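/- Let p∈(2,3], q>p−1, and let u be a nonnegative classical solution of u_t−Δu=|∇u|^p in Q_T with u=0 on Γ_T, having an isolated gradient blowup point at (0,0,T) and satisfying the monotonicity condition x·u_x≤0 in Q_T. Then there exist k∈(0,1) and x₁,y₁,σ>0 such that, with β=1/(p−1), u_x(x,y,t) + k·x·y^{−q(1−β)}·(1+y)·u(x,y,t)^q ≤ 0 for all (x,y,t)∈(0,x₁)×(0,y₁)×(T−σ,T). -/

import Mathlib

open Real Set Filter MeasureTheory

noncomputable section

/-- Partial derivative of `u(x,y,t)` with respect to `x`. -/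
def pdx (u : ℝ → ℝ → ℝ → ℝ) (x y t : ℝ) : ℝ := deriv (fun s => u s y t) x

/-- Partial derivative with respect to `y`. -/
def pdy (u : ℝ → ℝ → ℝ → ℝ) (x y t : ℝ) : ℝ := deriv (fun s => u x s t) y

/-- Partial derivative with respect to `t`. -/
def pdt (u : ℝ → ℝ → ℝ → ℝ) (x y t : ℝ) : ℝ := deriv (fun s => u x y s) t

/-- Second partial derivative with respect to `x`. -/
def pdxx (u : ℝ → ℝ → ℝ → ℝ) (x y t : ℝ) : ℝ := deriv (fun s => pdx u s y t) x

/-- Second partial derivative with respect to `y`. -/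
def pdyy (u : ℝ → ℝ → ℝ → ℝ) (x y t : ℝ) : ℝ := deriv (fun s => pdy u x s t) y

/-- Mixed second partial derivative `u_{xy}` (first `x`, then `y`). -/
def pdxy (u : ℝ → ℝ → ℝ → ℝ) (x y t : ℝ) : ℝ := deriv (fun s => pdx u x s t) y

/-- The norm of the spatial gradient, `|∇u| = (u_x² + u_y²)^{1/2}`. -/
def gradNorm (u : ℝ → ℝ → ℝ → ℝ) (x y t : ℝ) : ℝ :=
  Real.sqrt ((pdx u x y t) ^ 2 + (pdy u x y t) ^ 2)

/-- `C^{2,1}`-type regularity of `u` at the point `(x,y,t)`: twice (continuously)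
differentiable in the space variables and once in time. -/
def C21At (u : ℝ → ℝ → ℝ → ℝ) (x y t : ℝ) : Prop :=
  DifferentiableAt ℝ (fun s => u s y t) x ∧
  DifferentiableAt ℝ (fun s => u x s t) y ∧
  DifferentiableAt ℝ (fun s => u x y s) t ∧
  DifferentiableAt ℝ (fun s => pdx u s y t) x ∧
  DifferentiableAt ℝ (fun s => pdy u x s t) y ∧
  DifferentiableAt ℝ (fun s => pdx u x s t) y ∧
  ContinuousAt (fun q : ℝ × ℝ × ℝ => u q.1 q.2.1 q.2.2) (x, y, t) ∧
  ContinuousAt (fun q : ℝ × ℝ × ℝ => pdx u q.1 q.2.1 q.2.2) (x, y, t) ∧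
  ContinuousAt (fun q : ℝ × ℝ × ℝ => pdy u q.1 q.2.1 q.2.2) (x, y, t) ∧
  ContinuousAt (fun q : ℝ × ℝ × ℝ => pdt u q.1 q.2.1 q.2.2) (x, y, t) ∧
  ContinuousAt (fun q : ℝ × ℝ × ℝ => pdxx u q.1 q.2.1 q.2.2) (x, y, t) ∧
  ContinuousAt (fun q : ℝ × ℝ × ℝ => pdyy u q.1 q.2.1 q.2.2) (x, y, t) ∧
  ContinuousAt (fun q : ℝ × ℝ × ℝ => pdxy u q.1 q.2.1 q.2.2) (x, y, t)

/-- `u` is a nonnegative classical solution of `u_t - Δu = |∇u|^p` in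
`Q_T = ω × (0,T)`, `ω = (-L,L) × (0,L)`, with `u = 0` on `Γ_T = (-L,L) × {0} × (0,T)`. -/
structure ClassicalSolution (p L T : ℝ) (u : ℝ → ℝ → ℝ → ℝ) : Prop where
  nonneg : ∀ ⦃x y t : ℝ⦄, |x| ≤ L → y ∈ Icc (0:ℝ) L → t ∈ Ioo 0 T → 0 ≤ u x y t
  smooth : ∀ ⦃x y t : ℝ⦄, |x| ≤ L → y ∈ Icc (0:ℝ) L → t ∈ Ioo 0 T → C21At u x y t
  pde : ∀ ⦃x y t : ℝ⦄, |x| < L → y ∈ Ioo (0:ℝ) L → t ∈ Ioo 0 T →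
    pdt u x y t - (pdxx u x y t + pdyy u x y t) = gradNorm u x y t ^ p
  bc : ∀ ⦃x t : ℝ⦄, |x| < L → t ∈ Ioo 0 T → u x 0 t = 0

/-- `u` has an isolated gradient blow-up point at `(0,0,T)`:
`limsup |∇u| = ∞` at `(0,0,T)` while `∇u` stays bounded on `K × (0,T)` for every
compact `K ⊆ ω̄ \ {(0,0)}`. -/
structure IsolatedGBU (L T : ℝ) (u : ℝ → ℝ → ℝ → ℝ) : Prop where
  blowup : ∀ M : ℝ, ∀ δ > (0:ℝ), ∃ x y t : ℝ, |x| ≤ L ∧ y ∈ Icc (0:ℝ) L ∧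
    t ∈ Ioo 0 T ∧ |x| < δ ∧ |y| < δ ∧ T - δ < t ∧ M < gradNorm u x y t
  bounded : ∀ K : Set (ℝ × ℝ), IsCompact K →
    K ⊆ (Icc (-L) L ×ˢ Icc (0:ℝ) L) \ {((0:ℝ), (0:ℝ))} →
    ∃ M : ℝ, ∀ q ∈ K, ∀ t ∈ Ioo (0:ℝ) T, gradNorm u q.1 q.2 t ≤ M

/-- `u` extends as a `C^{2,1}` function to `(ω̄' × [T/2,T]) \ {(0,0,T)}`,
`ω' = (-L/2,L/2) × (0,L/2)`; values and derivatives at `t = T` refer to this extension. -/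
def ExtC21 (L T : ℝ) (u : ℝ → ℝ → ℝ → ℝ) : Prop :=
  ∀ ⦃x y t : ℝ⦄, |x| ≤ L / 2 → y ∈ Icc (0:ℝ) (L / 2) → t ∈ Icc (T / 2) T →
    ¬(x = 0 ∧ y = 0 ∧ t = T) → C21At u x y t

/-- The monotonicity condition `x·u_x ≤ 0` in `Q_T`. -/
def MonCond (L T : ℝ) (u : ℝ → ℝ → ℝ → ℝ) : Prop :=
  ∀ ⦃x y t : ℝ⦄, |x| < L → y ∈ Ioo (0:ℝ) L → t ∈ Ioo 0 T → x * pdx u x y t ≤ 0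

section

lemma max_second_deriv {f f' : ℝ → ℝ} {x a : ℝ} (hm : IsLocalMax f x)
    (h1 : ∀ᶠ s in nhds x, HasDerivAt f (f' s) s) (h2 : HasDerivAt f' a x) :
    f' x = 0 ∧ a ≤ 0 := by
  have hx : f' x = 0 := hm.hasDerivAt_eq_zero h1.self_of_nhds
  refine ⟨hx, ?_⟩
  by_contra ha
  push Not at ha
  have hd : deriv f =ᶠ[nhds x] f' := h1.mono (fun s hs => hs.deriv)
  have e2 : deriv (deriv f) x = a := by rw [hd.deriv_eq]; exact h2.deriv
  have hmin := isLocalMin_of_deriv_deriv_pos (f := f) (x₀ := x) (by rw [e2]; exact ha)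
    (by rw [hd.self_of_nhds]; exact hx) h1.self_of_nhds.continuousAt
  have hconst : f =ᶠ[nhds x] fun _ => f x := by
    filter_upwards [hm, hmin] with s a b using le_antisymm a b
  have : deriv f =ᶠ[nhds x] fun _ => 0 := by
    have := hconst.deriv
    simpa using this
  rw [this.deriv_eq] at e2
  simp at e2
  linarith

lemma maxP {w : ℝ → ℝ → ℝ → ℝ} {x0 x1 y0 y1 s0 s1 ε b : ℝ} 
    (hc : ContinuousOn (fun q : ℝ × ℝ × ℝ => w q.1 q.2.1 q.2.2)
      (Icc x0 x1 ×ˢ Icc y0 y1 ×ˢ Icc s0 s1))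
    (hb : ∀ x ∈ Icc x0 x1, ∀ y ∈ Icc y0 y1, ∀ t ∈ Icc s0 s1,
      (x = x0 ∨ x = x1 ∨ y = y0 ∨ y = y1 ∨ t = s0) → w x y t ≤ b)
    (hε : 0 < ε)
    (hi : ∀ x ∈ Ioo x0 x1, ∀ y ∈ Ioo y0 y1, ∀ t ∈ Ioc s0 s1, b < w x y t →
      IsLocalMax (fun s => w s y t) x → IsLocalMax (fun s => w x s t) y →
      ∃ d < ε, HasDerivAt (fun s => w x y s) d t) :
    ∀ x ∈ Icc x0 x1, ∀ y ∈ Icc y0 y1, ∀ t ∈ Icc s0 s1, w x y t ≤ b + ε * (t - s0) := by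
  intro x hx y hy t ht
  have hcpt : IsCompact (Icc x0 x1 ×ˢ Icc y0 y1 ×ˢ Icc s0 s1) :=
    isCompact_Icc.prod (isCompact_Icc.prod isCompact_Icc)
  have hne : (Icc x0 x1 ×ˢ Icc y0 y1 ×ˢ Icc s0 s1).Nonempty := ⟨(x, y, t), hx, hy, ht⟩
  obtain ⟨⟨X, Y, S⟩, ⟨hX, hY, hS⟩, hmax⟩ := hcpt.exists_isMaxOn hne
    (f := fun q : ℝ × ℝ × ℝ => w q.1 q.2.1 q.2.2 - ε * (q.2.2 - s0))
    (hc.sub (by fun_prop))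
  have hM : ∀ x ∈ Icc x0 x1, ∀ y ∈ Icc y0 y1, ∀ t ∈ Icc s0 s1,
      w x y t - ε * (t - s0) ≤ w X Y S - ε * (S - s0) := fun x hx y hy t ht =>
    hmax (show (x, y, t) ∈ _ from ⟨hx, hy, ht⟩)
  have hkey : w X Y S - ε * (S - s0) ≤ b := by
    by_contra hcon
    push Not at hcon
    simp only at hX hY hS
    have hSp : 0 ≤ ε * (S - s0) := mul_nonneg hε.le (by linarith [hS.1])
    have hwb : b < w X Y S := by linarith
    have hnb : ¬ (X = x0 ∨ X = x1 ∨ Y = y0 ∨ Y = y1 ∨ S = s0) := fun hh =>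
      absurd (hb X hX Y hY S hS hh) (by linarith)
    push Not at hnb
    obtain ⟨n1, n2, n3, n4, n5⟩ := hnb
    have hX' : X ∈ Ioo x0 x1 := ⟨lt_of_le_of_ne hX.1 (Ne.symm n1), lt_of_le_of_ne hX.2 n2⟩
    have hY' : Y ∈ Ioo y0 y1 := ⟨lt_of_le_of_ne hY.1 (Ne.symm n3), lt_of_le_of_ne hY.2 n4⟩
    have hS' : S ∈ Ioc s0 s1 := ⟨lt_of_le_of_ne hS.1 (Ne.symm n5), hS.2⟩
    obtain ⟨d, hd, hder⟩ := hi X hX' Y hY' S hS' hwb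
      (by filter_upwards [Icc_mem_nhds hX'.1 hX'.2] with s hs
          have := hM s hs Y hY S hS
          linarith)
      (by filter_upwards [Icc_mem_nhds hY'.1 hY'.2] with s hs
          have := hM X hX s hs S hS
          linarith)
    have hder2 : HasDerivAt (fun s => w X Y s - ε * (s - s0)) (d - ε) S := by
      have h2 : HasDerivAt (fun s => ε * (s - s0)) (ε * 1) S :=
        ((hasDerivAt_id S).sub_const s0).const_mul ε
      rw [mul_one] at h2
      exact hder.sub h2
    have hneg : d - ε < 0 := by linarith
    have hsl := hder2.tendsto_slope
    have hev : ∀ᶠ s in nhdsWithin S {S}ᶜ, slope (fun s => w X Y s - ε * (s - s0)) S s < 0 :=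
      hsl.eventually (gt_mem_nhds hneg)
    have hev2 : ∀ᶠ s in nhdsWithin S (Iio S), slope (fun s => w X Y s - ε * (s - s0)) S s < 0 :=
      hev.filter_mono (nhdsWithin_mono _ (fun s hs => ne_of_lt hs))
    have hev3 : ∀ᶠ s in nhdsWithin S (Iio S), s ∈ Ico s0 S := Ico_mem_nhdsLT hS'.1
    obtain ⟨s, hs1, hs2⟩ := (hev2.and hev3).exists
    have hle := hM X hX Y hY s ⟨hs2.1, hs2.2.le.trans hS.2⟩
    rw [slope_def_field] at hs1
    have : 0 ≤ (w X Y s - ε * (s - s0) - (w X Y S - ε * (S - s0))) / (s - S) :=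
      div_nonneg_of_nonpos (by linarith) (by linarith [hs2.2])
    linarith
  have := hM x hx y hy t ht
  linarith

lemma rpow_tangent {p r R : ℝ} (hp : 1 < p) (hr : 0 ≤ r) (hR : 0 ≤ R) :
    R ^ p + p * R ^ (p - 1) * (r - R) ≤ r ^ p := by
  rcases hR.eq_or_lt with h | h
  · subst h
    rw [Real.zero_rpow (by linarith), Real.zero_rpow (by linarith)]
    simp; positivity
  · have h1 := one_add_mul_self_le_rpow_one_add (s := r / R - 1) (by
      have : 0 ≤ r / R := by positivity
      linarith) hp.le
    have h2 : (1 + (r / R - 1)) = r / R := by ring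
    rw [h2, Real.div_rpow hr hR, le_div_iff₀ (by positivity)] at h1
    have h3 : R ^ p = R ^ (p - 1) * R := by
      rw [← Real.rpow_add_one h.ne']; congr 1; ring
    have h4 : (1 + p * (r / R - 1)) * R ^ p = R ^ p + p * R ^ (p - 1) * (r - R) := by
      rw [h3]; field_simp
    linarith

/-- Convexity of `|.|^p` in the plane. -/
lemma norm_tangent {p a1 a2 b1 b2 : ℝ} (hp : 2 < p) :
    √(b1 ^ 2 + b2 ^ 2) ^ p - √(a1 ^ 2 + a2 ^ 2) ^ p ≤
      p * √(b1 ^ 2 + b2 ^ 2) ^ (p - 2) * (b1 * (b1 - a1) + b2 * (b2 - a2)) := by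
  set R := √(b1 ^ 2 + b2 ^ 2) with hR
  set r := √(a1 ^ 2 + a2 ^ 2) with hr
  have hR0 : 0 ≤ R := Real.sqrt_nonneg _
  have hr0 : 0 ≤ r := Real.sqrt_nonneg _
  have hR2 : R ^ 2 = b1 ^ 2 + b2 ^ 2 := Real.sq_sqrt (by positivity)
  have hr2 : r ^ 2 = a1 ^ 2 + a2 ^ 2 := Real.sq_sqrt (by positivity)
  have hcs : b1 * a1 + b2 * a2 ≤ R * r := by
    refine (abs_le.1 (abs_le_of_sq_le_sq ?_ (by positivity))).2
    nlinarith [sq_nonneg (b1 * a2 - b2 * a1)]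
  have ht := rpow_tangent (p := p) (by linarith) hr0 hR0
  have h3 : R ^ (p - 1) = R ^ (p - 2) * R := by
    rcases hR0.eq_or_lt with h | h
    · rw [← h, Real.zero_rpow (by linarith), Real.zero_rpow (by linarith)]; simp
    · rw [← Real.rpow_add_one h.ne']; congr 1; ring
  have h4 : 0 ≤ p * R ^ (p - 2) := by positivity
  rw [h3] at ht
  nlinarith [mul_le_mul_of_nonneg_left hcs h4]

lemma N_lemma {p a e f1 f2 : ℝ} (hp : 2 < p) (he : 0 ≤ e) (h1 : 0 ≤ f1) (h12 : f1 ≤ f2) :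
    f2 ^ p - f1 ^ p ≤ √(a ^ 2 + (e + f2) ^ 2) ^ p - √(a ^ 2 + (e + f1) ^ 2) ^ p := by
  -- monotone of s ↦ N (e+s) - s^p on [0,∞)
  have key : MonotoneOn (fun s : ℝ => (a ^ 2 + (e + s) ^ 2) ^ (p / 2) - s ^ p) (Ici 0) := by
    have hd : ∀ s : ℝ, HasDerivAt (fun s : ℝ => (a ^ 2 + (e + s) ^ 2) ^ (p / 2) - s ^ p)
        ((2 * (e + s)) * (p / 2) * (a ^ 2 + (e + s) ^ 2) ^ (p / 2 - 1) - p * s ^ (p - 1)) s := by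
      intro s
      have hin : HasDerivAt (fun s : ℝ => a ^ 2 + (e + s) ^ 2) (2 * (e + s)) s := by
        have := (((hasDerivAt_id s).const_add e).pow 2).const_add (a ^ 2)
        simpa using this
      exact (hin.rpow_const (p := p / 2) (Or.inr (by linarith))).sub
        (Real.hasDerivAt_rpow_const (Or.inr (by linarith)))
    apply monotoneOn_of_deriv_nonneg (convex_Ici 0)
    · exact fun s _ => (hd s).continuousAt.continuousWithinAt
    · exact fun s _ => (hd s).differentiableAt.differentiableWithinAt
    · intro s hs
      rw [interior_Ici, mem_Ioi] at hs
      rw [(hd s).deriv]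
      have e1 : (s ^ 2) ^ (p / 2 - 1) ≤ (a ^ 2 + (e + s) ^ 2) ^ (p / 2 - 1) :=
        Real.rpow_le_rpow (by positivity) (by nlinarith [sq_nonneg a]) (by linarith)
      have e2 : (s ^ 2) ^ (p / 2 - 1) * s = s ^ (p - 1) := by
        rw [← Real.rpow_natCast, ← Real.rpow_mul hs.le, ← Real.rpow_add_one hs.ne']
        congr 1; push_cast; ring
      have e3 : (s ^ 2) ^ (p / 2 - 1) * s ≤ (a ^ 2 + (e + s) ^ 2) ^ (p / 2 - 1) * (e + s) := by
        apply mul_le_mul e1 (by linarith) hs.le (by positivity)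
      rw [e2] at e3
      have : 2 * (e + s) * (p / 2) * (a ^ 2 + (e + s) ^ 2) ^ (p / 2 - 1) - p * s ^ (p - 1)
        = p * ((a ^ 2 + (e + s) ^ 2) ^ (p / 2 - 1) * (e + s) - s ^ (p - 1)) := by ring
      rw [this]
      apply mul_nonneg (by linarith) (by linarith)
  have := key (show f1 ∈ Ici 0 from h1) (show f2 ∈ Ici 0 from h1.trans h12) h12
  have hs : ∀ z : ℝ, 0 ≤ z → √z ^ p = z ^ (p / 2) := by
    intro z hz
    rw [Real.sqrt_eq_rpow, ← Real.rpow_mul hz]; congr 1; ring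
  rw [hs _ (by positivity), hs _ (by positivity)]
  simp only at this
  linarith

end

section

section Basic

variable {p L T : ℝ} {u : ℝ → ℝ → ℝ → ℝ}

lemma cs_dx (hsol : ClassicalSolution p L T u) {x y t : ℝ} (hx : |x| ≤ L)
    (hy : y ∈ Icc (0:ℝ) L) (ht : t ∈ Ioo 0 T) :
    HasDerivAt (fun s => u s y t) (pdx u x y t) x := (hsol.smooth hx hy ht).1.hasDerivAt

lemma cs_dy (hsol : ClassicalSolution p L T u) {x y t : ℝ} (hx : |x| ≤ L)
    (hy : y ∈ Icc (0:ℝ) L) (ht : t ∈ Ioo 0 T) :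
    HasDerivAt (fun s => u x s t) (pdy u x y t) y := (hsol.smooth hx hy ht).2.1.hasDerivAt

lemma cs_dt (hsol : ClassicalSolution p L T u) {x y t : ℝ} (hx : |x| ≤ L)
    (hy : y ∈ Icc (0:ℝ) L) (ht : t ∈ Ioo 0 T) :
    HasDerivAt (fun s => u x y s) (pdt u x y t) t := (hsol.smooth hx hy ht).2.2.1.hasDerivAt

lemma cs_dxx (hsol : ClassicalSolution p L T u) {x y t : ℝ} (hx : |x| ≤ L)
    (hy : y ∈ Icc (0:ℝ) L) (ht : t ∈ Ioo 0 T) :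
    HasDerivAt (fun s => pdx u s y t) (pdxx u x y t) x :=
  (hsol.smooth hx hy ht).2.2.2.1.hasDerivAt

lemma cs_dyy (hsol : ClassicalSolution p L T u) {x y t : ℝ} (hx : |x| ≤ L)
    (hy : y ∈ Icc (0:ℝ) L) (ht : t ∈ Ioo 0 T) :
    HasDerivAt (fun s => pdy u x s t) (pdyy u x y t) y :=
  (hsol.smooth hx hy ht).2.2.2.2.1.hasDerivAt

lemma cs_cu (hsol : ClassicalSolution p L T u) {x y t : ℝ} (hx : |x| ≤ L)
    (hy : y ∈ Icc (0:ℝ) L) (ht : t ∈ Ioo 0 T) :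
    ContinuousAt (fun q : ℝ × ℝ × ℝ => u q.1 q.2.1 q.2.2) (x, y, t) :=
  (hsol.smooth hx hy ht).2.2.2.2.2.2.1

lemma cs_cx (hsol : ClassicalSolution p L T u) {x y t : ℝ} (hx : |x| ≤ L)
    (hy : y ∈ Icc (0:ℝ) L) (ht : t ∈ Ioo 0 T) :
    ContinuousAt (fun q : ℝ × ℝ × ℝ => pdx u q.1 q.2.1 q.2.2) (x, y, t) :=
  (hsol.smooth hx hy ht).2.2.2.2.2.2.2.1

lemma cs_cy (hsol : ClassicalSolution p L T u) {x y t : ℝ} (hx : |x| ≤ L)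
    (hy : y ∈ Icc (0:ℝ) L) (ht : t ∈ Ioo 0 T) :
    ContinuousAt (fun q : ℝ × ℝ × ℝ => pdy u q.1 q.2.1 q.2.2) (x, y, t) :=
  (hsol.smooth hx hy ht).2.2.2.2.2.2.2.2.1

lemma abs_pdx_le (x y t : ℝ) : |pdx u x y t| ≤ gradNorm u x y t := by
  unfold gradNorm
  exact Real.abs_le_sqrt (by nlinarith [sq_nonneg (pdy u x y t)])

lemma abs_pdy_le (x y t : ℝ) : |pdy u x y t| ≤ gradNorm u x y t := by
  unfold gradNorm
  exact Real.abs_le_sqrt (by nlinarith [sq_nonneg (pdx u x y t)])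

lemma gradNorm_nonneg (x y t : ℝ) : 0 ≤ gradNorm u x y t := Real.sqrt_nonneg _

lemma gradNorm_le (x y t : ℝ) : gradNorm u x y t ≤ |pdx u x y t| + |pdy u x y t| := by
  unfold gradNorm
  rw [Real.sqrt_le_left (by positivity)]
  nlinarith [sq_abs (pdx u x y t), sq_abs (pdy u x y t), abs_nonneg (pdx u x y t),
    abs_nonneg (pdy u x y t), mul_nonneg (abs_nonneg (pdx u x y t)) (abs_nonneg (pdy u x y t))]

/-- The closed domain times a time interval. -/
def box (L t1 t2 : ℝ) : Set (ℝ × ℝ × ℝ) := Icc (-L) L ×ˢ Icc 0 L ×ˢ Icc t1 t2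

lemma box_compact (L t1 t2 : ℝ) : IsCompact (box L t1 t2) :=
    isCompact_Icc.prod (isCompact_Icc.prod isCompact_Icc)

lemma box_cu (hsol : ClassicalSolution p L T u) {t1 t2 : ℝ} (h1 : 0 < t1) (h2 : t2 < T) :
    ContinuousOn (fun q : ℝ × ℝ × ℝ => u q.1 q.2.1 q.2.2) (box L t1 t2) := by
  rintro ⟨x, y, t⟩ ⟨hx, hy, ht⟩
  exact (cs_cu hsol (abs_le.2 hx) hy ⟨h1.trans_le ht.1, ht.2.trans_lt h2⟩).continuousWithinAt

lemma box_cx (hsol : ClassicalSolution p L T u) {t1 t2 : ℝ} (h1 : 0 < t1) (h2 : t2 < T) :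
    ContinuousOn (fun q : ℝ × ℝ × ℝ => pdx u q.1 q.2.1 q.2.2) (box L t1 t2) := by
  rintro ⟨x, y, t⟩ ⟨hx, hy, ht⟩
  exact (cs_cx hsol (abs_le.2 hx) hy ⟨h1.trans_le ht.1, ht.2.trans_lt h2⟩).continuousWithinAt

lemma box_cy (hsol : ClassicalSolution p L T u) {t1 t2 : ℝ} (h1 : 0 < t1) (h2 : t2 < T) :
    ContinuousOn (fun q : ℝ × ℝ × ℝ => pdy u q.1 q.2.1 q.2.2) (box L t1 t2) := by
  rintro ⟨x, y, t⟩ ⟨hx, hy, ht⟩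
  exact (cs_cy hsol (abs_le.2 hx) hy ⟨h1.trans_le ht.1, ht.2.trans_lt h2⟩).continuousWithinAt

lemma box_cg (hsol : ClassicalSolution p L T u) {t1 t2 : ℝ} (h1 : 0 < t1) (h2 : t2 < T) :
    ContinuousOn (fun q : ℝ × ℝ × ℝ => gradNorm u q.1 q.2.1 q.2.2) (box L t1 t2) := by
  unfold gradNorm
  exact (((box_cx hsol h1 h2).pow 2).add ((box_cy hsol h1 h2).pow 2)).sqrt

lemma grad_bdd_compact (hsol : ClassicalSolution p L T u) {t1 t2 : ℝ} (h1 : 0 < t1)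
    (h2 : t2 < T) : ∃ M > 0, ∀ x y t : ℝ, |x| ≤ L → y ∈ Icc 0 L → t ∈ Icc t1 t2 →
      gradNorm u x y t ≤ M := by
  obtain ⟨M, hM⟩ := ((box_compact L t1 t2).image_of_continuousOn (box_cg hsol h1 h2)).bddAbove
  refine ⟨max M 1, by positivity, fun x y t hx hy ht => le_max_of_le_left (hM ?_)⟩
  exact ⟨(x, y, t), ⟨abs_le.1 hx, hy, ht⟩, rfl⟩

/-- Uniform continuity on the box, in a convenient form. -/
lemma box_unif {f : ℝ × ℝ × ℝ → ℝ} {L t1 t2 : ℝ} (hf : ContinuousOn f (box L t1 t2))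
    {η : ℝ} (hη : 0 < η) : ∃ δ > 0, ∀ x y t x' y' : ℝ, |x| ≤ L → y ∈ Icc 0 L → |x'| ≤ L →
      y' ∈ Icc 0 L → t ∈ Icc t1 t2 → |x - x'| < δ → |y - y'| < δ →
      |f (x, y, t) - f (x', y', t)| < η := by
  have := (box_compact L t1 t2).uniformContinuousOn_of_continuous hf
  rw [Metric.uniformContinuousOn_iff] at this
  obtain ⟨δ, hδ, h⟩ := this η hη
  refine ⟨δ, hδ, fun x y t x' y' hx hy hx' hy' ht h1 h2 => ?_⟩
  have := h (x, y, t) ⟨abs_le.1 hx, hy, ht⟩ (x', y', t) ⟨abs_le.1 hx', hy', ht⟩ (by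
    simp only [Prod.dist_eq, Real.dist_eq, sub_self, abs_zero]
    exact max_lt h1 (max_lt h2 hδ))
  rwa [Real.dist_eq] at this

lemma lipx (hsol : ClassicalSolution p L T u) {a b y t M : ℝ} (ha : |a| ≤ L) (hb : |b| ≤ L)
    (hy : y ∈ Icc 0 L) (ht : t ∈ Ioo 0 T)
    (hM : ∀ s ∈ uIcc a b, gradNorm u s y t ≤ M) : |u b y t - u a y t| ≤ M * |b - a| := by
  have := Convex.norm_image_sub_le_of_norm_hasDerivWithin_le (f := fun s => u s y t)
    (f' := fun s => pdx u s y t) (s := uIcc a b) (x := a) (y := b) (C := M)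
    (fun s hs => (cs_dx hsol (by
      rw [abs_le] at *
      rcases le_total a b with h | h
      · rw [uIcc_of_le h] at hs; constructor <;> linarith [hs.1, hs.2]
      · rw [uIcc_of_ge h] at hs; constructor <;> linarith [hs.1, hs.2]) hy ht).hasDerivWithinAt)
    (fun s hs => (abs_pdx_le s y t).trans (hM s hs)) (convex_uIcc a b) left_mem_uIcc right_mem_uIcc
  simpa using this

lemma lipy (hsol : ClassicalSolution p L T u) {a b x t M : ℝ} (ha : a ∈ Icc 0 L)
    (hb : b ∈ Icc 0 L) (hx : |x| ≤ L) (ht : t ∈ Ioo 0 T)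
    (hM : ∀ s ∈ uIcc a b, gradNorm u x s t ≤ M) : |u x b t - u x a t| ≤ M * |b - a| := by
  have := Convex.norm_image_sub_le_of_norm_hasDerivWithin_le (f := fun s => u x s t)
    (f' := fun s => pdy u x s t) (s := uIcc a b) (x := a) (y := b) (C := M)
    (fun s hs => (cs_dy hsol hx (by
      rcases le_total a b with h | h
      · rw [uIcc_of_le h] at hs; constructor <;> linarith [hs.1, hs.2, ha.1, hb.2]
      · rw [uIcc_of_ge h] at hs; constructor <;> linarith [hs.1, hs.2, ha.2, hb.1])
      ht).hasDerivWithinAt)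
    (fun s hs => (abs_pdy_le x s t).trans (hM s hs)) (convex_uIcc a b) left_mem_uIcc right_mem_uIcc
  simpa using this

lemma transP (hsol : ClassicalSolution p L T u) {hx hy x0 x1 y0 y1 s0 s1 ε b : ℝ}
    {Φ : ℝ → ℝ → ℝ → ℝ}
    (a1 : -L ≤ x0) (a2 : x1 ≤ L) (a3 : -L ≤ x0 + hx) (a4 : x1 + hx ≤ L)
    (b1 : 0 ≤ y0) (b2 : y1 ≤ L) (b3 : 0 ≤ y0 + hy) (b4 : y1 + hy ≤ L)
    (c1 : 0 < s0) (c2 : s1 < T)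
    (hΦ : ContinuousOn (fun q : ℝ × ℝ × ℝ => Φ q.1 q.2.1 q.2.2)
      (Icc x0 x1 ×ˢ Icc y0 y1 ×ˢ Icc s0 s1))
    (hb : ∀ x ∈ Icc x0 x1, ∀ y ∈ Icc y0 y1, ∀ t ∈ Icc s0 s1,
      (x = x0 ∨ x = x1 ∨ y = y0 ∨ y = y1 ∨ t = s0) →
      u (x + hx) (y + hy) t - u x y t + Φ x y t ≤ b)
    (hε : 0 < ε)
    (hi : ∀ x ∈ Ioo x0 x1, ∀ y ∈ Ioo y0 y1, ∀ t ∈ Ioc s0 s1,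
      b < u (x + hx) (y + hy) t - u x y t + Φ x y t →
      ∃ A B : ℝ → ℝ, ∃ Axx Byy At : ℝ,
        (∀ᶠ s in nhds x, HasDerivAt (fun s => Φ s y t) (A s) s) ∧ HasDerivAt A Axx x ∧
        (∀ᶠ s in nhds y, HasDerivAt (fun s => Φ x s t) (B s) s) ∧ HasDerivAt B Byy y ∧
        HasDerivAt (fun s => Φ x y s) At t ∧
        (pdx u (x + hx) (y + hy) t - pdx u x y t = - A x →
         pdy u (x + hx) (y + hy) t - pdy u x y t = - B y →
         At - Axx - Byy + gradNorm u (x + hx) (y + hy) t ^ p - gradNorm u x y t ^ p < ε)) :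
    ∀ x ∈ Icc x0 x1, ∀ y ∈ Icc y0 y1, ∀ t ∈ Icc s0 s1,
      u (x + hx) (y + hy) t - u x y t + Φ x y t ≤ b + ε * (t - s0) := by
  refine maxP (w := fun x y t => u (x + hx) (y + hy) t - u x y t + Φ x y t) ?_ hb hε ?_
  · refine ContinuousOn.add (ContinuousOn.sub ?_ ?_) hΦ
    · refine (box_cu hsol c1 c2).comp (f := fun q : ℝ × ℝ × ℝ => (q.1 + hx, q.2.1 + hy, q.2.2))
        (by fun_prop) ?_
      rintro ⟨x, y, t⟩ ⟨h1, h2, h3⟩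
      simp only at h1 h2 h3
      exact ⟨⟨by linarith [h1.1], by linarith [h1.2]⟩, ⟨by linarith [h2.1], by linarith [h2.2]⟩, h3⟩
    · refine (box_cu hsol c1 c2).mono ?_
      rintro ⟨x, y, t⟩ ⟨h1, h2, h3⟩
      simp only at h1 h2 h3
      exact ⟨⟨by linarith [h1.1], by linarith [h1.2]⟩, ⟨by linarith [h2.1], by linarith [h2.2]⟩, h3⟩
  · intro x hxm y hym t htm hw m1 m2
    obtain ⟨A, B, Axx, Byy, At, d1, d2, d3, d4, d5, hfin⟩ := hi x hxm y hym t htm hw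
    have ht : t ∈ Ioo 0 T := ⟨c1.trans htm.1, htm.2.trans_lt c2⟩
    have X1 : ∀ s ∈ Ioo x0 x1, |s| < L ∧ |s + hx| < L := fun s hs =>
      ⟨abs_lt.2 ⟨by linarith [hs.1], by linarith [hs.2]⟩,
       abs_lt.2 ⟨by linarith [hs.1], by linarith [hs.2]⟩⟩
    have Y1 : ∀ s ∈ Ioo y0 y1, s ∈ Ioo 0 L ∧ s + hy ∈ Ioo 0 L := fun s hs =>
      ⟨⟨by linarith [hs.1], by linarith [hs.2]⟩, ⟨by linarith [hs.1], by linarith [hs.2]⟩⟩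
    have hX := X1 x hxm
    have hY := Y1 y hym
    have hYc := Ioo_subset_Icc_self hY.1
    have hYc' := Ioo_subset_Icc_self hY.2
    obtain ⟨e1, e2⟩ := max_second_deriv m1
      (f' := fun s => pdx u (s + hx) (y + hy) t - pdx u s y t + A s)
      (a := pdxx u (x + hx) (y + hy) t - pdxx u x y t + Axx)
      (by
        filter_upwards [d1, Ioo_mem_nhds hxm.1 hxm.2] with s hs1 hs2
        have hs3 := X1 s hs2
        exact ((HasDerivAt.comp_add_const s hx (cs_dx hsol hs3.2.le hYc' ht)).sub
          (cs_dx hsol hs3.1.le hYc ht)).add hs1)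
      (((HasDerivAt.comp_add_const x hx (cs_dxx hsol hX.2.le hYc' ht)).sub
          (cs_dxx hsol hX.1.le hYc ht)).add d2)
    obtain ⟨e3, e4⟩ := max_second_deriv m2
      (f' := fun s => pdy u (x + hx) (s + hy) t - pdy u x s t + B s)
      (a := pdyy u (x + hx) (y + hy) t - pdyy u x y t + Byy)
      (by
        filter_upwards [d3, Ioo_mem_nhds hym.1 hym.2] with s hs1 hs2
        have hs3 := Y1 s hs2
        exact ((HasDerivAt.comp_add_const s hy
          (cs_dy hsol hX.2.le (Ioo_subset_Icc_self hs3.2) ht)).sub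
          (cs_dy hsol hX.1.le (Ioo_subset_Icc_self hs3.1) ht)).add hs1)
      (((HasDerivAt.comp_add_const y hy (cs_dyy hsol hX.2.le hYc' ht)).sub
          (cs_dyy hsol hX.1.le hYc ht)).add d4)
    have hf := hfin (by linarith) (by linarith)
    refine ⟨pdt u (x + hx) (y + hy) t - pdt u x y t + At, ?_,
      ((cs_dt hsol hX.2.le hYc' ht).sub (cs_dt hsol hX.1.le hYc ht)).add d5⟩
    have p1 := hsol.pde hX.1 hY.1 ht
    have p2 := hsol.pde hX.2 hY.2 ht
    linarith

end Basic

end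

section

lemma eps_lim {a b c : ℝ} (h : ∀ ε > 0, a ≤ b + ε * c) : a ≤ b := by
  by_contra hc
  push Not at hc
  rcases le_or_gt c 0 with h0 | h0
  · have := h 1 one_pos; linarith
  · have := h ((a - b) / (2 * c)) (by apply div_pos <;> linarith)
    have e : (a - b) / (2 * c) * c = (a - b) / 2 := by field_simp
    rw [e] at this; linarith

lemma deriv_le_of {f : ℝ → ℝ} {f' x M : ℝ} (hf : HasDerivAt f f' x) {δ : ℝ} (hδ : 0 < δ)
    (h : ∀ s, 0 < s → s < δ → f (x + s) - f x ≤ M * s) : f' ≤ M := by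
  refine le_of_tendsto hf.tendsto_slope_zero_right ?_
  filter_upwards [Ioo_mem_nhdsGT hδ] with s hs
  rw [smul_eq_mul, inv_mul_le_iff₀ hs.1, mul_comm]
  exact h s hs.1 hs.2

lemma deriv_ge_of {f : ℝ → ℝ} {f' x M : ℝ} (hf : HasDerivAt f f' x) {δ : ℝ} (hδ : 0 < δ)
    (h : ∀ s, 0 < s → s < δ → f (x - s) - f x ≤ M * s) : -M ≤ f' := by
  have hg : HasDerivAt (fun s => f (x - s)) (-f') 0 := by
    have h1 : HasDerivAt (fun s : ℝ => x - s) (-1) 0 := by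
      simpa using (hasDerivAt_id (0:ℝ)).const_sub x
    have h2 : HasDerivAt f f' (x - 0) := by simpa using hf
    have h3 := h2.comp (0:ℝ) h1
    rw [mul_neg_one] at h3
    exact h3
  have := deriv_le_of hg hδ (M := M) (fun s h1 h2 => by simpa using h s h1 h2)
  linarith

section Est

variable {p L T : ℝ} {u : ℝ → ℝ → ℝ → ℝ}

lemma outer_bdd (hgbu : IsolatedGBU L T u) {ρ : ℝ} (hρ : 0 < ρ) :
    ∃ M > 0, ∀ x y t : ℝ, |x| ≤ L → y ∈ Icc 0 L → t ∈ Ioo 0 T → (ρ ≤ |x| ∨ ρ ≤ y) →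
      gradNorm u x y t ≤ M := by
  have hK : IsCompact ((Icc (-L) L ×ˢ Icc (0:ℝ) L) ∩ {q : ℝ × ℝ | ρ ≤ |q.1| ∨ ρ ≤ q.2}) := by
    refine (isCompact_Icc.prod isCompact_Icc).inter_right ?_
    have c1 : Continuous (fun q : ℝ × ℝ => |q.1|) := by fun_prop
    exact (isClosed_le continuous_const c1).union (isClosed_le continuous_const continuous_snd)
  obtain ⟨M, hM⟩ := hgbu.bounded _ hK (by
    rintro ⟨x, y⟩ ⟨h1, h2⟩
    refine ⟨h1, ?_⟩
    rintro h3
    simp only [mem_singleton_iff, Prod.mk.injEq] at h3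
    simp only [Set.mem_ofPred_eq, h3.1, h3.2, abs_zero] at h2
    rcases h2 with h2 | h2 <;> linarith)
  refine ⟨max M 1, by positivity, fun x y t hx hy ht h => le_max_of_le_left ?_⟩
  exact hM (x, y) ⟨⟨abs_le.1 hx, hy⟩, h⟩ t ht

lemma transConst (hsol : ClassicalSolution p L T u) {hx hy x0 x1 y0 y1 s0 s1 K : ℝ}
    (a1 : -L ≤ x0) (a2 : x1 ≤ L) (a3 : -L ≤ x0 + hx) (a4 : x1 + hx ≤ L)
    (b1 : 0 ≤ y0) (b2 : y1 ≤ L) (b3 : 0 ≤ y0 + hy) (b4 : y1 + hy ≤ L)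
    (c1 : 0 < s0) (c2 : s1 < T)
    (hb : ∀ x ∈ Icc x0 x1, ∀ y ∈ Icc y0 y1, ∀ t ∈ Icc s0 s1,
      (x = x0 ∨ x = x1 ∨ y = y0 ∨ y = y1 ∨ t = s0) →
      u (x + hx) (y + hy) t - u x y t ≤ K) :
    ∀ x ∈ Icc x0 x1, ∀ y ∈ Icc y0 y1, ∀ t ∈ Icc s0 s1,
      u (x + hx) (y + hy) t - u x y t ≤ K := by
  intro x hxm y hym t htm
  refine eps_lim (c := t - s0) (fun ε hε => ?_)
  have := transP hsol (Φ := fun _ _ _ => 0) (b := K) a1 a2 a3 a4 b1 b2 b3 b4 c1 c2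
    continuousOn_const (fun x hx y hy t ht h => by simpa using hb x hx y hy t ht h) hε
    (fun x _ y _ t _ _ => ⟨fun _ => 0, fun _ => 0, 0, 0, 0,
      Filter.Eventually.of_forall (fun s => hasDerivAt_const _ _), hasDerivAt_const _ _,
      Filter.Eventually.of_forall (fun s => hasDerivAt_const _ _), hasDerivAt_const _ _,
      hasDerivAt_const _ _, fun h1 h2 => by
        have : gradNorm u (x + hx) (y + hy) t = gradNorm u x y t := by
          unfold gradNorm
          rw [show pdx u (x + hx) (y + hy) t = pdx u x y t by linarith,
            show pdy u (x + hx) (y + hy) t = pdy u x y t by linarith]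
        rw [this]; linarith⟩) x hxm y hym t htm
  simpa using this

/-- boundary gradient constant for the box `[-L/2,L/2]×[0,L/2]×[T/2,T)`. -/
lemma bdry_const (hL : 0 < L) (hT : 0 < T) (hsol : ClassicalSolution p L T u)
    (hgbu : IsolatedGBU L T u) :
    ∃ M > 0, ∀ x y t : ℝ, |x| ≤ L → y ∈ Icc 0 L → t ∈ Ioo 0 T →
      (L / 4 ≤ |x| ∨ L / 4 ≤ y ∨ t = T / 2) → gradNorm u x y t ≤ M := by
  obtain ⟨M1, hM1, h1⟩ := outer_bdd hgbu (show 0 < L / 4 by linarith)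
  obtain ⟨M2, hM2, h2⟩ := grad_bdd_compact hsol (t1 := T / 2) (t2 := T / 2) (by linarith)
    (by linarith)
  refine ⟨max M1 M2, by positivity, fun x y t hx hy ht h => ?_⟩
  rcases h with h | h | h
  · exact le_max_of_le_left (h1 x y t hx hy ht (Or.inl h))
  · exact le_max_of_le_left (h1 x y t hx hy ht (Or.inr h))
  · exact le_max_of_le_right (h2 x y t hx hy (by rw [h]; exact ⟨le_rfl, le_rfl⟩))

/-- translation bound in `x`, `|h| ≤ L/4`. -/
lemma shift_x (hL : 0 < L) (hT : 0 < T) (hsol : ClassicalSolution p L T u) {M : ℝ}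
    (hM0 : 0 < M) (hM : ∀ x y t : ℝ, |x| ≤ L → y ∈ Icc 0 L → t ∈ Ioo 0 T →
      (L / 4 ≤ |x| ∨ L / 4 ≤ y ∨ t = T / 2) → gradNorm u x y t ≤ M) {h : ℝ} (hh : |h| ≤ L / 4) :
    ∀ x y t : ℝ, |x| ≤ L / 2 → y ∈ Icc 0 (L / 2) → t ∈ Ico (T / 2) T →
      u (x + h) y t - u x y t ≤ M * |h| := by
  intro x y t hx hy ht
  have hh' := abs_le.1 hh
  have := transConst hsol (hx := h) (hy := 0) (x0 := -(L / 2)) (x1 := L / 2) (y0 := 0)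
    (y1 := L / 2) (s0 := T / 2) (s1 := t) (K := M * |h|) (by linarith) (by linarith) (by linarith)
    (by linarith) le_rfl (by linarith) (by linarith) (by linarith) (by linarith) ht.2 (by
      intro x hx y hy s hs hbd
      rw [add_zero]
      have hsT : s ∈ Ioo 0 T := ⟨by linarith [hs.1], hs.2.trans_lt ht.2⟩
      have hxL : |x| ≤ L := abs_le.2 ⟨by linarith [hx.1], by linarith [hx.2]⟩
      have hxL' : |x + h| ≤ L := abs_le.2 ⟨by linarith [hx.1], by linarith [hx.2]⟩
      have hyL : y ∈ Icc 0 L := ⟨hy.1, by linarith [hy.2]⟩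
      have main : (∀ r ∈ uIcc x (x + h), (L / 4 ≤ |r| ∨ L / 4 ≤ y ∨ s = T / 2)) →
          u (x + h) y s - u x y s ≤ M * |h| := by
        intro hr
        have := lipx hsol (M := M) hxL hxL' hyL hsT (fun r hrm => hM r y s (by
          have := uIcc_subset_Icc (abs_le.1 hxL) (abs_le.1 hxL') hrm
          exact abs_le.2 this) hyL hsT (hr r hrm))
        rw [add_sub_cancel_left] at this
        exact (le_abs_self _).trans this
      have habs : ∀ r ∈ uIcc x (x + h), |r - x| ≤ L / 4 := by
        intro r hr
        have := abs_sub_left_of_mem_uIcc hr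
        rw [add_sub_cancel_left] at this
        linarith
      rcases hbd with h1 | h1 | h1 | h1 | h1
      · refine main (fun r hr => Or.inl ?_)
        have := abs_le.1 (habs r hr)
        rw [le_abs]; right; linarith
      · refine main (fun r hr => Or.inl ?_)
        have := abs_le.1 (habs r hr)
        rw [le_abs]; left; linarith
      · rw [h1, hsol.bc (abs_lt.2 ⟨by linarith [hx.1], by linarith [hx.2]⟩) hsT,
          hsol.bc (abs_lt.2 ⟨by linarith [hx.1], by linarith [hx.2]⟩) hsT]
        simp; positivity
      · exact main (fun r hr => Or.inr (Or.inl (by linarith)))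
      · exact main (fun r hr => Or.inr (Or.inr h1))) x (abs_le.1 hx) y hy t ⟨ht.1, le_rfl⟩
  simpa using this

lemma pdx_bdd (hL : 0 < L) (hT : 0 < T) (hsol : ClassicalSolution p L T u) {M : ℝ}
    (hM0 : 0 < M) (hM : ∀ x y t : ℝ, |x| ≤ L → y ∈ Icc 0 L → t ∈ Ioo 0 T →
      (L / 4 ≤ |x| ∨ L / 4 ≤ y ∨ t = T / 2) → gradNorm u x y t ≤ M) :
    ∀ x y t : ℝ, |x| ≤ L / 2 → y ∈ Icc 0 (L / 2) → t ∈ Ico (T / 2) T → |pdx u x y t| ≤ M := by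
  intro x y t hx hy ht
  have hd := cs_dx hsol (x := x) (y := y) (t := t) (by linarith)
    ⟨hy.1, by linarith [hy.2]⟩ ⟨by linarith [ht.1], ht.2⟩
  rw [abs_le]
  constructor
  · refine deriv_ge_of hd (δ := L / 4) (by linarith) (fun s h1 h2 => ?_)
    have := shift_x hL hT hsol hM0 hM (h := -s) (by rw [abs_neg, abs_of_pos h1]; exact h2.le)
      x y t hx hy ht
    rwa [abs_neg, abs_of_pos h1] at this
  · refine deriv_le_of hd (δ := L / 4) (by linarith) (fun s h1 h2 => ?_)
    have := shift_x hL hT hsol hM0 hM (h := s) (by rw [abs_of_pos h1]; exact h2.le)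
      x y t hx hy ht
    rwa [abs_of_pos h1] at this

/-- bounds of `y`-translations on the parts of the boundary away from `y = 0` -/
lemma bdry_y (hL : 0 < L) (hsol : ClassicalSolution p L T u) {M : ℝ}
    (hM : ∀ x y t : ℝ, |x| ≤ L → y ∈ Icc 0 L → t ∈ Ioo 0 T →
      (L / 4 ≤ |x| ∨ L / 4 ≤ y ∨ t = T / 2) → gradNorm u x y t ≤ M) {h : ℝ} (hh : |h| ≤ L / 4)
    {x y s : ℝ} (hx : x ∈ Icc (-(L/2)) (L/2)) (hy : y ∈ Icc 0 (L/2)) (hy' : 0 ≤ y + h)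
    (hs : s ∈ Ioo 0 T) (hbd : x = -(L/2) ∨ x = L/2 ∨ y = L/2 ∨ s = T/2) :
    u x (y + h) s - u x y s ≤ M * |h| := by
  have hh' := abs_le.1 hh
  have hxL : |x| ≤ L := abs_le.2 ⟨by linarith [hx.1], by linarith [hx.2]⟩
  have hyL : y ∈ Icc 0 L := ⟨hy.1, by linarith [hy.2]⟩
  have hyL' : y + h ∈ Icc 0 L := ⟨hy', by linarith [hy.2]⟩
  have habs : ∀ r ∈ uIcc y (y + h), |r - y| ≤ L / 4 := by
    intro r hr
    have := abs_sub_left_of_mem_uIcc hr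
    rw [add_sub_cancel_left] at this
    linarith
  have := lipy hsol (M := M) hyL hyL' hxL hs (fun r hrm => hM x r s hxL
    (uIcc_subset_Icc hyL hyL' hrm) hs (by
      rcases hbd with h1 | h1 | h1 | h1
      · left; rw [le_abs]; right; linarith
      · left; rw [le_abs]; left; linarith
      · right; left
        have := abs_le.1 (habs r hrm)
        linarith
      · right; right; exact h1))
  rw [add_sub_cancel_left] at this
  exact (le_abs_self _).trans this

lemma pdy_lower (hL : 0 < L) (hT : 0 < T) (hsol : ClassicalSolution p L T u) {M : ℝ}
    (hM0 : 0 < M) (hM : ∀ x y t : ℝ, |x| ≤ L → y ∈ Icc 0 L → t ∈ Ioo 0 T →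
      (L / 4 ≤ |x| ∨ L / 4 ≤ y ∨ t = T / 2) → gradNorm u x y t ≤ M) :
    ∀ x y t : ℝ, |x| ≤ L / 2 → y ∈ Ioc 0 (L / 2) → t ∈ Ico (T / 2) T → -M ≤ pdy u x y t := by
  intro x y t hx hy ht
  have hd := cs_dy hsol (x := x) (y := y) (t := t) (by linarith)
    ⟨hy.1.le, by linarith [hy.2]⟩ ⟨by linarith [ht.1], ht.2⟩
  refine deriv_ge_of hd (δ := min (L / 4) y) (lt_min (by linarith) hy.1) (fun h h1 h2 => ?_)
  have h3 := (lt_min_iff.1 h2).1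
  have h4 := (lt_min_iff.1 h2).2
  have := transConst hsol (hx := 0) (hy := -h) (x0 := -(L / 2)) (x1 := L / 2) (y0 := h)
    (y1 := L / 2) (s0 := T / 2) (s1 := t) (K := M * h) (by linarith) (by linarith) (by linarith)
    (by linarith) h1.le (by linarith) (by linarith) (by linarith) (by linarith) ht.2 (by
      intro x hx y hy s hs hbd
      rw [add_zero]
      have hsT : s ∈ Ioo 0 T := ⟨by linarith [hs.1], hs.2.trans_lt ht.2⟩
      have main : (x = -(L/2) ∨ x = L/2 ∨ y = L/2 ∨ s = T/2) →
          u x (y + -h) s - u x y s ≤ M * h := by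
        intro hbd
        have := bdry_y hL hsol hM (h := -h) (by rw [abs_neg, abs_of_pos h1]; exact h3.le) hx
          ⟨h1.le.trans hy.1, hy.2⟩ (by linarith [hy.1]) hsT hbd
        rwa [abs_neg, abs_of_pos h1] at this
      rcases hbd with h5 | h5 | h5 | h5 | h5
      · exact main (by tauto)
      · exact main (by tauto)
      · rw [h5, add_neg_cancel, hsol.bc (abs_lt.2 ⟨by linarith [hx.1], by linarith [hx.2]⟩) hsT]
        have := hsol.nonneg (x := x) (y := h) (t := s)
          (abs_le.2 ⟨by linarith [hx.1], by linarith [hx.2]⟩) ⟨h1.le, by linarith⟩ hsT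
        have : 0 < M * h := by positivity
        linarith
      · exact main (by tauto)
      · exact main (by tauto)) x (abs_le.1 hx) y ⟨h4.le, hy.2⟩ t ⟨ht.1, le_rfl⟩
  rw [add_zero] at this
  exact this

/-- if `u ≤ M y`, then `u_y` is bounded above. -/
lemma pdy_upper_of_lin (hL : 0 < L) (hT : 0 < T) (hsol : ClassicalSolution p L T u) {M : ℝ}
    (hM : ∀ x y t : ℝ, |x| ≤ L → y ∈ Icc 0 L → t ∈ Ioo 0 T →
      (L / 4 ≤ |x| ∨ L / 4 ≤ y ∨ t = T / 2) → gradNorm u x y t ≤ M)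
    (hlin : ∀ x y t : ℝ, |x| ≤ L / 2 → y ∈ Icc 0 (L / 2) → t ∈ Ioo 0 T → u x y t ≤ M * y) :
    ∀ x y t : ℝ, |x| ≤ L / 2 → y ∈ Icc 0 (L / 2) → t ∈ Ico (T / 2) T → pdy u x y t ≤ M := by
  intro x y t hx hy ht
  have hd := cs_dy hsol (x := x) (y := y) (t := t) (by linarith)
    ⟨hy.1, by linarith [hy.2]⟩ ⟨by linarith [ht.1], ht.2⟩
  refine deriv_le_of hd (δ := L / 4) (by linarith) (fun h h1 h2 => ?_)
  have := transConst hsol (hx := 0) (hy := h) (x0 := -(L / 2)) (x1 := L / 2) (y0 := 0)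
    (y1 := L / 2) (s0 := T / 2) (s1 := t) (K := M * h) (by linarith) (by linarith) (by linarith)
    (by linarith) le_rfl (by linarith) (by linarith) (by linarith) (by linarith) ht.2 (by
      intro x hx y hy s hs hbd
      rw [add_zero]
      have hsT : s ∈ Ioo 0 T := ⟨by linarith [hs.1], hs.2.trans_lt ht.2⟩
      have main : (x = -(L/2) ∨ x = L/2 ∨ y = L/2 ∨ s = T/2) →
          u x (y + h) s - u x y s ≤ M * h := by
        intro hbd
        have := bdry_y hL hsol hM (h := h) (by rw [abs_of_pos h1]; exact h2.le) hx
          hy (by linarith [hy.1]) hsT hbd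
        rwa [abs_of_pos h1] at this
      rcases hbd with h5 | h5 | h5 | h5 | h5
      · exact main (by tauto)
      · exact main (by tauto)
      · rw [h5, zero_add, hsol.bc (abs_lt.2 ⟨by linarith [hx.1], by linarith [hx.2]⟩) hsT]
        have := hlin x h s (abs_le.2 hx) ⟨h1.le, by linarith⟩ hsT
        linarith
      · exact main (by tauto)
      · exact main (by tauto)) x (abs_le.1 hx) y hy t ⟨ht.1, le_rfl⟩
  rw [add_zero] at this
  exact this

end Est

end

section

section Prof

variable {p L T : ℝ} {u : ℝ → ℝ → ℝ → ℝ}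

lemma U_der {β d y : ℝ} (hβ1 : β < 1) (hy : 0 < y) :
    HasDerivAt (fun s : ℝ => d / (1 - β) * s ^ (1 - β)) (d * y ^ (-β)) y := by
  have h := (Real.hasDerivAt_rpow_const (x := y) (p := 1 - β) (Or.inl hy.ne')).const_mul
    (d / (1 - β))
  have e : d / (1 - β) * ((1 - β) * y ^ (1 - β - 1)) = d * y ^ (-β) := by
    have : 1 - β ≠ 0 := by linarith
    rw [show 1 - β - 1 = -β by ring]; field_simp
  rwa [e] at h

lemma U_der2 {β y : ℝ} (hβ0 : 0 < β) (hβ : β * (p - 1) = 1) (hy : 0 < y) :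
    HasDerivAt (fun s : ℝ => β ^ β * s ^ (-β)) (-(β ^ β * y ^ (-β)) ^ p) y := by
  have h := (Real.hasDerivAt_rpow_const (x := y) (p := -β) (Or.inl hy.ne')).const_mul
    (β ^ β)
  have e : β ^ β * (-β * y ^ (-β - 1)) = -(β ^ β * y ^ (-β)) ^ p := by
    rw [Real.mul_rpow (by positivity) (by positivity), ← Real.rpow_mul hβ0.le,
      ← Real.rpow_mul hy.le, show -β * p = -β - 1 by linarith, show β * p = β + 1 by linarith,
      Real.rpow_add_one hβ0.ne']
    ring
  rwa [e] at h

lemma pdy_upper (hp : 2 < p) {β : ℝ} (hβ : β * (p - 1) = 1)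
    (hL : 0 < L) (hT : 0 < T) (hsol : ClassicalSolution p L T u) {M : ℝ}
    (hM0 : 0 < M) (hM : ∀ x y t : ℝ, |x| ≤ L → y ∈ Icc 0 L → t ∈ Ioo 0 T →
      (L / 4 ≤ |x| ∨ L / 4 ≤ y ∨ t = T / 2) → gradNorm u x y t ≤ M) :
    ∀ x y t : ℝ, |x| ≤ L / 2 → y ∈ Ioc 0 (L / 2) → t ∈ Ico (T / 2) T →
      pdy u x y t ≤ β ^ β * y ^ (-β) + (M + 1) := by
  intro x y t hx hy ht
  have hβ0 : 0 < β := by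
    by_contra hc; push Not at hc; nlinarith
  have hβ1 : β < 1 := by nlinarith
  have hd := cs_dy hsol (x := x) (y := y) (t := t) (by linarith)
    ⟨hy.1.le, by linarith [hy.2]⟩ ⟨by linarith [ht.1], ht.2⟩
  set d := β ^ β with hdd
  have hd0 : 0 < d := by positivity
  have h1β : 0 < 1 - β := by linarith
  set U : ℝ → ℝ := fun s => d / (1 - β) * s ^ (1 - β) with hU
  have hUd : ∀ s, 0 < s → HasDerivAt U (d * s ^ (-β)) s := fun s hs => U_der hβ1 hs
  have hU2 : ∀ s, 0 < s → HasDerivAt (fun s => d * s ^ (-β)) (-(d * s ^ (-β)) ^ p) s :=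
    fun s hs => U_der2 hβ0 hβ hs
  have hUc : Continuous U := by
    rw [hU]
    exact continuous_const.mul (Real.continuous_rpow_const h1β.le)
  have hUmono : ∀ a b, 0 ≤ a → a ≤ b → U a ≤ U b := by
    intro a b ha hab
    rw [hU]
    exact mul_le_mul_of_nonneg_left (Real.rpow_le_rpow ha hab h1β.le) (by positivity)
  have hU'anti : ∀ a b, 0 < a → a ≤ b → d * b ^ (-β) ≤ d * a ^ (-β) := by
    intro a b ha hab
    exact mul_le_mul_of_nonneg_left
      (Real.rpow_le_rpow_of_nonpos ha hab (by linarith)) hd0.le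
  have hU0 : U 0 = 0 := by
    rw [hU]; simp only; rw [Real.zero_rpow h1β.ne', mul_zero]
  obtain ⟨Mt, hMt0, hMt⟩ := grad_bdd_compact hsol (t1 := T / 2) (t2 := t) (by linarith) ht.2
  obtain ⟨δ, hδ, hunif⟩ := box_unif (box_cy hsol (t1 := T / 2) (t2 := t) (by linarith) ht.2)
    one_pos
  -- small h
  have hh0 : ∃ h0 > 0, ∀ h, 0 < h → h < h0 → Mt * h ≤ U h := by
    have hlim : Tendsto (fun h : ℝ => Mt * h ^ β) (nhds 0) (nhds 0) := by
      have := ((Real.continuous_rpow_const hβ0.le).const_mul Mt).tendsto 0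
      rwa [Real.zero_rpow hβ0.ne', mul_zero] at this
    have hev := hlim.eventually (gt_mem_nhds (show (0:ℝ) < d / (1 - β) by positivity))
    obtain ⟨h0, h0pos, hball⟩ := Metric.eventually_nhds_iff.1 hev
    refine ⟨h0, h0pos, fun h hp1 hp2 => ?_⟩
    have h3 : Mt * h ^ β < d / (1 - β) :=
      hball (by rw [Real.dist_eq, sub_zero, abs_of_pos hp1]; exact hp2)
    have h4 : h = h ^ β * h ^ (1 - β) := by
      rw [← Real.rpow_add hp1]; simp
    calc Mt * h = (Mt * h ^ β) * h ^ (1 - β) := by rw [mul_assoc, ← h4]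
      _ ≤ d / (1 - β) * h ^ (1 - β) := mul_le_mul_of_nonneg_right h3.le (by positivity)
  obtain ⟨h0, hh0, hh0'⟩ := hh0
  have hdiff : HasDerivAt (fun s => u x s t - U s) (pdy u x y t - d * y ^ (-β)) y :=
    hd.sub (hUd y hy.1)
  suffices pdy u x y t - d * y ^ (-β) ≤ M + 1 by linarith
  refine deriv_le_of hdiff (δ := min (min (L / 4) δ) h0) (by positivity) (fun h hp1 hp2 => ?_)
  have g1 : h < L / 4 := lt_of_lt_of_le hp2 ((min_le_left _ _).trans (min_le_left _ _))
  have g2 : h < δ := lt_of_lt_of_le hp2 ((min_le_left _ _).trans (min_le_right _ _))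
  have g3 : h < h0 := lt_of_lt_of_le hp2 (min_le_right _ _)
  have key : u (x + 0) (y + h) t - u x y t + (-(U (y + h) - U y) - (M + 1) * h) ≤ 0 := by
    refine eps_lim (c := t - T / 2) (fun ε hε => ?_)
    refine transP hsol (hx := 0) (hy := h) (x0 := -(L / 2)) (x1 := L / 2) (y0 := 0)
      (y1 := L / 2) (s0 := T / 2) (s1 := t) (b := 0) (ε := ε)
      (Φ := fun x y t => -(U (y + h) - U y) - (M + 1) * h)
      (by linarith) (by linarith) (by linarith)
      (by linarith) le_rfl (by linarith) (by linarith) (by linarith) (by linarith) ht.2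
      ?_ ?_ hε ?_ x (abs_le.1 hx) y ⟨hy.1.le, hy.2⟩ t ⟨ht.1, le_rfl⟩
    · apply Continuous.continuousOn
      fun_prop
    · intro x hx y hy s hs hbd
      rw [add_zero]
      have hsT : s ∈ Ioo 0 T := ⟨by linarith [hs.1], hs.2.trans_lt ht.2⟩
      have main : (x = -(L/2) ∨ x = L/2 ∨ y = L/2 ∨ s = T/2) →
          u x (y + h) s - u x y s + (-(U (y + h) - U y) - (M + 1) * h) ≤ 0 := by
        intro hbd
        have := bdry_y hL hsol hM (h := h) (by rw [abs_of_pos hp1]; exact g1.le) hx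
          hy (by linarith [hy.1]) hsT hbd
        rw [abs_of_pos hp1] at this
        have := hUmono y (y + h) hy.1 (by linarith)
        nlinarith
      rcases hbd with h5 | h5 | h5 | h5 | h5
      · exact main (by tauto)
      · exact main (by tauto)
      · rw [h5, zero_add, hU0, hsol.bc (abs_lt.2 ⟨by linarith [hx.1], by linarith [hx.2]⟩) hsT]
        have hxL : |x| ≤ L := abs_le.2 ⟨by linarith [hx.1], by linarith [hx.2]⟩
        have := lipy hsol (a := 0) (b := h) (x := x) (t := s) (M := Mt) ⟨le_rfl, hL.le⟩
          ⟨hp1.le, by linarith⟩ hxL hsT (fun r hr => hMt x r s hxL (by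
            rw [uIcc_of_le hp1.le] at hr
            exact ⟨hr.1, by linarith [hr.2]⟩) hs)
        rw [hsol.bc (abs_lt.2 ⟨by linarith [hx.1], by linarith [hx.2]⟩) hsT, sub_zero, sub_zero,
          abs_of_pos hp1] at this
        have h6 := hh0' h hp1 g3
        have h7 := le_abs_self (u x h s)
        have : 0 ≤ (M + 1) * h := by positivity
        linarith
      · exact main (by tauto)
      · exact main (by tauto)
    · intro x hx y hy s hs hw
      rw [add_zero] at hw ⊢
      have hsT : s ∈ Ioo 0 T := ⟨by linarith [hs.1], hs.2.trans_lt ht.2⟩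
      have hxL : |x| ≤ L := abs_le.2 ⟨by linarith [hx.1], by linarith [hx.2]⟩
      refine ⟨fun _ => 0, fun r => -(d * (r + h) ^ (-β) - d * r ^ (-β)), 0,
        -(-(d * (y + h) ^ (-β)) ^ p - -(d * y ^ (-β)) ^ p), 0,
        Filter.Eventually.of_forall (fun s => hasDerivAt_const _ _), hasDerivAt_const _ _,
        ?_, ?_, hasDerivAt_const _ _, ?_⟩
      · filter_upwards [Ioi_mem_nhds hy.1] with r hr
        have hr' : 0 < r := hr
        exact (((hUd (r + h) (by linarith)).comp_add_const r h).sub (hUd r hr')).neg.sub_const _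
      · exact (((hU2 (y + h) (by linarith [hy.1])).comp_add_const y h).sub (hU2 y hy.1)).neg
      · intro e1 e2
        have hN := N_lemma (p := p) (a := pdx u x y s) (e := pdy u x (y + h) s - d * (y + h) ^ (-β))
          (f1 := d * (y + h) ^ (-β)) (f2 := d * y ^ (-β)) hp (by
            -- mean value
            have hlt : y < y + h := by linarith
            obtain ⟨η, hη, hηe⟩ := exists_hasDerivAt_eq_slope (fun r => u x r s)
              (fun r => pdy u x r s) hlt
              (fun r hr => (cs_dy hsol hxL ⟨by linarith [hr.1, hy.1], by linarith [hr.2, hy.2]⟩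
                hsT).continuousAt.continuousWithinAt)
              (fun r hr => cs_dy hsol hxL ⟨by linarith [hr.1, hy.1], by linarith [hr.2, hy.2]⟩ hsT)
            obtain ⟨ζ, hζ, hζe⟩ := exists_hasDerivAt_eq_slope U (fun r => d * r ^ (-β)) hlt
              hUc.continuousOn (fun r hr => hUd r (by linarith [hr.1, hy.1]))
            have hu := hunif x (y + h) s x η hxL ⟨by linarith [hy.1], by linarith [hy.2]⟩ hxL
              ⟨by linarith [hη.1, hy.1], by linarith [hη.2, hy.2]⟩ ⟨hs.1.le, hs.2⟩ (by simpa using hδ)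
              (by rw [abs_of_pos (by linarith [hη.2])]; linarith [hη.1])
            have hu' := (abs_lt.1 hu).1
            simp only at hu'
            have hz := hU'anti ζ (y + h) (by linarith [hζ.1, hy.1]) hζ.2.le
            rw [add_sub_cancel_left, eq_div_iff hp1.ne'] at hηe hζe
            have : (d * ζ ^ (-β) + (M + 1)) * h < pdy u x η s * h := by
              rw [hηe, add_mul, hζe]; linarith
            have := lt_of_mul_lt_mul_right this hp1.le
            linarith) (by have := hy.1; positivity) (hU'anti y (y + h) hy.1 (by linarith))
        have q1 : pdx u x (y + h) s = pdx u x y s := by linarith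
        have q2 : pdy u x y s = pdy u x (y + h) s - d * (y + h) ^ (-β) + d * y ^ (-β) := by
          linarith
        unfold gradNorm
        rw [q1, q2]
        rw [sub_add_cancel] at hN
        linarith
  rw [add_zero] at key
  linarith

lemma u_lin (hsol : ClassicalSolution p L T u) {x y t M : ℝ} (hx : |x| < L)
    (hy : y ∈ Icc 0 L) (ht : t ∈ Ioo 0 T) (hM : ∀ r ∈ Icc 0 y, gradNorm u x r t ≤ M) :
    u x y t ≤ M * y := by
  have hL : 0 ≤ L := hy.1.trans hy.2
  have := lipy hsol (a := 0) (b := y) (x := x) (t := t) (M := M) ⟨le_rfl, hL⟩ hy hx.le ht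
    (fun r hr => hM r (by rwa [uIcc_of_le hy.1] at hr))
  rw [hsol.bc hx ht, sub_zero, sub_zero, abs_of_nonneg hy.1] at this
  exact (le_abs_self _).trans this

lemma u_anti (hsol : ClassicalSolution p L T u) (hmon : MonCond L T u) {a b y t : ℝ}
    (ha : 0 ≤ a) (hab : a ≤ b) (hb : b < L) (hy : y ∈ Ico 0 L) (ht : t ∈ Ioo 0 T) :
    u b y t ≤ u a y t := by
  rcases hy.1.eq_or_lt with h | h
  · rw [← h, hsol.bc (abs_lt.2 ⟨by linarith, by linarith⟩) ht,
      hsol.bc (abs_lt.2 ⟨by linarith, by linarith⟩) ht]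
  · have hd : ∀ s ∈ Icc a b, HasDerivAt (fun s => u s y t) (pdx u s y t) s := fun s hs =>
      cs_dx hsol (abs_le.2 ⟨by linarith [hs.1], by linarith [hs.2]⟩) ⟨hy.1, hy.2.le⟩ ht
    have : AntitoneOn (fun s => u s y t) (Icc a b) := by
      apply antitoneOn_of_deriv_nonpos (convex_Icc a b)
      · exact fun s hs => (hd s hs).continuousAt.continuousWithinAt
      · exact fun s hs => (hd s (interior_subset hs)).differentiableAt.differentiableWithinAt
      · intro s hs
        rw [(hd s (interior_subset hs)).deriv]
        rw [interior_Icc] at hs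
        have := hmon (x := s) (y := y) (t := t) (abs_lt.2 ⟨by linarith [hs.1], by linarith [hs.2]⟩)
          ⟨h, hy.2⟩ ht
        have hs0 : 0 < s := by linarith [hs.1]
        by_contra hc
        push Not at hc
        have := mul_pos hs0 hc
        linarith
    exact this ⟨le_rfl, hab⟩ ⟨hab, le_rfl⟩ hab

lemma u_mono (hsol : ClassicalSolution p L T u) {a b y t : ℝ}
    (ha : -L ≤ a) (hab : a ≤ b) (hb : b ≤ L) (hy : y ∈ Icc 0 L) (ht : t ∈ Ioo 0 T)
    (hpos : ∀ s ∈ Ioo a b, 0 ≤ pdx u s y t) :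
    u a y t ≤ u b y t := by
  have hd : ∀ s ∈ Icc a b, HasDerivAt (fun s => u s y t) (pdx u s y t) s := fun s hs =>
      cs_dx hsol (abs_le.2 ⟨by linarith [hs.1], by linarith [hs.2]⟩) hy ht
  have : MonotoneOn (fun s => u s y t) (Icc a b) := by
    apply monotoneOn_of_deriv_nonneg (convex_Icc a b)
    · exact fun s hs => (hd s hs).continuousAt.continuousWithinAt
    · exact fun s hs => (hd s (interior_subset hs)).differentiableAt.differentiableWithinAt
    · intro s hs
      rw [(hd s (interior_subset hs)).deriv]
      rw [interior_Icc] at hs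
      exact hpos s hs
  exact this ⟨le_rfl, hab⟩ ⟨hab, le_rfl⟩ hab

lemma exists_neg (hL : 0 < L) (hT : 0 < T) (hsol : ClassicalSolution p L T u)
    (hgbu : IsolatedGBU L T u) (hmon : MonCond L T u) :
    ∃ x ∈ Ioo 0 L, ∃ y ∈ Ioo 0 L, ∃ t ∈ Ioo 0 T, pdx u x y t < 0 := by
  by_contra hcon
  push Not at hcon
  obtain ⟨M, hM0, hM⟩ := bdry_const hL hT hsol hgbu
  have hlin : ∀ x y t : ℝ, |x| ≤ L / 2 → y ∈ Icc 0 (L / 2) → t ∈ Ioo 0 T → u x y t ≤ M * y := by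
    intro x y t hx hy ht
    have hx' := abs_le.1 hx
    rcases hy.1.eq_or_lt with h0 | h0
    · rw [← h0, hsol.bc (lt_of_le_of_lt hx (by linarith)) ht]; simp
    have hyL : y ∈ Icc 0 L := ⟨hy.1, by linarith [hy.2]⟩
    have hyo : y ∈ Ioo 0 L := ⟨h0, by linarith [hy.2]⟩
    have e1 : u (L / 2) y t ≤ M * y := by
      have hxx : |L / 2| = L / 2 := abs_of_pos (by linarith)
      refine u_lin hsol (by rw [hxx]; linarith) hyL ht (fun r hr => ?_)
      exact hM _ _ _ (by rw [hxx]; linarith) ⟨hr.1, hr.2.trans hyL.2⟩ ht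
        (Or.inl (by rw [hxx]; linarith))
    have e2 : ∀ a, 0 ≤ a → a ≤ L / 2 → u a y t ≤ u (L / 2) y t := fun a h1 h2 =>
      u_mono hsol (by linarith) h2 (by linarith) hyL ht
        (fun s hs => hcon s ⟨by linarith [hs.1], by linarith [hs.2]⟩ y hyo t ht)
    rcases le_total 0 x with h | h
    · exact (e2 x h hx'.2).trans e1
    · have e3 : u x y t ≤ u 0 y t := u_mono hsol (by linarith) h hL.le hyL ht (fun s hs => by
        have hm := hmon (x := s) (abs_lt.2 ⟨by linarith [hs.1], by linarith [hs.2]⟩) hyo ht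
        by_contra hc
        push Not at hc
        have := mul_pos_of_neg_of_neg hs.2 hc
        linarith)
      exact e3.trans ((e2 0 le_rfl (by linarith)).trans e1)
  have hx1 := pdx_bdd hL hT hsol hM0 hM
  have hy1 := pdy_upper_of_lin hL hT hsol hM hlin
  have hy2 := pdy_lower hL hT hsol hM0 hM
  obtain ⟨x, y, t, hx, hy, ht, hxd, hyd, htd, hbig⟩ := hgbu.blowup (2 * M)
    (min (L / 2) (T / 2)) (by positivity)
  have k1 : |x| ≤ L / 2 := hxd.le.trans (min_le_left _ _)
  have k2 : y ∈ Icc 0 (L / 2) := ⟨hy.1, (le_abs_self y).trans (hyd.le.trans (min_le_left _ _))⟩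
  have k3 : t ∈ Ico (T / 2) T := ⟨by linarith [min_le_right (L / 2) (T / 2)], ht.2⟩
  have l1 := hx1 x y t k1 k2 k3
  have l2 := hy1 x y t k1 k2 k3
  have l3 : -M ≤ pdy u x y t := by
    rcases hy.1.eq_or_lt with h0 | h0
    · subst h0
      have hd := (cs_dy hsol hx hy ht).neg
      have := deriv_le_of (M := 0) hd (δ := L) hL (fun s h1 h2 => by
        simp only [Pi.neg_apply]
        rw [zero_add, hsol.bc (lt_of_le_of_lt k1 (by linarith)) ht]
        have := hsol.nonneg hx (y := s) ⟨h1.le, h2.le⟩ ht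
        linarith)
      linarith
    · exact hy2 x y t k1 ⟨h0, k2.2⟩ k3
  have l4 : |pdy u x y t| ≤ M := abs_le.2 ⟨l3, l2⟩
  have := gradNorm_le (u := u) x y t
  linarith

end Prof

end

section

variable {p L T : ℝ} {u : ℝ → ℝ → ℝ → ℝ}

lemma bar1 {ρ0 R A B : ℝ} (h0 : 0 < ρ0) (hA : 0 ≤ A) (hB : 0 ≤ B) (hR : 0 ≤ R) :
    ∃ l > 0, ∃ K > 0, ∀ ρ X wt : ℝ, ρ0 ≤ ρ → ρ ≤ R → |X| < ρ → wt ≤ A →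
      l * exp (l * (ρ ^ 2 - X ^ 2)) * (wt + 2 - 4 * l * X ^ 2 + 2 * B * |X|) ≤
        K * (exp (l * (ρ ^ 2 - X ^ 2)) - 1) := by
  set S := A + 2 + 2 * B * R with hS
  have hS0 : 0 < S := by positivity
  set l := S / ρ0 ^ 2 with hl
  have hl0 : 0 < l := by positivity
  have hlS : l * ρ0 ^ 2 = S := by rw [hl]; field_simp
  set e := exp (-(l * (3 * ρ0 ^ 2 / 4))) with he
  have he1 : e < 1 := by
    rw [he, Real.exp_lt_one_iff]
    have : 0 < l * (3 * ρ0 ^ 2 / 4) := by positivity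
    linarith
  have he2 : 0 < 1 - e := by linarith
  refine ⟨l, hl0, l * S / (1 - e), by positivity, ?_⟩
  intro ρ X wt h1 h2 h3 h4
  have hX2 : X ^ 2 < ρ ^ 2 := by
    rw [← sq_abs X]; exact pow_lt_pow_left₀ h3 (abs_nonneg _) two_ne_zero
  have hw : 0 < ρ ^ 2 - X ^ 2 := by linarith
  have hE : 0 < exp (l * (ρ ^ 2 - X ^ 2)) := exp_pos _
  have hBX : 2 * B * |X| ≤ 2 * B * R := by
    have := abs_nonneg X
    exact mul_le_mul_of_nonneg_left (by linarith) (by positivity)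
  rcases le_or_gt (ρ0 ^ 2 / 4) (X ^ 2) with hc | hc
  · have : wt + 2 - 4 * l * X ^ 2 + 2 * B * |X| ≤ 0 := by nlinarith
    have a1 : l * exp (l * (ρ ^ 2 - X ^ 2)) * (wt + 2 - 4 * l * X ^ 2 + 2 * B * |X|) ≤ 0 :=
      mul_nonpos_of_nonneg_of_nonpos (by positivity) this
    have a2 : 1 ≤ exp (l * (ρ ^ 2 - X ^ 2)) := Real.one_le_exp (by positivity)
    have a3 : 0 ≤ l * S / (1 - e) * (exp (l * (ρ ^ 2 - X ^ 2)) - 1) :=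
      mul_nonneg (by positivity) (by linarith)
    linarith
  · have hw2 : 3 * ρ0 ^ 2 / 4 ≤ ρ ^ 2 - X ^ 2 := by
      have : ρ0 ^ 2 ≤ ρ ^ 2 := pow_le_pow_left₀ h0.le h1 2
      linarith
    have b1 : 1 ≤ e * exp (l * (ρ ^ 2 - X ^ 2)) := by
      rw [he, ← Real.exp_add]
      apply Real.one_le_exp
      nlinarith
    have b2 : l * exp (l * (ρ ^ 2 - X ^ 2)) * (wt + 2 - 4 * l * X ^ 2 + 2 * B * |X|) ≤
        l * exp (l * (ρ ^ 2 - X ^ 2)) * S := by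
      apply mul_le_mul_of_nonneg_left _ (by positivity)
      have : 0 ≤ 4 * l * X ^ 2 := by positivity
      linarith
    have b3 : (1 - e) * exp (l * (ρ ^ 2 - X ^ 2)) ≤ exp (l * (ρ ^ 2 - X ^ 2)) - 1 := by
      linarith
    calc _ ≤ _ := b2
      _ = l * S / (1 - e) * ((1 - e) * exp (l * (ρ ^ 2 - X ^ 2))) := by field_simp
      _ ≤ _ := mul_le_mul_of_nonneg_left b3 (by positivity)

/-- Moving parabola. -/
def wf (a b c d x t : ℝ) : ℝ := (c + d * t) ^ 2 - (x - (a + b * t)) ^ 2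

lemma wf_dx (a b c d l x t : ℝ) : HasDerivAt (fun s => exp (l * wf a b c d s t) - 1)
    (-2 * l * (x - (a + b * t)) * exp (l * wf a b c d x t)) x := by
  unfold wf
  have h : HasDerivAt (fun s : ℝ => s - (a + b * t)) 1 x := (hasDerivAt_id x).sub_const _
  have := ((((h.pow 2).const_sub ((c + d * t) ^ 2)).const_mul l).exp).sub_const 1
  exact this.congr_deriv (by simp; ring)

lemma wf_dxx (a b c d l x t : ℝ) :
    HasDerivAt (fun s => -2 * l * (s - (a + b * t)) * exp (l * wf a b c d s t))
    ((4 * l ^ 2 * (x - (a + b * t)) ^ 2 - 2 * l) * exp (l * wf a b c d x t)) x := by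
  have h : HasDerivAt (fun s : ℝ => s - (a + b * t)) 1 x := (hasDerivAt_id x).sub_const _
  have h2 := (wf_dx a b c d l x t).add_const 1
  simp only [sub_add_cancel] at h2
  have := (h.const_mul (-2 * l)).mul h2
  exact this.congr_deriv (by ring)

lemma wf_dt (a b c d l x t : ℝ) : HasDerivAt (fun s => exp (l * wf a b c d x s) - 1)
    (l * (2 * (c + d * t) * d + 2 * (x - (a + b * t)) * b) * exp (l * wf a b c d x t)) t := by
  unfold wf
  have h1 : HasDerivAt (fun s : ℝ => c + d * s) d t := by
    simpa using ((hasDerivAt_id t).const_mul d).const_add c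
  have h2 : HasDerivAt (fun s : ℝ => x - (a + b * s)) (-b) t := by
    simpa using (((hasDerivAt_id t).const_mul b).const_add a).const_sub x
  have := ((((h1.pow 2).sub (h2.pow 2)).const_mul l).exp).sub_const 1
  exact this.congr_deriv (by simp; ring)

lemma wf_cont (a b c d : ℝ) : Continuous (fun q : ℝ × ℝ => wf a b c d q.1 q.2) := by
  unfold wf; fun_prop

lemma bar_fun {ρ0 R B a b c d s0 s1 : ℝ} (h0 : 0 < ρ0) (hB : 0 ≤ B)  (hR : 0 ≤ R)
    (hρ : ∀ t ∈ Icc s0 s1, ρ0 ≤ c + d * t ∧ c + d * t ≤ R) :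
    ∃ l > 0, ∃ K > 0, (∀ t ∈ Icc s0 s1, ∀ x, 0 < wf a b c d x t →
      l * (2 * (c + d * t) * d + 2 * (x - (a + b * t)) * b) * exp (l * wf a b c d x t)
       - (4 * l ^ 2 * (x - (a + b * t)) ^ 2 - 2 * l) * exp (l * wf a b c d x t)
       + B * |-2 * l * (x - (a + b * t)) * exp (l * wf a b c d x t)|
       ≤ K * (exp (l * wf a b c d x t) - 1)) ∧
      (∀ t ∈ Icc s0 s1, ∀ x, l * max (wf a b c d x t) 0 ≤ max (exp (l * wf a b c d x t) - 1) 0 ∧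
        max (exp (l * wf a b c d x t) - 1) 0 ≤ l * exp (l * R ^ 2) * max (wf a b c d x t) 0) := by
  obtain ⟨l, hl, K, hK, h⟩ := bar1 (ρ0 := ρ0) (R := R) (A := 2 * R * |d| + 2 * R * |b|) (B := B) h0
    (by positivity) hB hR
  refine ⟨l, hl, K, hK, ?_, ?_⟩
  · intro t ht x hw
    obtain ⟨r1, r2⟩ := hρ t ht
    have hX : |x - (a + b * t)| < c + d * t := by
      unfold wf at hw
      exact abs_lt_of_sq_lt_sq (by linarith) (by linarith)
    have := h (c + d * t) (x - (a + b * t))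
      (2 * (c + d * t) * d + 2 * (x - (a + b * t)) * b) r1 r2 hX (by
        have i1 : (c + d * t) * d ≤ R * |d| := by
            calc (c + d * t) * d ≤ (c + d * t) * |d| :=
                  mul_le_mul_of_nonneg_left (le_abs_self d) (by linarith)
              _ ≤ R * |d| := mul_le_mul_of_nonneg_right r2 (abs_nonneg d)
        have i2 : (x - (a + b * t)) * b ≤ R * |b| := by
          calc _ ≤ |(x - (a + b * t)) * b| := le_abs_self _
            _ = |x - (a + b * t)| * |b| := abs_mul _ _
            _ ≤ R * |b| := mul_le_mul_of_nonneg_right (by linarith) (abs_nonneg b)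
        linarith)
    have e : wf a b c d x t = (c + d * t) ^ 2 - (x - (a + b * t)) ^ 2 := rfl
    rw [← e] at this
    have e2 : |-2 * l * (x - (a + b * t)) * exp (l * wf a b c d x t)| =
        2 * l * |x - (a + b * t)| * exp (l * wf a b c d x t) := by
      rw [abs_mul, abs_mul, abs_mul, abs_of_pos (exp_pos _), abs_of_pos hl]
      simp
    rw [e2]
    refine le_trans (le_of_eq ?_) this
    ring
  · intro t ht x
    obtain ⟨r1, r2⟩ := hρ t ht
    rcases le_or_gt (wf a b c d x t) 0 with hw | hw
    · have : exp (l * wf a b c d x t) ≤ 1 := by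
        rw [Real.exp_le_one_iff]; exact mul_nonpos_of_nonneg_of_nonpos hl.le hw
      rw [max_eq_right hw, max_eq_right (by linarith)]
      simp
    · have h1 : l * wf a b c d x t + 1 ≤ exp (l * wf a b c d x t) := Real.add_one_le_exp _
      have h2 : -(l * wf a b c d x t) + 1 ≤ exp (-(l * wf a b c d x t)) := Real.add_one_le_exp _
      have h3 : exp (-(l * wf a b c d x t)) * exp (l * wf a b c d x t) = 1 := by
        rw [← Real.exp_add]; simp
      have h4 : wf a b c d x t ≤ R ^ 2 := by
        unfold wf
        have := pow_le_pow_left₀ (by linarith) r2 2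
        nlinarith [sq_nonneg (x - (a + b * t))]
      have h5 : exp (l * wf a b c d x t) ≤ exp (l * R ^ 2) := by
        rw [Real.exp_le_exp]; exact mul_le_mul_of_nonneg_left h4 hl.le
      have h6 : 0 < l * wf a b c d x t := by positivity
      rw [max_eq_left hw.le, max_eq_left (by linarith)]
      refine ⟨by linarith, ?_⟩
      calc exp (l * wf a b c d x t) - 1 ≤ l * wf a b c d x t * exp (l * wf a b c d x t) := by
            nlinarith [exp_pos (l * wf a b c d x t)]
        _ ≤ l * wf a b c d x t * exp (l * R ^ 2) := mul_le_mul_of_nonneg_left h5 h6.le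
        _ = _ := by ring

lemma grad_diff (hp : 2 < p) {B0 A B x y t x' y' : ℝ} 
    (hV : gradNorm u x' y' t ≤ B0) (h1 : pdx u x' y' t - pdx u x y t = -A)
    (h2 : pdy u x' y' t - pdy u x y t = -B) :
    gradNorm u x' y' t ^ p - gradNorm u x y t ^ p ≤ p * B0 ^ (p - 1) * (|A| + |B|) := by
  have h := norm_tangent (p := p) (a1 := pdx u x y t) (a2 := pdy u x y t) (b1 := pdx u x' y' t)
    (b2 := pdy u x' y' t) hp
  rw [h1, h2] at h
  have hg := gradNorm_nonneg (u := u) x' y' t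
  change gradNorm u x' y' t ^ p - gradNorm u x y t ^ p ≤ p * gradNorm u x' y' t ^ (p - 2) * _ at h
  refine h.trans ?_
  have i1 : pdx u x' y' t * -A + pdy u x' y' t * -B ≤ gradNorm u x' y' t * (|A| + |B|) := by
    have j1 : pdx u x' y' t * -A ≤ gradNorm u x' y' t * |A| := by
      calc _ ≤ |pdx u x' y' t * -A| := le_abs_self _
        _ = |pdx u x' y' t| * |A| := by rw [abs_mul, abs_neg]
        _ ≤ _ := mul_le_mul_of_nonneg_right (abs_pdx_le _ _ _) (abs_nonneg _)
    have j2 : pdy u x' y' t * -B ≤ gradNorm u x' y' t * |B| := by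
      calc _ ≤ |pdy u x' y' t * -B| := le_abs_self _
        _ = |pdy u x' y' t| * |B| := by rw [abs_mul, abs_neg]
        _ ≤ _ := mul_le_mul_of_nonneg_right (abs_pdy_le _ _ _) (abs_nonneg _)
    linarith
  have hr : gradNorm u x' y' t ^ (p - 2) * gradNorm u x' y' t = gradNorm u x' y' t ^ (p - 1) := by
    nth_rewrite 2 [← Real.rpow_one (gradNorm u x' y' t)]
    rw [← Real.rpow_add_of_nonneg hg (by linarith) (by norm_num)]
    congr 1; ring
  have hr2 : gradNorm u x' y' t ^ (p - 1) ≤ B0 ^ (p - 1) :=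
    Real.rpow_le_rpow hg hV (by linarith)
  calc _ ≤ p * gradNorm u x' y' t ^ (p - 2) * (gradNorm u x' y' t * (|A| + |B|)) :=
        mul_le_mul_of_nonneg_left i1 (mul_nonneg (by linarith) (Real.rpow_nonneg hg _))
    _ = p * (gradNorm u x' y' t ^ (p - 2) * gradNorm u x' y' t) * (|A| + |B|) := by ring
    _ ≤ _ := by
      rw [hr]
      exact mul_le_mul_of_nonneg_right (mul_le_mul_of_nonneg_left hr2 (by linarith))
        (by positivity)

end

section

variable {p L T : ℝ} {u : ℝ → ℝ → ℝ → ℝ}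

lemma wf_nonpos {a b c d x t : ℝ} (h : 0 ≤ c + d * t)
    (h2 : x ≤ a + b * t - (c + d * t) ∨ a + b * t + (c + d * t) ≤ x) : wf a b c d x t ≤ 0 := by
  unfold wf
  rcases h2 with h2 | h2 <;> nlinarith

set_option maxHeartbeats 1600000 in
lemma hopf (hp : 2 < p) (hsol : ClassicalSolution p L T u) (hmon : MonCond L T u)
    {xl xr yl yr s0 s1 B0 ρ0 R a1 b1 c1 d1 a2 b2 c2 d2 C : ℝ}
    (hxl : 0 ≤ xl) (hyl : 0 ≤ yl) (hyr : yr < L) (hs0 : 0 < s0)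
    (h0 : 0 < ρ0) (hR : 0 ≤ R) (hB0 : 0 ≤ B0) (hC : 0 < C)
    (hB : ∀ x y t : ℝ, x ∈ Icc xl L → y ∈ Icc yl yr → t ∈ Icc s0 s1 → t < T →
      gradNorm u x y t ≤ B0)
    (hρ1 : ∀ t ∈ Icc s0 s1, ρ0 ≤ c1 + d1 * t ∧ c1 + d1 * t ≤ R)
    (hρ2 : ∀ t ∈ Icc s0 s1, ρ0 ≤ c2 + d2 * t ∧ c2 + d2 * t ≤ R)
    (hx1 : ∀ t ∈ Icc s0 s1, xl ≤ a1 + b1 * t - (c1 + d1 * t) ∧ a1 + b1 * t + (c1 + d1 * t) ≤ xr)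
    (hx2 : ∀ t ∈ Icc s0 s1, yl ≤ a2 + b2 * t - (c2 + d2 * t) ∧ a2 + b2 * t + (c2 + d2 * t) ≤ yr) :
    ∃ C2 > 0, ∀ h, 0 < h → h < L - xr →
      (∀ x ∈ Icc xl xr, ∀ y ∈ Icc yl yr,
        h * (C * (max (wf a1 b1 c1 d1 x s0) 0 * max (wf a2 b2 c2 d2 y s0) 0)) ≤
          u x y s0 - u (x + h) y s0) →
      ∀ x ∈ Icc xl xr, ∀ y ∈ Icc yl yr, ∀ t ∈ Icc s0 s1, t < T →
        h * (C2 * (max (wf a1 b1 c1 d1 x t) 0 * max (wf a2 b2 c2 d2 y t) 0)) ≤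
          u x y t - u (x + h) y t := by
  set B := p * B0 ^ (p - 1) with hBd
  have hB0' : 0 ≤ B := mul_nonneg (by linarith) (Real.rpow_nonneg hB0 _)
  obtain ⟨l1, hl1, K1, hK1, f1, g1⟩ := bar_fun (a := a1) (b := b1) h0 hB0' hR hρ1
  obtain ⟨l2, hl2, K2, hK2, f2, g2⟩ := bar_fun (a := a2) (b := b2) h0 hB0' hR hρ2
  set D := (l1 * exp (l1 * R ^ 2)) * (l2 * exp (l2 * R ^ 2)) with hD
  have hD0 : 0 < D := by positivity
  set c := C / D with hc
  have hc0 : 0 < c := by positivity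
  refine ⟨c * (exp (-((K1 + K2) * (s1 - s0))) * (l1 * l2)), by positivity, ?_⟩
  intro h hh hhL hinit x hx y hy t ht htT
  set G1 : ℝ → ℝ → ℝ := fun x t => exp (l1 * wf a1 b1 c1 d1 x t) - 1 with hG1
  set G2 : ℝ → ℝ → ℝ := fun x t => exp (l2 * wf a2 b2 c2 d2 x t) - 1 with hG2
  set E : ℝ → ℝ := fun t => exp (-((K1 + K2) * (t - s0))) with hE
  set Φ : ℝ → ℝ → ℝ → ℝ := fun x y t => h * c * E t * max (G1 x t) 0 * max (G2 y t) 0 with hΦ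
  have cG1 : Continuous (fun q : ℝ × ℝ => G1 q.1 q.2) := by
    have := wf_cont a1 b1 c1 d1
    simp only [hG1]; fun_prop
  have cG2 : Continuous (fun q : ℝ × ℝ => G2 q.1 q.2) := by
    have := wf_cont a2 b2 c2 d2
    simp only [hG2]; fun_prop
  have zero1 : ∀ x t, wf a1 b1 c1 d1 x t ≤ 0 → max (G1 x t) 0 = 0 := by
    intro x t hw
    apply max_eq_right
    have : exp (l1 * wf a1 b1 c1 d1 x t) ≤ 1 := by
      rw [Real.exp_le_one_iff]; exact mul_nonpos_of_nonneg_of_nonpos hl1.le hw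
    simp only [hG1]; linarith
  have zero2 : ∀ x t, wf a2 b2 c2 d2 x t ≤ 0 → max (G2 x t) 0 = 0 := by
    intro x t hw
    apply max_eq_right
    have : exp (l2 * wf a2 b2 c2 d2 x t) ≤ 1 := by
      rw [Real.exp_le_one_iff]; exact mul_nonpos_of_nonneg_of_nonpos hl2.le hw
    simp only [hG2]; linarith
  have anti : ∀ x ∈ Icc xl xr, ∀ y ∈ Icc yl yr, ∀ s ∈ Icc s0 t, u (x + h) y s ≤ u x y s := by
    intro x hx y hy s hs
    exact u_anti hsol hmon (by linarith [hx.1]) (by linarith) (by linarith [hx.2])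
      ⟨by linarith [hy.1], by linarith [hy.2]⟩ ⟨by linarith [hs.1], by linarith [hs.2]⟩
  have key : ∀ ε > 0, u (x + h) y t - u x y t + Φ x y t ≤ 0 + ε * (t - s0) := by
    intro ε hε
    have := transP hsol (hx := h) (hy := 0) (x0 := xl) (x1 := xr) (y0 := yl) (y1 := yr)
      (s0 := s0) (s1 := t) (ε := ε) (b := 0) (Φ := Φ)
      (by linarith [hx.1, hx.2]) (by linarith) (by linarith [hx.1, hx.2]) (by linarith) (by linarith)
      (by linarith) (by linarith) (by linarith) hs0 htT ?_ ?_ hε ?_ x hx y hy t ⟨ht.1, le_rfl⟩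
    · rw [add_zero] at this; exact this
    · apply Continuous.continuousOn
      have e1 : Continuous (fun q : ℝ × ℝ × ℝ => G1 q.1 q.2.2) :=
        cG1.comp (g := fun q : ℝ × ℝ => G1 q.1 q.2) (f := fun q : ℝ × ℝ × ℝ => (q.1, q.2.2))
          (by fun_prop)
      have e2 : Continuous (fun q : ℝ × ℝ × ℝ => G2 q.2.1 q.2.2) :=
        cG2.comp (g := fun q : ℝ × ℝ => G2 q.1 q.2) (f := fun q : ℝ × ℝ × ℝ => (q.2.1, q.2.2))
          (by fun_prop)
      simp only [hΦ, hE]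
      fun_prop
    · intro x hx y hy s hs hbd
      rw [add_zero]
      have hs' : s ∈ Icc s0 s1 := ⟨hs.1, hs.2.trans ht.2⟩
      have han := anti x hx y hy s hs
      obtain ⟨r1, r1'⟩ := hρ1 s hs'
      obtain ⟨r2, r2'⟩ := hρ2 s hs'
      obtain ⟨m1, m1'⟩ := hx1 s hs'
      obtain ⟨m2, m2'⟩ := hx2 s hs'
      rcases hbd with e | e | e | e | e
      · have : Φ x y s = 0 := by
          simp only [hΦ]
          rw [zero1 x s (wf_nonpos (by linarith) (Or.inl (by linarith)))]; ring
        linarith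
      · have : Φ x y s = 0 := by
          simp only [hΦ]
          rw [zero1 x s (wf_nonpos (by linarith) (Or.inr (by linarith)))]; ring
        linarith
      · have : Φ x y s = 0 := by
          simp only [hΦ]
          rw [zero2 y s (wf_nonpos (by linarith) (Or.inl (by linarith)))]; ring
        linarith
      · have : Φ x y s = 0 := by
          simp only [hΦ]
          rw [zero2 y s (wf_nonpos (by linarith) (Or.inr (by linarith)))]; ring
        linarith
      · have hi := hinit x hx y hy
        subst e
        have k1 := (g1 s hs' x).2
        have k2 := (g2 s hs' y).2
        have : Φ x y s ≤ h * (C * (max (wf a1 b1 c1 d1 x s) 0 * max (wf a2 b2 c2 d2 y s) 0)) := by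
          have hEs : E s = 1 := by simp [hE]
          have hm : max (G1 x s) 0 * max (G2 y s) 0 ≤
             (l1 * exp (l1 * R ^ 2) * max (wf a1 b1 c1 d1 x s) 0) *
             (l2 * exp (l2 * R ^ 2) * max (wf a2 b2 c2 d2 y s) 0) :=
            mul_le_mul k1 k2 (le_max_right _ _)
              (mul_nonneg (by positivity) (le_max_right _ _))
          calc Φ x y s = h * c * (max (G1 x s) 0 * max (G2 y s) 0) := by
                simp only [hΦ, hEs]; ring
            _ ≤ h * c * _ := mul_le_mul_of_nonneg_left hm (by positivity)
            _ = h * ((c * D) * (max (wf a1 b1 c1 d1 x s) 0 * max (wf a2 b2 c2 d2 y s) 0)) := by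
                rw [hD]; ring
            _ = _ := by rw [hc, div_mul_cancel₀ _ hD0.ne']
        linarith
    · intro x hx y hy s hs hpos
      rw [add_zero] at hpos ⊢
      have hs' : s ∈ Icc s0 s1 := ⟨hs.1.le, hs.2.trans ht.2⟩
      have han := anti x ⟨hx.1.le, hx.2.le⟩ y ⟨hy.1.le, hy.2.le⟩ s ⟨hs.1.le, hs.2⟩
      have hΦp : 0 < Φ x y s := by linarith
      have hw1 : 0 < wf a1 b1 c1 d1 x s := by
        by_contra hcon
        have := zero1 x s (not_lt.1 hcon)
        simp only [hΦ, this] at hΦp; simp at hΦp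
      have hw2 : 0 < wf a2 b2 c2 d2 y s := by
        by_contra hcon
        have := zero2 y s (not_lt.1 hcon)
        simp only [hΦ, this] at hΦp; simp at hΦp
      have hg1 : 0 < G1 x s := by
        have : 1 < exp (l1 * wf a1 b1 c1 d1 x s) := Real.one_lt_exp_iff.2 (by positivity)
        simp only [hG1]; linarith
      have hg2 : 0 < G2 y s := by
        have : 1 < exp (l2 * wf a2 b2 c2 d2 y s) := Real.one_lt_exp_iff.2 (by positivity)
        simp only [hG2]; linarith
      set A : ℝ → ℝ := fun r => h * c * E s *
        (-2 * l1 * (r - (a1 + b1 * s)) * exp (l1 * wf a1 b1 c1 d1 r s)) * G2 y s with hA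
      set Bf : ℝ → ℝ := fun r => h * c * E s * G1 x s *
        (-2 * l2 * (r - (a2 + b2 * s)) * exp (l2 * wf a2 b2 c2 d2 r s)) with hBf
      set G1t := (l1 * (2 * (c1 + d1 * s) * d1 + 2 * (x - (a1 + b1 * s)) * b1) *
        exp (l1 * wf a1 b1 c1 d1 x s)) with hG1t
      set G2t := (l2 * (2 * (c2 + d2 * s) * d2 + 2 * (y - (a2 + b2 * s)) * b2) *
        exp (l2 * wf a2 b2 c2 d2 y s)) with hG2t
      set G1xx := ((4 * l1 ^ 2 * (x - (a1 + b1 * s)) ^ 2 - 2 * l1) *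
        exp (l1 * wf a1 b1 c1 d1 x s)) with hG1xx
      set G2xx := ((4 * l2 ^ 2 * (y - (a2 + b2 * s)) ^ 2 - 2 * l2) *
        exp (l2 * wf a2 b2 c2 d2 y s)) with hG2xx
      refine ⟨A, Bf, h * c * E s * G1xx * G2 y s, h * c * E s * G1 x s * G2xx,
        h * c * E s * (-(K1 + K2) * G1 x s * G2 y s + G1t * G2 y s + G1 x s * G2t),
        ?_, ?_, ?_, ?_, ?_, ?_⟩
      · have : ∀ᶠ r in nhds x, 0 < G1 r s :=
          (cG1.comp (f := fun r : ℝ => (r, s)) (by fun_prop)).continuousAt.eventually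
            (lt_mem_nhds hg1)
        filter_upwards [this.eventually_nhds] with r hr
        have hd := ((wf_dx a1 b1 c1 d1 l1 r s).const_mul (h * c * E s)).mul_const (G2 y s)
        refine hd.congr_of_eventuallyEq ?_
        filter_upwards [hr] with r' hr'
        simp only [hΦ]
        rw [max_eq_left hr'.le, max_eq_left hg2.le]
      · exact ((wf_dxx a1 b1 c1 d1 l1 x s).const_mul (h * c * E s)).mul_const (G2 y s)
      · have : ∀ᶠ r in nhds y, 0 < G2 r s :=
          (cG2.comp (f := fun r : ℝ => (r, s)) (by fun_prop)).continuousAt.eventually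
            (lt_mem_nhds hg2)
        filter_upwards [this.eventually_nhds] with r hr
        have hd := ((wf_dx a2 b2 c2 d2 l2 r s).const_mul (h * c * E s * G1 x s))
        refine hd.congr_of_eventuallyEq ?_
        filter_upwards [hr] with r' hr'
        simp only [hΦ]
        rw [max_eq_left hr'.le, max_eq_left hg1.le]
      · exact (wf_dxx a2 b2 c2 d2 l2 y s).const_mul (h * c * E s * G1 x s)
      · have e1 : ∀ᶠ r in nhds s, 0 < G1 x r :=
          (cG1.comp (f := fun r : ℝ => (x, r)) (by fun_prop)).continuousAt.eventually
            (lt_mem_nhds hg1)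
        have e2 : ∀ᶠ r in nhds s, 0 < G2 y r :=
          (cG2.comp (f := fun r : ℝ => (y, r)) (by fun_prop)).continuousAt.eventually
            (lt_mem_nhds hg2)
        have hEd : HasDerivAt E (-(K1 + K2) * E s) s := by
          have h1 : HasDerivAt (fun t : ℝ => -((K1 + K2) * (t - s0))) (-((K1 + K2) * 1)) s :=
            ((((hasDerivAt_id s).sub_const s0).const_mul (K1 + K2))).neg
          exact h1.exp.congr_deriv (by simp only [hE]; ring)
        have hd := ((hEd.const_mul (h * c)).mul (wf_dt a1 b1 c1 d1 l1 x s)).mul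
          (wf_dt a2 b2 c2 d2 l2 y s)
        refine (hd.congr_of_eventuallyEq ?_).congr_deriv ?_
        · filter_upwards [e1, e2] with r hr1 hr2
          simp only [hΦ]
          rw [max_eq_left hr1.le, max_eq_left hr2.le]
          rfl
        · simp only [Pi.mul_apply, hG1t, hG2t, hG1, hG2]
          ring
      · intro q1 q2
        have hgd := grad_diff hp (hB (x + h) y s ⟨by linarith [hx.1], by linarith [hx.2]⟩
          ⟨hy.1.le, hy.2.le⟩ hs' (by linarith [hs.2])) q1 q2
        rw [← hBd] at hgd
        have F1 := f1 s hs' x hw1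
        have F2 := f2 s hs' y hw2
        rw [← hG1t, ← hG1xx] at F1
        rw [← hG2t, ← hG2xx] at F2
        have hEp : 0 < E s := exp_pos _
        set N1 := |-2 * l1 * (x - (a1 + b1 * s)) * exp (l1 * wf a1 b1 c1 d1 x s)| with hN1
        set N2 := |-2 * l2 * (y - (a2 + b2 * s)) * exp (l2 * wf a2 b2 c2 d2 y s)| with hN2
        have eA : |A x| = h * c * E s * N1 * G2 y s := by
          simp only [hA]
          rw [abs_mul, abs_mul, abs_of_pos hg2, abs_of_pos (show 0 < h * c * E s by positivity)]
        have eB : |Bf y| = h * c * E s * G1 x s * N2 := by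
          simp only [hBf]
          rw [abs_mul, abs_of_pos (show 0 < h * c * E s * G1 x s by positivity)]
        rw [eA, eB] at hgd
        have F1' : G1t - G1xx + B * N1 ≤ K1 * G1 x s := F1
        have F2' : G2t - G2xx + B * N2 ≤ K2 * G2 y s := F2
        have T1 := mul_le_mul_of_nonneg_left F1' (show 0 ≤ h * c * E s * G2 y s by positivity)
        have T2 := mul_le_mul_of_nonneg_left F2' (show 0 ≤ h * c * E s * G1 x s by positivity)
        linarith
  have h2 := eps_lim key
  have k1 := (g1 t ht x).1
  have k2 := (g2 t ht y).1
  have hm1 : 0 ≤ max (wf a1 b1 c1 d1 x t) 0 := le_max_right _ _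
  have hm2 : 0 ≤ max (wf a2 b2 c2 d2 y t) 0 := le_max_right _ _
  have hmm : (l1 * max (wf a1 b1 c1 d1 x t) 0) * (l2 * max (wf a2 b2 c2 d2 y t) 0) ≤
      max (G1 x t) 0 * max (G2 y t) 0 :=
    mul_le_mul k1 k2 (by positivity) (le_max_right _ _)
  have hEt : exp (-((K1 + K2) * (s1 - s0))) ≤ E t := by
    simp only [hE]
    rw [Real.exp_le_exp]
    nlinarith [ht.2]
  have : h * (c * (exp (-((K1 + K2) * (s1 - s0))) * (l1 * l2)) *
      (max (wf a1 b1 c1 d1 x t) 0 * max (wf a2 b2 c2 d2 y t) 0)) ≤ Φ x y t := by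
    calc _ = h * c * (exp (-((K1 + K2) * (s1 - s0))) *
        ((l1 * max (wf a1 b1 c1 d1 x t) 0) * (l2 * max (wf a2 b2 c2 d2 y t) 0))) := by ring
      _ ≤ h * c * (E t * (max (G1 x t) 0 * max (G2 y t) 0)) := by
        apply mul_le_mul_of_nonneg_left _ (by positivity)
        exact mul_le_mul hEt hmm (by positivity) (exp_pos _).le
      _ = _ := by simp only [hΦ]; ring
  linarith

end

section

variable {p L T : ℝ} {u : ℝ → ℝ → ℝ → ℝ}

lemma wf_static (l r x t : ℝ) :
    wf ((l + r) / 2) 0 ((r - l) / 2) 0 x t = (x - l) * (r - x) := by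
  unfold wf; ring

lemma hopf_static (hp : 2 < p) (hsol : ClassicalSolution p L T u) (hmon : MonCond L T u)
    {xl xr yl yr s0 s1 B0 C : ℝ}
    (hxl : 0 ≤ xl) (hx : xl < xr) (hxr : xr < L) (hyl : 0 ≤ yl) (hy : yl < yr) (hyr : yr < L)
    (hs0 : 0 < s0) (hB0 : 0 ≤ B0) (hC : 0 < C)
    (hB : ∀ x y t : ℝ, x ∈ Icc xl L → y ∈ Icc yl yr → t ∈ Icc s0 s1 → t < T →
      gradNorm u x y t ≤ B0) :
    ∃ C2 > 0, ∀ h, 0 < h → h < L - xr →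
      (∀ x ∈ Icc xl xr, ∀ y ∈ Icc yl yr,
        h * (C * (((x - xl) * (xr - x)) * ((y - yl) * (yr - y)))) ≤
          u x y s0 - u (x + h) y s0) →
      ∀ x ∈ Icc xl xr, ∀ y ∈ Icc yl yr, ∀ t ∈ Icc s0 s1, t < T →
        h * (C2 * (((x - xl) * (xr - x)) * ((y - yl) * (yr - y)))) ≤
          u x y t - u (x + h) y t := by
  have hL : 0 < L := by linarith
  obtain ⟨C2, hC2, h⟩ := hopf hp hsol hmon (xl := xl) (xr := xr) (yl := yl) (yr := yr) (s0 := s0)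
    (s1 := s1) (B0 := B0) (ρ0 := min ((xr - xl) / 2) ((yr - yl) / 2)) (R := L)
    (a1 := (xl + xr) / 2) (b1 := 0) (c1 := (xr - xl) / 2) (d1 := 0)
    (a2 := (yl + yr) / 2) (b2 := 0) (c2 := (yr - yl) / 2) (d2 := 0) (C := C)
    hxl hyl hyr hs0 (lt_min (by linarith) (by linarith)) hL.le hB0 hC hB
    (fun t _ => ⟨by rw [zero_mul, add_zero]; exact min_le_left _ _, by linarith⟩)
    (fun t _ => ⟨by rw [zero_mul, add_zero]; exact min_le_right _ _, by linarith⟩)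
    (fun t _ => ⟨by linarith, by linarith⟩)
    (fun t _ => ⟨by linarith, by linarith⟩)
  refine ⟨C2, hC2, fun k hk hk2 hin x hx y hy t ht htT => ?_⟩
  have e : ∀ x ∈ Icc xl xr, ∀ t, max (wf ((xl + xr) / 2) 0 ((xr - xl) / 2) 0 x t) 0 =
      (x - xl) * (xr - x) := fun x hx t => by
    rw [wf_static]
    exact max_eq_left (mul_nonneg (by linarith [hx.1]) (by linarith [hx.2]))
  have e2 : ∀ x ∈ Icc yl yr, ∀ t, max (wf ((yl + yr) / 2) 0 ((yr - yl) / 2) 0 x t) 0 =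
      (x - yl) * (yr - x) := fun x hx t => by
    rw [wf_static]
    exact max_eq_left (mul_nonneg (by linarith [hx.1]) (by linarith [hx.2]))
  have := h k hk hk2 (fun x hx y hy => by rw [e x hx, e2 y hy]; exact hin x hx y hy) x hx y hy t
    ht htT
  rwa [e x hx, e2 y hy] at this

/-- initial stage -/
lemma hopf_init (hp : 2 < p) (hL : 0 < L) (hsol : ClassicalSolution p L T u)
    (hmon : MonCond L T u)
    {xs ys ts t0 : ℝ} (hxs : xs ∈ Ioo 0 L) (hys : ys ∈ Ioo 0 L) (hts : ts ∈ Ioo 0 T)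
    (ht0 : ts < t0) (ht0T : t0 < T) (hneg : pdx u xs ys ts < 0) :
    ∃ X ∈ Ioo 0 L, ∃ Y ∈ Ioo 0 L, ∃ C > 0, ∃ h0 > 0, h0 ≤ L - X ∧ ∀ h, 0 < h → h < h0 →
      ∀ x ∈ Icc 0 X, ∀ y ∈ Icc 0 Y,
        h * (C * ((x * (X - x)) * (y * (Y - y)))) ≤ u x y t0 - u (x + h) y t0 := by
  obtain ⟨hx0, hxL⟩ := hxs
  obtain ⟨hy0, hyL⟩ := hys
  set X := (xs + L) / 2 with hX
  set Y := (ys + L) / 2 with hY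
  set c0 := -(pdx u xs ys ts) / 2 with hc0
  have hc0p : 0 < c0 := by rw [hc0]; linarith
  have hcont := cs_cx hsol (x := xs) (y := ys) (t := ts) (abs_le.2 ⟨by linarith, by linarith⟩)
    ⟨hy0.le, hyL.le⟩ hts
  have hev : ∀ᶠ q : ℝ × ℝ × ℝ in nhds (xs, ys, ts), pdx u q.1 q.2.1 q.2.2 < -c0 :=
    hcont.eventually (gt_mem_nhds (by rw [hc0]; show pdx u xs ys ts < _; linarith))
  obtain ⟨r', hr', hball⟩ := Metric.eventually_nhds_iff.1 hev
  obtain ⟨r, hr, hr1, hr2, hr3, hr4, hr5⟩ : ∃ r > 0, r ≤ r' / 4 ∧ r ≤ xs / 2 ∧ r ≤ (L - xs) / 4 ∧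
      r ≤ ys / 2 ∧ r ≤ (L - ys) / 4 := by
    refine ⟨min (r' / 4) (min (xs / 2) (min ((L - xs) / 4) (min (ys / 2) ((L - ys) / 4)))), ?_, ?_⟩
    · simp only [lt_min_iff, gt_iff_lt]
      refine ⟨?_, ?_, ?_, ?_, ?_⟩ <;> linarith
    · simp
  have hdec : ∀ h, 0 < h → h < r → ∀ x, |x - xs| < r → ∀ y, |y - ys| < r →
      h * c0 ≤ u x y ts - u (x + h) y ts := by
    intro h hh hhr x hx y hy
    rw [abs_lt] at hx hy
    have hyI : y ∈ Icc 0 L := ⟨by linarith, by linarith⟩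
    have hd : ∀ s ∈ Icc x (x + h), HasDerivAt (fun s => u s y ts) (pdx u s y ts) s := fun s hs =>
      cs_dx hsol (abs_le.2 ⟨by linarith [hs.1], by linarith [hs.2]⟩) hyI hts
    have := Convex.image_sub_le_mul_sub_of_deriv_le (convex_Icc x (x + h))
      (f := fun s => u s y ts) (C := -c0)
      (fun s hs => (hd s hs).continuousAt.continuousWithinAt)
      (fun s hs => (hd s (interior_subset hs)).differentiableAt.differentiableWithinAt)
      (fun s hs => by
        have hs' := interior_subset hs
        rw [(hd s hs').deriv]
        have := @hball (s, y, ts) (by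
          rw [Prod.dist_eq, Prod.dist_eq, dist_self, Real.dist_eq, Real.dist_eq]
          refine max_lt ?_ (max_lt ?_ hr')
          · rw [abs_lt]; constructor <;> linarith [hs'.1, hs'.2]
          · rw [abs_lt]; constructor <;> linarith)
        exact this.le)
      x ⟨le_rfl, by linarith⟩ (x + h) ⟨by linarith, le_rfl⟩ (by linarith)
    have e : -c0 * (x + h - x) = -(h * c0) := by ring
    rw [e] at this
    linarith
  obtain ⟨B0, hB0, hB⟩ := grad_bdd_compact hsol hts.1 ht0T
  set τ := t0 - ts with hτ
  have hτ0 : 0 < τ := by rw [hτ]; linarith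
  have conv : ∀ a b t, a + (b - a) / τ * (t - ts) =
      a * (1 - (t - ts) / τ) + b * ((t - ts) / τ) := by
    intro a b t; field_simp; ring
  have hlam : ∀ t ∈ Icc ts t0, 0 ≤ (t - ts) / τ ∧ 0 ≤ 1 - (t - ts) / τ := by
    intro t ht
    refine ⟨div_nonneg (by linarith [ht.1]) hτ0.le, ?_⟩
    rw [sub_nonneg, div_le_one hτ0]
    linarith [ht.2]
  have lin : ∀ a b t, (a - (b - a) / τ * ts) + (b - a) / τ * t =
      a * (1 - (t - ts) / τ) + b * ((t - ts) / τ) := by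
    intro a b t; rw [← conv]; ring
  have hle : ∀ a b m t, t ∈ Icc ts t0 → m ≤ a → m ≤ b →
      m ≤ a * (1 - (t - ts) / τ) + b * ((t - ts) / τ) := by
    intro a b m t ht h1 h2
    obtain ⟨l1, l2⟩ := hlam t ht
    nlinarith
  have hge : ∀ a b m t, t ∈ Icc ts t0 → a ≤ m → b ≤ m →
      a * (1 - (t - ts) / τ) + b * ((t - ts) / τ) ≤ m := by
    intro a b m t ht h1 h2
    obtain ⟨l1, l2⟩ := hlam t ht
    nlinarith
  obtain ⟨C2, hC2, H⟩ := hopf hp hsol hmon (xl := 0) (xr := X) (yl := 0) (yr := Y) (s0 := ts)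
    (s1 := t0) (B0 := B0) (ρ0 := min r (min (X / 2) (Y / 2))) (R := L)
    (a1 := xs - (X / 2 - xs) / τ * ts) (b1 := (X / 2 - xs) / τ)
    (c1 := r - (X / 2 - r) / τ * ts) (d1 := (X / 2 - r) / τ)
    (a2 := ys - (Y / 2 - ys) / τ * ts) (b2 := (Y / 2 - ys) / τ)
    (c2 := r - (Y / 2 - r) / τ * ts) (d2 := (Y / 2 - r) / τ)
    (C := c0 / r ^ 4)
    le_rfl le_rfl (by rw [hY]; linarith) hts.1
    (lt_min hr (lt_min (by rw [hX]; linarith) (by rw [hY]; linarith))) hL.le hB0.le (by positivity)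
    (fun x y t hx hy ht _ => hB x y t (abs_le.2 ⟨by linarith [hx.1], hx.2⟩)
      ⟨hy.1, by linarith [hy.2]⟩ ht)
    (fun t ht => by
      rw [lin]
      exact ⟨hle _ _ _ t ht (min_le_left _ _) ((min_le_right _ _).trans (min_le_left _ _)),
        hge _ _ _ t ht (by linarith) (by linarith)⟩)
    (fun t ht => by
      rw [lin]
      exact ⟨hle _ _ _ t ht (min_le_left _ _) ((min_le_right _ _).trans (min_le_right _ _)),
        hge _ _ _ t ht (by linarith) (by linarith)⟩)
    (fun t ht => by
      rw [lin, lin]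
      constructor
      · have := hle (xs - r) 0 0 t ht (by linarith) le_rfl
        linarith
      · have := hge (xs + r) X X t ht (by linarith) le_rfl
        linarith)
    (fun t ht => by
      rw [lin, lin]
      constructor
      · have := hle (ys - r) 0 0 t ht (by linarith) le_rfl
        linarith
      · have := hge (ys + r) Y Y t ht (by linarith) le_rfl
        linarith)
  refine ⟨X, ⟨by linarith, by linarith⟩, Y, ⟨by linarith, by linarith⟩, C2, hC2, min r (L - X),
    lt_min hr (by linarith), min_le_right _ _, ?_⟩
  intro h hh hh0 x hx y hy
  obtain ⟨hhr, hhX⟩ := lt_min_iff.1 hh0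
  have := H h hh hhX ?_ x hx y hy t0 ⟨ht0.le, le_rfl⟩ ht0T
  · have e1 : wf (xs - (X / 2 - xs) / τ * ts) ((X / 2 - xs) / τ) (r - (X / 2 - r) / τ * ts)
        ((X / 2 - r) / τ) x t0 = x * (X - x) := by
      unfold wf
      rw [lin, lin, ← hτ, div_self hτ0.ne']; ring
    have e2 : wf (ys - (Y / 2 - ys) / τ * ts) ((Y / 2 - ys) / τ) (r - (Y / 2 - r) / τ * ts)
        ((Y / 2 - r) / τ) y t0 = y * (Y - y) := by
      unfold wf
      rw [lin, lin, ← hτ, div_self hτ0.ne']; ring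
    rw [e1, e2, max_eq_left (mul_nonneg hx.1 (by linarith [hx.2])),
      max_eq_left (mul_nonneg hy.1 (by linarith [hy.2]))] at this
    exact this
  · intro x hx y hy
    have e1 : wf (xs - (X / 2 - xs) / τ * ts) ((X / 2 - xs) / τ) (r - (X / 2 - r) / τ * ts)
        ((X / 2 - r) / τ) x ts = r ^ 2 - (x - xs) ^ 2 := by
      unfold wf
      rw [lin, lin, sub_self]; ring
    have e2 : wf (ys - (Y / 2 - ys) / τ * ts) ((Y / 2 - ys) / τ) (r - (Y / 2 - r) / τ * ts)
        ((Y / 2 - r) / τ) y ts = r ^ 2 - (y - ys) ^ 2 := by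
      unfold wf
      rw [lin, lin, sub_self]; ring
    rw [e1, e2]
    have han : u (x + h) y ts ≤ u x y ts := u_anti hsol hmon hx.1 (by linarith)
      (by linarith [hx.2]) ⟨hy.1, by linarith [hy.2]⟩ hts
    by_cases h1 : |x - xs| < r
    · by_cases h2 : |y - ys| < r
      · refine le_trans ?_ (hdec h hh hhr x h1 y h2)
        have m1 : max (r ^ 2 - (x - xs) ^ 2) 0 ≤ r ^ 2 :=
          max_le (by nlinarith [sq_nonneg (x - xs)]) (by positivity)
        have m2 : max (r ^ 2 - (y - ys) ^ 2) 0 ≤ r ^ 2 :=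
          max_le (by nlinarith [sq_nonneg (y - ys)]) (by positivity)
        have m3 := mul_le_mul m1 m2 (le_max_right _ _) (by positivity)
        have m4 : c0 / r ^ 4 * (r ^ 2 * r ^ 2) = c0 := by field_simp
        have m5 := mul_le_mul_of_nonneg_left m3 (show 0 ≤ c0 / r ^ 4 by positivity)
        rw [m4] at m5
        exact mul_le_mul_of_nonneg_left m5 hh.le
      · have : r ^ 2 - (y - ys) ^ 2 ≤ 0 := by
          rw [not_lt] at h2
          have := pow_le_pow_left₀ hr.le h2 2
          rw [sq_abs] at this; linarith
        rw [max_eq_right this]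
        simp; linarith
    · have : r ^ 2 - (x - xs) ^ 2 ≤ 0 := by
        rw [not_lt] at h1
        have := pow_le_pow_left₀ hr.le h1 2
        rw [sq_abs] at this; linarith
      rw [max_eq_right this]
      simp; linarith

lemma hopf_main (hp : 2 < p) (hL : 0 < L) (hT : 0 < T) (hsol : ClassicalSolution p L T u)
    (hgbu : IsolatedGBU L T u) (hmon : MonCond L T u) {ym : ℝ} (hym : 0 < ym) :
    ∃ x1 y1 t0 c h0 : ℝ, 0 < x1 ∧ x1 < L / 4 ∧ 0 < y1 ∧ y1 < L / 4 ∧ y1 ≤ ym ∧ T / 2 < t0 ∧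
      t0 < T ∧ 0 < c ∧ 0 < h0 ∧ ∀ h, 0 < h → h < h0 →
      ∀ x ∈ Icc 0 x1, ∀ y ∈ Icc 0 y1, ∀ t ∈ Ico t0 T, (t = t0 ∨ x = x1 ∨ y = y1) →
        h * (c * (x * y)) ≤ u x y t - u (x + h) y t := by
  obtain ⟨xs, hxs, ys, hys, ts, hts, hneg⟩ := exists_neg hL hT hsol hgbu hmon
  set t0 := (max ts (T / 2) + T) / 2 with ht0
  have hm : max ts (T / 2) < T := max_lt hts.2 (by linarith)
  have hm1 := le_max_left ts (T / 2)
  have hm2 := le_max_right ts (T / 2)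
  have ht0T : t0 < T := by linarith
  obtain ⟨X, ⟨hX0, hXL⟩, Y, ⟨hY0, hYL⟩, C, hC, h0, hh0, hh0X, H⟩ := hopf_init hp hL hsol hmon
    hxs hys hts (show ts < t0 by linarith) ht0T hneg
  set y1 := min ym (Y / 4) with hy1
  have hy10 : 0 < y1 := lt_min hym (by linarith)
  have hy1Y : y1 ≤ Y / 4 := min_le_right _ _
  have ht00 : 0 < t0 := by linarith
  obtain ⟨B1, hB1, b1⟩ := outer_bdd hgbu (show 0 < X / 8 by linarith)
  obtain ⟨B2, hB2, b2⟩ := outer_bdd hgbu (show 0 < y1 / 2 by linarith)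
  obtain ⟨C1, hC1, H1⟩ := hopf_static hp hsol hmon (xl := X / 8) (xr := X) (yl := 0) (yr := Y)
    (s0 := t0) (s1 := T) (B0 := B1) (C := C) (by linarith) (by linarith) hXL le_rfl hY0 hYL ht00
    hB1.le hC (fun x y t hx hy ht htT => b1 x y t (abs_le.2 ⟨by linarith [hx.1], hx.2⟩)
      ⟨hy.1, by linarith [hy.2]⟩ ⟨by linarith [ht.1], htT⟩ (Or.inl (hx.1.trans (le_abs_self x))))
  obtain ⟨C2, hC2, H2⟩ := hopf_static hp hsol hmon (xl := 0) (xr := X) (yl := y1 / 2) (yr := Y)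
    (s0 := t0) (s1 := T) (B0 := B2) (C := C) le_rfl hX0 hXL (by linarith) (by linarith) hYL ht00
    hB2.le hC (fun x y t hx hy ht htT => b2 x y t (abs_le.2 ⟨by linarith [hx.1], hx.2⟩)
      ⟨by linarith [hy.1], by linarith [hy.2]⟩ ⟨by linarith [ht.1], htT⟩ (Or.inr hy.1))
  set c := min (C * (X / 2 * (Y / 2))) (min (C1 / 8 * (X / 2 * (Y / 2))) (C2 / 2 * (X / 2 * (Y / 2))))
    with hc
  have hc0 : 0 < c := lt_min (by positivity) (lt_min (by positivity) (by positivity))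
  refine ⟨X / 4, y1, t0, c, h0, by linarith, by linarith, hy10, by linarith, min_le_left _ _,
    by linarith, ht0T, hc0, hh0, ?_⟩
  intro h hh hhh x hx y hy t ht hcase
  have hxX : x ∈ Icc 0 X := ⟨hx.1, by linarith [hx.2]⟩
  have hyY : y ∈ Icc 0 Y := ⟨hy.1, by linarith [hy.2]⟩
  have hXx : X / 2 ≤ X - x := by linarith [hx.2]
  have hYy : Y / 2 ≤ Y - y := by linarith [hy.2]
  have hxy : 0 ≤ x * y := mul_nonneg hx.1 hy.1
  have hprod : X / 2 * (Y / 2) ≤ (X - x) * (Y - y) :=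
    mul_le_mul hXx hYy (by linarith) (by linarith)
  rcases hcase with e | e | e
  · subst e
    refine le_trans (mul_le_mul_of_nonneg_left ?_ hh.le) (H h hh hhh x hxX y hyY)
    calc c * (x * y) ≤ C * (X / 2 * (Y / 2)) * (x * y) :=
          mul_le_mul_of_nonneg_right (min_le_left _ _) hxy
      _ ≤ C * ((X - x) * (Y - y)) * (x * y) :=
          mul_le_mul_of_nonneg_right (mul_le_mul_of_nonneg_left hprod hC.le) hxy
      _ = _ := by ring
  · refine le_trans (mul_le_mul_of_nonneg_left ?_ hh.le)
      (H1 h hh (by linarith) (fun x hx y hy => ?_) x ⟨by linarith, hxX.2⟩ y hyY t ⟨ht.1, ht.2.le⟩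
        ht.2)
    · have hk : x / 8 ≤ x - X / 8 := by linarith
      calc c * (x * y) ≤ C1 / 8 * (X / 2 * (Y / 2)) * (x * y) :=
          mul_le_mul_of_nonneg_right ((min_le_right _ _).trans (min_le_left _ _)) hxy
        _ ≤ C1 / 8 * ((X - x) * (Y - y)) * (x * y) :=
          mul_le_mul_of_nonneg_right (mul_le_mul_of_nonneg_left hprod (by positivity)) hxy
        _ = C1 * ((X - x) * (Y - y)) * y * (x / 8) := by ring
        _ ≤ C1 * ((X - x) * (Y - y)) * y * (x - X / 8) :=
          mul_le_mul_of_nonneg_left hk (mul_nonneg (mul_nonneg hC1.le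
            (mul_nonneg (by linarith) (by linarith))) hy.1)
        _ = _ := by ring
    · refine le_trans (mul_le_mul_of_nonneg_left (mul_le_mul_of_nonneg_left ?_ hC.le) hh.le)
        (H h hh hhh x ⟨by linarith [hx.1], hx.2⟩ y hy)
      rw [sub_zero]
      apply mul_le_mul_of_nonneg_right _ (mul_nonneg hy.1 (by linarith [hy.2]))
      exact mul_le_mul_of_nonneg_right (by linarith) (by linarith [hx.2])
  · refine le_trans (mul_le_mul_of_nonneg_left ?_ hh.le)
      (H2 h hh (by linarith) (fun x hx y hy => ?_) x hxX y ⟨by linarith, hyY.2⟩ t ⟨ht.1, ht.2.le⟩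
        ht.2)
    · have hk : y / 2 ≤ y - y1 / 2 := by linarith
      calc c * (x * y) ≤ C2 / 2 * (X / 2 * (Y / 2)) * (x * y) :=
          mul_le_mul_of_nonneg_right ((min_le_right _ _).trans (min_le_right _ _)) hxy
        _ ≤ C2 / 2 * ((X - x) * (Y - y)) * (x * y) :=
          mul_le_mul_of_nonneg_right (mul_le_mul_of_nonneg_left hprod (by positivity)) hxy
        _ = C2 * ((X - x) * (Y - y)) * x * (y / 2) := by ring
        _ ≤ C2 * ((X - x) * (Y - y)) * x * (y - y1 / 2) :=
          mul_le_mul_of_nonneg_left hk (mul_nonneg (mul_nonneg hC2.le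
            (mul_nonneg (by linarith) (by linarith))) hx.1)
        _ = _ := by ring
    · refine le_trans (mul_le_mul_of_nonneg_left (mul_le_mul_of_nonneg_left ?_ hC.le) hh.le)
        (H h hh hhh x hx y ⟨by linarith [hy.1], hy.2⟩)
      rw [sub_zero]
      apply mul_le_mul_of_nonneg_left _ (mul_nonneg hx.1 (by linarith [hx.2]))
      exact mul_le_mul_of_nonneg_right (by linarith) (by linarith [hy.2])

end

section

lemma falg {β q C : ℝ} (hβ : 1 / 2 ≤ β) (hβ1 : β < 1) (hq : 1 < q * β) (hC : 0 ≤ C) :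
    ∃ c0 > 0, ∀ Z n s : ℝ, 0 ≤ Z → Z ≤ 1 → n ≤ 1 → -(C * Z) ≤ n →
      -(1 - β) * max n 0 - C * Z ≤ s →
      -(q - 1) * s ^ 2 + (n - (2 * β - 1)) * s - β * (1 - β) * n ≤
        -c0 * (max n 0 + s ^ 2) + (2 * C + C ^ 2) * Z := by
  have hq1 : 1 < q := by nlinarith
  have hb : 0 < 1 - β := by linarith
  have hq1' : 0 < q - 1 := by linarith
  obtain ⟨μ, hμ0, hμ1, hμ2⟩ : ∃ μ : ℝ, 0 < μ ∧ μ < β ∧ (1 - β) < (q - 1) * μ := by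
    have h1 : (1 - β) / (q - 1) < β := by rw [div_lt_iff₀ hq1']; linarith
    have h2 : 0 < (1 - β) / (q - 1) := by positivity
    refine ⟨((1 - β) / (q - 1) + β) / 2, by linarith, by linarith, ?_⟩
    have h3 : (q - 1) * ((1 - β) / (q - 1)) = 1 - β := by field_simp
    nlinarith
  set e1 := (q - 1) - (1 - β) / μ with he1
  have he1p : 0 < e1 := by
    rw [he1, sub_pos, div_lt_iff₀ hμ0]; exact hμ2
  set e2 := (1 - β) * (β - μ) with he2
  have he2p : 0 < e2 := mul_pos hb (by linarith)
  obtain ⟨c0, hc0, k1, k2, k3, k4⟩ : ∃ c0 > 0, c0 ≤ e1 ∧ c0 ≤ e2 ∧ c0 ≤ q - 1 ∧ c0 ≤ (1 - β) ^ 2 := by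
    refine ⟨min e1 (min e2 (min (q - 1) ((1 - β) ^ 2))), ?_, ?_⟩
    · simp only [lt_min_iff, gt_iff_lt]
      exact ⟨he1p, he2p, hq1', by positivity⟩
    · simp
  refine ⟨c0, hc0, ?_⟩
  intro Z n s hZ hZ1 hn1 hn2 hs
  have hCZ : 0 ≤ C * Z := mul_nonneg hC hZ
  have hC2Z : 0 ≤ C ^ 2 * Z := by positivity
  have hs2 : 0 ≤ s ^ 2 := sq_nonneg s
  rcases le_or_gt 0 n with hn | hn
  · rw [max_eq_left hn] at hs ⊢
    have t1 : c0 * n ≤ e2 * n := mul_le_mul_of_nonneg_right k2 hn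
    have t2 : c0 * s ^ 2 ≤ e1 * s ^ 2 := mul_le_mul_of_nonneg_right k1 hs2
    have t3 : c0 * s ^ 2 ≤ (q - 1) * s ^ 2 := mul_le_mul_of_nonneg_right k3 hs2
    have t4 : c0 * n ≤ (1 - β) ^ 2 * n := mul_le_mul_of_nonneg_right k4 hn
    rcases le_or_gt 0 s with h0 | h0
    · have i1 : 2 * (n * s) ≤ μ * n + s ^ 2 / μ := by
        have : 0 ≤ (μ * n - s) ^ 2 / μ := by positivity
        have e : (μ * n - s) ^ 2 / μ = μ * n ^ 2 - 2 * (n * s) + s ^ 2 / μ := by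
          field_simp; ring
        have : n ^ 2 ≤ n := by nlinarith
        nlinarith
      have i2 : (1 - β) * (2 * (n * s)) ≤ (1 - β) * (μ * n + s ^ 2 / μ) :=
        mul_le_mul_of_nonneg_left i1 hb.le
      have i3 : 0 ≤ (1 - n) * (2 * β - 1) * s :=
        mul_nonneg (mul_nonneg (by linarith) (by linarith)) h0
      have i4 : e1 * s ^ 2 = (q - 1) * s ^ 2 - (1 - β) * (s ^ 2 / μ) := by
        rw [he1]; ring
      have i5 : e2 * n = (1 - β) * β * n - (1 - β) * (μ * n) := by rw [he2]; ring
      linarith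
    · have i1 : (2 * β - 1) * (-s) ≤ (2 * β - 1) * ((1 - β) * n + C * Z) :=
        mul_le_mul_of_nonneg_left (by linarith) (by linarith)
      have i2 : (2 * β - 1) * (C * Z) ≤ 1 * (C * Z) :=
        mul_le_mul_of_nonneg_right (by linarith) hCZ
      have i3 : n * s ≤ 0 := mul_nonpos_of_nonneg_of_nonpos hn h0.le
      linarith
  · rw [max_eq_right hn.le] at hs ⊢
    have t3 : c0 * s ^ 2 ≤ (q - 1) * s ^ 2 := mul_le_mul_of_nonneg_right k3 hs2
    have i0 : -(β * (1 - β) * n) ≤ C * Z := by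
      have : β * (1 - β) ≤ 1 := by nlinarith
      have : 0 ≤ β * (1 - β) := by positivity
      nlinarith
    rcases le_or_gt 0 s with h0 | h0
    · have i1 : (n - (2 * β - 1)) * s ≤ 0 := mul_nonpos_of_nonpos_of_nonneg (by linarith) h0
      linarith
    · have i1 : (n - (2 * β - 1)) * s ≤ (1 + C) * (C * Z) := by
        have j1 : -(n - (2 * β - 1)) ≤ 1 + C := by nlinarith
        have j2 : -s ≤ C * Z := by linarith
        calc (n - (2 * β - 1)) * s = (-(n - (2 * β - 1))) * (-s) := by ring
          _ ≤ (1 + C) * (C * Z) := mul_le_mul j1 j2 (by linarith) (by linarith)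
      nlinarith

lemma Ealg {β q C : ℝ} (hβ : 1 / 2 ≤ β) (hβ1 : β < 1) (hq : 1 < q * β) (hC : 0 ≤ C) :
    ∃ Y0 > 0, Y0 ≤ 1 ∧ ∀ Y θ n s err : ℝ, 0 < Y → Y ≤ Y0 → Y / 2 ≤ θ → θ ≤ Y → n ≤ 1 →
      -(C * Y ^ 2) ≤ n → -(1 - β) * max n 0 - C * Y ^ 2 ≤ s → err ≤ C * Y ^ 2 →
      q * (-(q - 1) * s ^ 2 + (n - (2 * β - 1)) * s - β * (1 - β) * n) +
        θ * (β / 2) * (-(β / 2 + β) - 2 * q * s + (1 + β) * n) + err ≤ 0 := by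
  obtain ⟨c0, hc0, hf⟩ := falg hβ hβ1 hq hC
  have hq0 : 0 < q := by nlinarith
  set C3 := q * (2 * C + C ^ 2) + q * (β / 2) ^ 2 / c0 + C with hC3
  have hC30 : 0 ≤ C3 := by positivity
  set e := β / 2 * (β / 2 + β) / 2 with he
  have he0 : 0 < e := by positivity
  refine ⟨min 1 (min (q * c0 / (β / 2 * (1 + β))) (e / (C3 + 1))), ?_, min_le_left _ _, ?_⟩
  · refine lt_min one_pos (lt_min ?_ ?_) <;> positivity
  intro Y θ n s err hY hY0 hθ1 hθ2 hn1 hn2 hs herr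
  obtain ⟨y1, y2, y3⟩ := le_min_iff.1 hY0 |>.imp id le_min_iff.1
  rw [le_div_iff₀ (by positivity)] at y2 y3
  have f := hf (Y ^ 2) n s (by positivity) (by nlinarith) hn1 hn2 hs
  have fq := mul_le_mul_of_nonneg_left f hq0.le
  have hm0 : 0 ≤ max n 0 := le_max_right _ _
  have hmn : n ≤ max n 0 := le_max_left _ _
  have hθ0 : 0 < θ := by linarith
  have T1 : θ * (β / 2) * ((1 + β) * n) ≤ q * c0 * max n 0 := by
    calc θ * (β / 2) * ((1 + β) * n) ≤ θ * (β / 2) * ((1 + β) * max n 0) := by gcongr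
      _ ≤ Y * (β / 2) * ((1 + β) * max n 0) := by gcongr
      _ = Y * (β / 2 * (1 + β)) * max n 0 := by ring
      _ ≤ _ := by gcongr
  have T2 : θ * (β / 2) * (-(β / 2 + β)) ≤ -(e * Y) := by
    rw [he]
    have : Y / 2 * (β / 2 * (β / 2 + β)) ≤ θ * (β / 2 * (β / 2 + β)) := by gcongr
    linarith
  have T3 : θ * (β / 2) * (-2 * q * s) ≤ q * c0 * s ^ 2 + q * (β / 2) ^ 2 / c0 * Y ^ 2 := by
    have j1 : 0 ≤ (c0 * s + θ * (β / 2)) ^ 2 / c0 := by positivity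
    have j2 : (c0 * s + θ * (β / 2)) ^ 2 / c0 = c0 * s ^ 2 + 2 * s * (θ * (β / 2)) +
        θ ^ 2 * ((β / 2) ^ 2 / c0) := by field_simp; ring
    have j3 : θ ^ 2 * ((β / 2) ^ 2 / c0) ≤ Y ^ 2 * ((β / 2) ^ 2 / c0) := by gcongr
    have j4 : 0 ≤ q * (c0 * s ^ 2 + 2 * s * (θ * (β / 2)) + Y ^ 2 * ((β / 2) ^ 2 / c0)) :=
      mul_nonneg hq0.le (by linarith)
    have j5 : q * (β / 2) ^ 2 / c0 * Y ^ 2 = q * (Y ^ 2 * ((β / 2) ^ 2 / c0)) := by ring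
    rw [j5]; linarith
  have T4 : C3 * Y ^ 2 ≤ e * Y := by nlinarith
  have T5 : C3 * Y ^ 2 = q * ((2 * C + C ^ 2) * Y ^ 2) + q * (β / 2) ^ 2 / c0 * Y ^ 2 + C * Y ^ 2 := by
    rw [hC3]; ring
  linarith

end

section

/-- weight -/
def Dw (γ a y : ℝ) : ℝ := y ^ (-γ) * (1 + y ^ a)
/-- ratio -/
def thw (a y : ℝ) : ℝ := y ^ a / (1 + y ^ a)
/-- minus log derivative of weight -/
def Pw (γ a y : ℝ) : ℝ := (γ - a * thw a y) / y
/-- second derivative ratio -/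
def Qw (γ a y : ℝ) : ℝ := (γ * (γ + 1) - (2 * γ * a + a * (1 - a)) * thw a y) / y ^ 2

set_option maxHeartbeats 1000000 in
lemma lemE {p q β C0 : ℝ} (hp : 2 < p) (hp3 : p ≤ 3) (hβ : β * (p - 1) = 1) (hq : p - 1 < q)
    (hC0 : 0 ≤ C0) :
    ∃ y1 > 0, y1 ≤ 1 ∧ ∀ y G v k : ℝ, 0 < y → y ≤ y1 → 0 ≤ G → 0 < v →
      G ≤ β ^ β * y ^ (-β) + C0 → v ≤ β ^ β / (1 - β) * y ^ (1 - β) + C0 * y → 0 ≤ k → k ≤ 1 →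
      -((p - 1) * q * (G ^ p / v)) - q * (q - 1) * (G / v) ^ 2 - Qw (q * (1 - β)) (β / 2) y
        + 2 * q * (G / v) * Pw (q * (1 - β)) (β / 2) y
        + p * G ^ (p - 1) * Pw (q * (1 - β)) (β / 2) y
        + (2 * k * q * Dw (q * (1 - β)) (β / 2) y * v ^ (q - 1) +
            p * k * G ^ (p - 2) * Dw (q * (1 - β)) (β / 2) y * v ^ q) ≤ 0 := by
  have hβ0 : 0 < β := by
    by_contra h
    have : β * (p - 1) ≤ 0 := mul_nonpos_of_nonpos_of_nonneg (not_lt.1 h) (by linarith)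
    linarith
  have hβ1 : β < 1 := by nlinarith
  have hβ2 : 1 / 2 ≤ β := by nlinarith
  have hqβ : 1 < q * β := by nlinarith
  have hq1 : 1 < q := by linarith
  have hb : 0 < 1 - β := by linarith
  set d := β ^ β with hd
  have hd0 : 0 < d := Real.rpow_pos_of_pos hβ0 _
  set η := C0 / d with hη
  have hη0 : 0 ≤ η := by positivity
  set Cs := C0 * (1 - β) / d with hCs
  have hCs0 : 0 ≤ Cs := by positivity
  set C1 := d / (1 - β) + C0 with hC1
  have hC10 : 0 < C1 := by positivity
  set C2 := d + C0 with hC2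
  have hC20 : 0 < C2 := by positivity
  set Ce := 4 * q * C1 ^ (q - 1) + 2 * p * C1 ^ q * C2 ^ (p - 2) with hCe
  have hCe0 : 0 ≤ Ce := by positivity
  obtain ⟨Y0, hY0, hY01, hE⟩ := Ealg (C := (2 * η + η ^ 2) + Cs + Ce) hβ2 hβ1 hqβ (by positivity)
  refine ⟨min 1 (Y0 ^ (2 / β)), lt_min one_pos (Real.rpow_pos_of_pos hY0 _), min_le_left _ _, ?_⟩
  intro y G v k hy hyy hG hv hGu hvu hk0 hk1
  obtain ⟨hy1, hyY⟩ := le_min_iff.1 hyy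
  set Y := y ^ (β / 2) with hY
  have hYp : 0 < Y := Real.rpow_pos_of_pos hy _
  have hYle : Y ≤ Y0 := by
    have := Real.rpow_le_rpow hy.le hyY (show 0 ≤ β / 2 by linarith)
    rw [← Real.rpow_mul hY0.le, show 2 / β * (β / 2) = 1 by field_simp, Real.rpow_one] at this
    exact this
  set z := y ^ β with hz
  have hzp : 0 < z := Real.rpow_pos_of_pos hy _
  have hYz : Y ^ 2 = z := by
    rw [hY, hz, ← Real.rpow_natCast, ← Real.rpow_mul hy.le]; congr 1; push_cast; ring
  have hz1 : z ≤ 1 := Real.rpow_le_one hy.le hy1 hβ0.le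
  have hyz : y ≤ z := by
    have := Real.rpow_le_rpow_of_exponent_ge hy hy1 hβ1.le
    rwa [Real.rpow_one] at this
  have eW : y ^ (1 - β) = y / z := by rw [Real.rpow_sub hy, Real.rpow_one]
  have en : y ^ (-β) = z⁻¹ := Real.rpow_neg hy.le _
  rw [en] at hGu
  rw [eW] at hvu
  set W := y / z with hW
  have hW0 : 0 < W := by positivity
  set g := G * z / d with hg
  have hg0 : 0 ≤ g := by positivity
  have hGg : G = d * g / z := by rw [hg]; field_simp
  have hg1 : g ≤ 1 + η * z := by
    rw [hg, div_le_iff₀ hd0, hη]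
    calc G * z ≤ (d * z⁻¹ + C0) * z := by gcongr
      _ = _ := by field_simp
  set m := y * G ^ (p - 1) / β with hm
  have hmg : m = g ^ (p - 1) := by
    rw [hg, Real.div_rpow (by positivity) hd0.le, Real.mul_rpow hG hzp.le, hz, hd,
      ← Real.rpow_mul hy.le, ← Real.rpow_mul hβ0.le, hβ, Real.rpow_one, Real.rpow_one, hm]
    ring
  have hm0 : 0 ≤ m := by positivity
  have hmu : m ≤ 1 + (2 * η + η ^ 2) * z := by
    have hpos : 0 ≤ (2 * η + η ^ 2) * z := by positivity
    rcases le_or_gt g 1 with h | h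
    · have : m ≤ 1 := by rw [hmg]; exact Real.rpow_le_one hg0 h (by linarith)
      linarith
    · have h2 : m ≤ g ^ 2 := by
        rw [hmg, ← Real.rpow_natCast]
        exact Real.rpow_le_rpow_of_exponent_le h.le (by push_cast; linarith)
      have h3 : g ^ 2 ≤ (1 + η * z) ^ 2 := pow_le_pow_left₀ hg0 hg1 2
      have h4 : η ^ 2 * z ^ 2 ≤ η ^ 2 * z := by
        apply mul_le_mul_of_nonneg_left _ (by positivity)
        rw [pow_two]; exact mul_le_of_le_one_left hzp.le hz1
      have h5 : (1 + η * z) ^ 2 = 1 + 2 * η * z + η ^ 2 * z ^ 2 := by ring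
      linarith
  have hmin : min m 1 ≤ g := by
    rcases le_or_gt g 1 with h | h
    · refine (min_le_left _ _).trans ?_
      rw [hmg]
      calc g ^ (p - 1) ≤ g ^ (1:ℝ) := by
            rcases hg0.eq_or_lt with h0 | h0
            · rw [← h0, Real.zero_rpow (by linarith), Real.zero_rpow (by norm_num)]
            · exact Real.rpow_le_rpow_of_exponent_ge h0 h (by linarith)
        _ = g := Real.rpow_one g
    · exact (min_le_right _ _).trans h.le
  set ξ := y * G / v with hξ
  have hξ0 : 0 ≤ ξ := by positivity
  have hξl : (1 - β) * (min m 1 - Cs * z) ≤ ξ := by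
    rcases le_or_gt (min m 1 - Cs * z) 0 with h | h
    · exact (mul_nonpos_of_nonneg_of_nonpos hb.le h).trans hξ0
    · rw [hξ, le_div_iff₀ hv]
      have hv2 : v ≤ d / (1 - β) * W * (1 + Cs * z) := by
        refine hvu.trans (le_of_eq ?_)
        rw [hCs, hW]; field_simp
      have hM1 : min m 1 ≤ 1 := min_le_right _ _
      have hcz : 0 ≤ Cs * z := by positivity
      calc (1 - β) * (min m 1 - Cs * z) * v
          ≤ (1 - β) * (min m 1 - Cs * z) * (d / (1 - β) * W * (1 + Cs * z)) := by gcongr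
        _ = d * W * ((min m 1 - Cs * z) * (1 + Cs * z)) := by field_simp
        _ ≤ d * W * min m 1 := by
          apply mul_le_mul_of_nonneg_left _ (by positivity)
          have i1 : min m 1 * (Cs * z) ≤ 1 * (Cs * z) := mul_le_mul_of_nonneg_right hM1 hcz
          have i2 : 0 ≤ (Cs * z) * (Cs * z) := mul_nonneg hcz hcz
          have i3 : (min m 1 - Cs * z) * (1 + Cs * z) = min m 1 - Cs * z + min m 1 * (Cs * z)
            - (Cs * z) * (Cs * z) := by ring
          linarith
        _ ≤ d * W * g := by gcongr
        _ = y * G := by rw [hGg, hW]; ring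
  have hθ : thw (β / 2) y = Y / (1 + Y) := rfl
  set θ := thw (β / 2) y with hθd
  have hθ1 : Y / 2 ≤ θ := by
    rw [hθ]; apply div_le_div_of_nonneg_left hYp.le (by linarith) (by linarith)
  have hθ2 : θ ≤ Y := by
    rw [hθ]; exact div_le_self hYp.le (by linarith)
  set err := y ^ 2 * (2 * k * q * Dw (q * (1 - β)) (β / 2) y * v ^ (q - 1) +
            p * k * G ^ (p - 2) * Dw (q * (1 - β)) (β / 2) y * v ^ q) with herr
  have herrb : err ≤ Ce * z := by
    have hD : Dw (q * (1 - β)) (β / 2) y ≤ 2 * W ^ (-q) := by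
      unfold Dw
      rw [← eW, ← Real.rpow_mul hy.le, show (1 - β) * -q = -(q * (1 - β)) by ring, mul_comm]
      apply mul_le_mul_of_nonneg_right _ (by positivity)
      rw [← hY]; linarith
    have hD0 : 0 ≤ Dw (q * (1 - β)) (β / 2) y := by unfold Dw; positivity
    have hvW : v ≤ C1 * W := by
      have : y ≤ W := by rw [hW, le_div_iff₀ hzp]; exact mul_le_of_le_one_right hy.le hz1
      calc v ≤ d / (1 - β) * W + C0 * y := hvu
        _ ≤ d / (1 - β) * W + C0 * W := by gcongr
        _ = _ := by rw [hC1]; ring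
    have hA : Dw (q * (1 - β)) (β / 2) y * v ^ (q - 1) ≤ 2 * C1 ^ (q - 1) * W⁻¹ := by
      calc _ ≤ 2 * W ^ (-q) * (C1 * W) ^ (q - 1) := by gcongr
        _ = 2 * C1 ^ (q - 1) * (W ^ (-q) * W ^ (q - 1)) := by
          rw [Real.mul_rpow hC10.le hW0.le]; ring
        _ = _ := by
          rw [← Real.rpow_add hW0, show -q + (q - 1) = -1 by ring, Real.rpow_neg_one]
    have hB : Dw (q * (1 - β)) (β / 2) y * v ^ q ≤ 2 * C1 ^ q := by
      calc _ ≤ 2 * W ^ (-q) * (C1 * W) ^ q := by gcongr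
        _ = 2 * C1 ^ q * (W ^ (-q) * W ^ q) := by
          rw [Real.mul_rpow hC10.le hW0.le]; ring
        _ = _ := by
          rw [← Real.rpow_add hW0, show -q + q = 0 by ring, Real.rpow_zero, mul_one]
    have hzi : 1 ≤ z⁻¹ := (one_le_inv₀ hzp).2 hz1
    have hGp : G ^ (p - 2) ≤ C2 ^ (p - 2) * z⁻¹ := by
      have : G ≤ C2 * z⁻¹ := by
        calc G ≤ d * z⁻¹ + C0 * 1 := by linarith
          _ ≤ d * z⁻¹ + C0 * z⁻¹ := by gcongr
          _ = _ := by rw [hC2]; ring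
      calc G ^ (p - 2) ≤ (C2 * z⁻¹) ^ (p - 2) := Real.rpow_le_rpow hG this (by linarith)
        _ = C2 ^ (p - 2) * (z⁻¹) ^ (p - 2) := Real.mul_rpow hC20.le (by positivity)
        _ ≤ C2 ^ (p - 2) * (z⁻¹) ^ (1:ℝ) := by
          apply mul_le_mul_of_nonneg_left _ (by positivity)
          exact Real.rpow_le_rpow_of_exponent_le hzi (by linarith)
        _ = _ := by rw [Real.rpow_one]
    have k1 : 2 * k * q * Dw (q * (1 - β)) (β / 2) y * v ^ (q - 1) ≤
        2 * q * (2 * C1 ^ (q - 1) * W⁻¹) := by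
      calc _ = k * (2 * q * (Dw (q * (1 - β)) (β / 2) y * v ^ (q - 1))) := by ring
        _ ≤ 1 * (2 * q * (2 * C1 ^ (q - 1) * W⁻¹)) := by gcongr
        _ = _ := one_mul _
    have k2 : p * k * G ^ (p - 2) * Dw (q * (1 - β)) (β / 2) y * v ^ q ≤
        p * ((C2 ^ (p - 2) * z⁻¹) * (2 * C1 ^ q)) := by
      calc _ = k * (p * (G ^ (p - 2) * (Dw (q * (1 - β)) (β / 2) y * v ^ q))) := by ring
        _ ≤ 1 * (p * ((C2 ^ (p - 2) * z⁻¹) * (2 * C1 ^ q))) := by gcongr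
        _ = _ := one_mul _
    have k3 : y ^ 2 * (2 * q * (2 * C1 ^ (q - 1) * W⁻¹)) ≤ 4 * q * C1 ^ (q - 1) * z := by
      have e : y ^ 2 * (2 * q * (2 * C1 ^ (q - 1) * W⁻¹)) = 4 * q * C1 ^ (q - 1) * z * y := by
        rw [hW]; field_simp; ring
      rw [e]
      exact mul_le_of_le_one_right (by positivity) hy1
    have k4 : y ^ 2 * (p * ((C2 ^ (p - 2) * z⁻¹) * (2 * C1 ^ q))) ≤
        2 * p * C1 ^ q * C2 ^ (p - 2) * z := by
      have e : y ^ 2 * (p * ((C2 ^ (p - 2) * z⁻¹) * (2 * C1 ^ q))) =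
         2 * p * C1 ^ q * C2 ^ (p - 2) * (y ^ 2 * z⁻¹) := by ring
      rw [e]
      apply mul_le_mul_of_nonneg_left _ (by positivity)
      rw [← div_eq_mul_inv, div_le_iff₀ hzp, pow_two]
      exact mul_le_mul hyz hyz hy.le hzp.le
    calc err ≤ y ^ 2 * (2 * q * (2 * C1 ^ (q - 1) * W⁻¹) +
          p * ((C2 ^ (p - 2) * z⁻¹) * (2 * C1 ^ q))) := by rw [herr]; gcongr
      _ ≤ Ce * z := by rw [mul_add, hCe, add_mul]; exact add_le_add k3 k4
  have hfin := hE Y θ (1 - m) (ξ - (1 - β)) err hYp hYle hθ1 hθ2 (by linarith)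
    (by
      rw [hYz]
      have i1 := mul_nonneg hCs0 hzp.le
      have i2 := mul_nonneg hCe0 hzp.le
      linarith)
    (by
      rw [hYz]
      have e : max (1 - m) 0 = 1 - min m 1 := by
        rcases le_total m 1 with h | h
        · rw [min_eq_left h, max_eq_left (by linarith)]
        · rw [min_eq_right h, max_eq_right (by linarith)]; ring
      rw [e]
      have : 0 ≤ (2 * η + η ^ 2) * z := by positivity
      have h2 : 0 ≤ Ce * z := by positivity
      have h3 : (1 - β) * (Cs * z) ≤ 1 * (Cs * z) := by gcongr; linarith
      linarith)
    (by
      rw [hYz]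
      have : 0 ≤ (2 * η + η ^ 2) * z := by positivity
      have h2 : 0 ≤ Cs * z := by positivity
      linarith)
  have hGp : G ^ p = G ^ (p - 1) * G := by
    rw [← Real.rpow_add_one' hG (by linarith)]; congr 1; ring
  have hX : G ^ (p - 1) = β * m / y := by rw [hm]; field_simp
  have hGv : G / v = ξ / y := by rw [hξ]; field_simp
  have hGpv : G ^ p / v = β * m * ξ / y ^ 2 := by
    rw [hGp, mul_div_assoc, hGv, hX]; ring
  have hp' : p - 1 = 1 / β := by field_simp; linarith
  have hp'' : p = 1 / β + 1 := by linarith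
  rw [hGpv, hGv, hX]
  have key : y ^ 2 * (-((p - 1) * q * (β * m * ξ / y ^ 2)) - q * (q - 1) * (ξ / y) ^ 2 -
      Qw (q * (1 - β)) (β / 2) y + 2 * q * (ξ / y) * Pw (q * (1 - β)) (β / 2) y
        + p * (β * m / y) * Pw (q * (1 - β)) (β / 2) y
        + (2 * k * q * Dw (q * (1 - β)) (β / 2) y * v ^ (q - 1) +
            p * k * G ^ (p - 2) * Dw (q * (1 - β)) (β / 2) y * v ^ q)) ≤ 0 := by
    refine le_trans (le_of_eq ?_) hfin
    rw [mul_add, ← herr]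
    congr 1
    unfold Qw Pw
    rw [← hθd]
    clear_value θ ξ m
    rw [hp', hp'']
    field_simp
    ring
  by_contra hcon
  push Not at hcon
  have := mul_pos (pow_pos hy 2) hcon
  linarith

lemma Pw_nonneg {γ β : ℝ} (hγ : 0 < γ) (hβ : 0 < β) (hβ1 : β < 1) :
    ∃ y1 > 0, ∀ y : ℝ, 0 < y → y ≤ y1 → 0 ≤ Pw γ (β / 2) y := by
  refine ⟨γ ^ (2 / β), Real.rpow_pos_of_pos hγ _, ?_⟩
  intro y hy hy1
  have h1 : y ^ (β / 2) ≤ γ := by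
    have := Real.rpow_le_rpow hy.le hy1 (show 0 ≤ β / 2 by linarith)
    rw [← Real.rpow_mul hγ.le, show 2 / β * (β / 2) = 1 by field_simp, Real.rpow_one] at this
    exact this
  have h0 : 0 < y ^ (β / 2) := Real.rpow_pos_of_pos hy _
  have h2 : thw (β / 2) y ≤ γ := by
    unfold thw
    exact (div_le_self h0.le (by linarith)).trans h1
  have h3 : 0 ≤ thw (β / 2) y := by unfold thw; positivity
  unfold Pw
  apply div_nonneg _ hy.le
  have : β / 2 * thw (β / 2) y ≤ 1 * thw (β / 2) y := by gcongr; linarith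
  linarith

lemma Dw_pos {γ a y : ℝ} (hy : 0 < y) : 0 < Dw γ a y := by
  unfold Dw; positivity

lemma Dw_le {γ a y : ℝ} (hy : 0 < y) (hy1 : y ≤ 1) (ha : 0 ≤ a) : Dw γ a y ≤ 2 * y ^ (-γ) := by
  unfold Dw
  have := Real.rpow_le_one hy.le hy1 ha
  have h2 : 0 < y ^ (-γ) := Real.rpow_pos_of_pos hy _
  rw [mul_comm]
  gcongr
  linarith

/-- first derivative of the weight -/
def Dw1 (γ a y : ℝ) : ℝ := -γ * y ^ (-γ - 1) + (a - γ) * y ^ (a - γ - 1)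

lemma Dw_eq {γ a y : ℝ} (hy : 0 < y) : Dw γ a y = y ^ (-γ) + y ^ (a - γ) := by
  unfold Dw
  rw [mul_add, mul_one, ← Real.rpow_add hy]; congr 2; ring

lemma Dw_der {γ a y : ℝ} (hy : 0 < y) : HasDerivAt (Dw γ a) (Dw1 γ a y) y := by
  have h1 := (Real.hasDerivAt_rpow_const (x := y) (p := -γ) (Or.inl hy.ne')).add
    (Real.hasDerivAt_rpow_const (x := y) (p := a - γ) (Or.inl hy.ne'))
  refine (h1.congr_of_eventuallyEq ?_).congr_deriv ?_
  · filter_upwards [lt_mem_nhds hy] with s hs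
    exact Dw_eq hs
  · rfl

lemma Dw1_der {γ a y : ℝ} (hy : 0 < y) : HasDerivAt (Dw1 γ a) (Qw γ a y * Dw γ a y) y := by
  have h1 := ((Real.hasDerivAt_rpow_const (x := y) (p := -γ - 1) (Or.inl hy.ne')).const_mul (-γ)).add
    ((Real.hasDerivAt_rpow_const (x := y) (p := a - γ - 1) (Or.inl hy.ne')).const_mul (a - γ))
  refine h1.congr_deriv ?_
  unfold Qw thw Dw
  rw [Real.rpow_sub_one hy.ne', Real.rpow_sub_one hy.ne', Real.rpow_sub_one hy.ne',
    Real.rpow_sub_one hy.ne', show a - γ = a + (-γ) by ring, Real.rpow_add hy]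
  have : 0 < y ^ a := Real.rpow_pos_of_pos hy _
  field_simp
  ring

lemma Dw1_eq {γ a y : ℝ} (hy : 0 < y) : Dw1 γ a y = -(Pw γ a y * Dw γ a y) := by
  unfold Pw thw Dw Dw1
  rw [Real.rpow_sub_one hy.ne', Real.rpow_sub_one hy.ne',
    show a - γ = a + (-γ) by ring, Real.rpow_add hy]
  have : 0 < y ^ a := Real.rpow_pos_of_pos hy _
  field_simp
  ring

end

section

lemma J_alg {p q a b v D P Q x k η G : ℝ} (hp : 2 < p) (hq : 1 < q) (hv : 0 < v) (hD : 0 < D)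
    (hP : 0 ≤ P) (hx : 0 < x) (hk : 0 ≤ k) (hG : 0 ≤ G) (hG2 : G ^ 2 = a ^ 2 + b ^ 2) (hb : b ≤ G)
    (ha : -(k * x * D * v ^ q) - η ≤ a)
    (hE : -((p - 1) * q * (G ^ p / v)) - q * (q - 1) * (G / v) ^ 2 - Q
        + 2 * q * (G / v) * P + p * G ^ (p - 1) * P
        + (2 * k * q * D * v ^ (q - 1) + p * k * G ^ (p - 2) * D * v ^ q) ≤ 0) :
    (k * x * D * q * v ^ (q - 1) * G ^ p - 2 * (k * D * q * v ^ (q - 1) * a)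
      - k * x * D * (q * (q - 1) * v ^ (q - 2)) * (a ^ 2 + b ^ 2) - k * x * (Q * D) * v ^ q
      + 2 * (k * x * (P * D) * (q * v ^ (q - 1) * b)))
      - p * G ^ (p - 2) * (a * (k * D * v ^ q + k * x * D * q * v ^ (q - 1) * a)
        + b * (k * x * (-(P * D) * v ^ q + D * q * v ^ (q - 1) * b))) ≤
      (2 * k * q * D * v ^ (q - 1) + p * k * G ^ (p - 2) * D * v ^ q) * η := by
  have e1 : v ^ (q - 1) = v ^ q / v := Real.rpow_sub_one hv.ne' q
  have e2 : v ^ (q - 2) = v ^ q / v ^ 2 := by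
    rw [show q - 2 = q - (2:ℕ) by push_cast; ring, Real.rpow_sub_natCast hv.ne']
  have e3 : G ^ p = G ^ (p - 2) * G ^ 2 := by
    rw [← Real.rpow_add_natCast' hG (by push_cast; linarith)]; congr 1; push_cast; ring
  have e4 : G ^ (p - 1) = G ^ (p - 2) * G := by
    rw [← Real.rpow_add_one' hG (by linarith)]; congr 1; ring
  have hV0 : 0 < v ^ q := Real.rpow_pos_of_pos hv q
  have hg0 : 0 ≤ G ^ (p - 2) := Real.rpow_nonneg hG _
  rw [e1, e3, e4] at hE
  rw [e1, e2, e3, ← hG2]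
  generalize v ^ q = V at *
  generalize G ^ (p - 2) = g at *
  set Cf := 2 * k * q * D * (V / v) + p * k * g * D * V with hCf
  have hCf0 : 0 ≤ Cf := by positivity
  have i1 : Cf * (-a) ≤ Cf * (k * x * D * V + η) := mul_le_mul_of_nonneg_left (by linarith) hCf0
  have hN : 0 ≤ k * x * D * V := by positivity
  have i2 : k * x * D * V * (2 * q * (b / v) * P + p * (g * b) * P) ≤
      k * x * D * V * (2 * q * (G / v) * P + p * (g * G) * P) := by gcongr
  have i3 := mul_nonpos_of_nonneg_of_nonpos hN hE
  have e5 : (k * x * D * q * (V / v) * (g * G ^ 2) - 2 * (k * D * q * (V / v) * a)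
      - k * x * D * (q * (q - 1) * (V / v ^ 2)) * G ^ 2 - k * x * (Q * D) * V
      + 2 * (k * x * (P * D) * (q * (V / v) * b)))
      - p * g * (a * (k * D * V + k * x * D * q * (V / v) * a)
        + b * (k * x * (-(P * D) * V + D * q * (V / v) * b)))
      = k * x * D * V * (-((p - 1) * q * (g * G ^ 2 / v)) - q * (q - 1) * (G / v) ^ 2 - Q) +
        k * x * D * V * (2 * q * (b / v) * P + p * (g * b) * P) + Cf * (-a) := by
    have e6 : p * g * (a * (k * D * V + k * x * D * q * (V / v) * a)
        + b * (k * x * (-(P * D) * V + D * q * (V / v) * b))) =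
        p * g * (k * D * V * a - k * x * P * D * V * b + k * x * D * q * (V / v) * G ^ 2) := by
      rw [hG2]; ring
    rw [e6, hCf]
    field_simp
    ring
  rw [e5]
  linarith

lemma Hbound {γ a q y v M : ℝ} (hy : 0 < y) (hy1 : y ≤ 1) (ha : 0 ≤ a) (hv : 0 ≤ v)
    (hM : 0 ≤ M) (hvM : v ≤ M * y) (hq : 0 ≤ q) (hγ : 1 ≤ q - γ) :
    Dw γ a y * v ^ q ≤ 2 * M ^ q * y := by
  calc Dw γ a y * v ^ q ≤ (2 * y ^ (-γ)) * (M * y) ^ q := by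
        gcongr
        exact Dw_le hy hy1 ha
    _ = 2 * M ^ q * y ^ (q - γ) := by
        rw [Real.mul_rpow hM hy.le, show q - γ = -γ + q by ring, Real.rpow_add hy]; ring
    _ ≤ 2 * M ^ q * y ^ (1:ℝ) := by
        apply mul_le_mul_of_nonneg_left _ (by positivity)
        exact Real.rpow_le_rpow_of_exponent_ge hy hy1 hγ
    _ = _ := by rw [Real.rpow_one]

/-- the function H -/
def Hf (u : ℝ → ℝ → ℝ → ℝ) (k γ α q : ℝ) (x y t : ℝ) : ℝ := k * x * Dw γ α y * u x y t ^ q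
/-- x derivative of H -/
def Hx (u : ℝ → ℝ → ℝ → ℝ) (k γ α q : ℝ) (x y t : ℝ) : ℝ :=
  k * Dw γ α y * u x y t ^ q + k * x * Dw γ α y * q * u x y t ^ (q - 1) * pdx u x y t
/-- y derivative of H -/
def Hy (u : ℝ → ℝ → ℝ → ℝ) (k γ α q : ℝ) (x y t : ℝ) : ℝ :=
  k * x * (Dw1 γ α y * u x y t ^ q + Dw γ α y * q * u x y t ^ (q - 1) * pdy u x y t)

variable {p L T : ℝ} {u : ℝ → ℝ → ℝ → ℝ}

lemma Hf_dx (hsol : ClassicalSolution p L T u) {k γ α q x y t : ℝ} (hx : |x| ≤ L)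
    (hy : y ∈ Icc (0:ℝ) L) (ht : t ∈ Ioo 0 T) (hu : 0 < u x y t) :
    HasDerivAt (fun s => Hf u k γ α q s y t) (Hx u k γ α q x y t) x := by
  have h1 := ((cs_dx hsol hx hy ht).rpow_const (p := q) (Or.inl hu.ne'))
  have h2 := (((hasDerivAt_id x).const_mul k).mul_const (Dw γ α y)).mul h1
  refine h2.congr_deriv ?_
  unfold Hx
  simp only [id]
  ring

lemma Hf_dy (hsol : ClassicalSolution p L T u) {k γ α q x y t : ℝ} (hx : |x| ≤ L)
    (hy : y ∈ Ioc (0:ℝ) L) (ht : t ∈ Ioo 0 T) (hu : 0 < u x y t) :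
    HasDerivAt (fun s => Hf u k γ α q x s t) (Hy u k γ α q x y t) y := by
  have h1 := ((cs_dy hsol hx ⟨hy.1.le, hy.2⟩ ht).rpow_const (p := q) (Or.inl hu.ne'))
  have h2 := ((Dw_der (γ := γ) (a := α) hy.1).const_mul (k * x)).mul h1
  refine h2.congr_deriv ?_
  unfold Hy
  ring

lemma Hf_dt (hsol : ClassicalSolution p L T u) {k γ α q x y t : ℝ} (hx : |x| ≤ L)
    (hy : y ∈ Icc (0:ℝ) L) (ht : t ∈ Ioo 0 T) (hu : 0 < u x y t) :
    HasDerivAt (fun s => Hf u k γ α q x y s)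
      (k * x * Dw γ α y * (q * u x y t ^ (q - 1) * pdt u x y t)) t := by
  have h1 := ((cs_dt hsol hx hy ht).rpow_const (p := q) (Or.inl hu.ne'))
  have h2 := h1.const_mul (k * x * Dw γ α y)
  refine h2.congr_deriv ?_
  ring

lemma Hx_dx (hsol : ClassicalSolution p L T u) {k γ α q x y t : ℝ} (hx : |x| ≤ L)
    (hy : y ∈ Icc (0:ℝ) L) (ht : t ∈ Ioo 0 T) (hu : 0 < u x y t) :
    HasDerivAt (fun s => Hx u k γ α q s y t)
      (2 * (k * Dw γ α y * q * u x y t ^ (q - 1) * pdx u x y t) +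
       k * x * Dw γ α y * (q * (q - 1) * u x y t ^ (q - 2) * pdx u x y t ^ 2 +
        q * u x y t ^ (q - 1) * pdxx u x y t)) x := by
  have h1 := ((cs_dx hsol hx hy ht).rpow_const (p := q) (Or.inl hu.ne'))
  have h2 := ((cs_dx hsol hx hy ht).rpow_const (p := q - 1) (Or.inl hu.ne'))
  have h3 := (h1.const_mul (k * Dw γ α y)).add
    ((((((hasDerivAt_id x).const_mul k).mul_const (Dw γ α y)).mul_const q).mul h2).mul
      (cs_dxx hsol hx hy ht))
  refine h3.congr_deriv ?_
  simp only [id, Pi.mul_apply]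
  rw [show q - 1 - 1 = q - 2 by ring]
  ring

lemma Hy_dy (hsol : ClassicalSolution p L T u) {k γ α q x y t : ℝ} (hx : |x| ≤ L)
    (hy : y ∈ Ioc (0:ℝ) L) (ht : t ∈ Ioo 0 T) (hu : 0 < u x y t) :
    HasDerivAt (fun s => Hy u k γ α q x s t)
      (k * x * (Qw γ α y * Dw γ α y * u x y t ^ q +
        2 * (Dw1 γ α y * (q * u x y t ^ (q - 1) * pdy u x y t)) +
        Dw γ α y * (q * (q - 1) * u x y t ^ (q - 2) * pdy u x y t ^ 2 +
        q * u x y t ^ (q - 1) * pdyy u x y t))) y := by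
  have hy' : y ∈ Icc (0:ℝ) L := ⟨hy.1.le, hy.2⟩
  have h1 := ((cs_dy hsol hx hy' ht).rpow_const (p := q) (Or.inl hu.ne'))
  have h2 := ((cs_dy hsol hx hy' ht).rpow_const (p := q - 1) (Or.inl hu.ne'))
  have h3 := (((Dw1_der (γ := γ) (a := α) hy.1).mul h1).add
    ((((Dw_der (γ := γ) (a := α) hy.1).mul_const q).mul h2).mul
      (cs_dyy hsol hx hy' ht))).const_mul (k * x)
  refine h3.congr_deriv ?_
  simp only [Pi.mul_apply]
  rw [show q - 1 - 1 = q - 2 by ring]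
  ring

end

section

variable {p L T : ℝ} {u : ℝ → ℝ → ℝ → ℝ}

/-- coefficient of u_x -/
def Cf (u : ℝ → ℝ → ℝ → ℝ) (p k γ α q : ℝ) (x y t : ℝ) : ℝ :=
  2 * k * q * Dw γ α y * u x y t ^ (q - 1) +
    p * k * gradNorm u x y t ^ (p - 2) * Dw γ α y * u x y t ^ q

lemma Dw_contOn (γ α : ℝ) : ContinuousOn (Dw γ α) (Ioi 0) := fun _ hy =>
  (Dw_der hy).continuousAt.continuousWithinAt

lemma Dw1_contOn (γ α : ℝ) : ContinuousOn (Dw1 γ α) (Ioi 0) := fun _ hy =>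
  (Dw1_der hy).continuousAt.continuousWithinAt

lemma box_sub {x1 y0 y1 t0 τ : ℝ} (hx1 : x1 ≤ L) (hy0 : 0 < y0) (hy1 : y1 ≤ L) :
    Icc 0 x1 ×ˢ Icc y0 y1 ×ˢ Icc t0 τ ⊆ box L t0 τ := by
  rintro ⟨x, y, t⟩ ⟨hx, hy, ht⟩
  exact ⟨⟨by linarith [hx.1, hx.2], by linarith [hx.2]⟩,
    ⟨by linarith [hy.1], by linarith [hy.2]⟩, ht⟩

lemma K_cont (hsol : ClassicalSolution p L T u) {k γ α q x1 y0 y1 t0 τ : ℝ} (hp : 2 < p)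
    (hq : 1 < q) (hx1 : x1 ≤ L) (hy0 : 0 < y0) (hy1 : y1 ≤ L) (ht0 : 0 < t0) (hτ : τ < T) :
    ContinuousOn (fun r : ℝ × ℝ × ℝ => Hf u k γ α q r.1 r.2.1 r.2.2)
      (Icc 0 x1 ×ˢ Icc y0 y1 ×ˢ Icc t0 τ) ∧
    ∃ K > 0, ∀ x ∈ Icc 0 x1, ∀ y ∈ Icc y0 y1, ∀ t ∈ Icc t0 τ,
      |Hx u k γ α q x y t| + |Hy u k γ α q x y t| + Cf u p k γ α q x y t ≤ K := by
  set S := Icc 0 x1 ×ˢ Icc y0 y1 ×ˢ Icc t0 τ with hS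
  have hsub : S ⊆ box L t0 τ := box_sub hx1 hy0 hy1
  have cu := (box_cu hsol ht0 hτ).mono hsub
  have cx := (box_cx hsol ht0 hτ).mono hsub
  have cy := (box_cy hsol ht0 hτ).mono hsub
  have cg := (box_cg hsol ht0 hτ).mono hsub
  have hmap : MapsTo (fun r : ℝ × ℝ × ℝ => r.2.1) S (Ioi 0) := by
    rintro ⟨x, y, t⟩ ⟨hx, hy, ht⟩
    exact hy0.trans_le hy.1
  have cD : ContinuousOn (fun r : ℝ × ℝ × ℝ => Dw γ α r.2.1) S :=
    (Dw_contOn γ α).comp (f := fun r : ℝ × ℝ × ℝ => r.2.1) (by fun_prop) hmap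
  have cD1 : ContinuousOn (fun r : ℝ × ℝ × ℝ => Dw1 γ α r.2.1) S :=
    (Dw1_contOn γ α).comp (f := fun r : ℝ × ℝ × ℝ => r.2.1) (by fun_prop) hmap
  have cq := cu.rpow_const (p := q) (fun _ _ => Or.inr (by linarith))
  have cq1 := cu.rpow_const (p := q - 1) (fun _ _ => Or.inr (by linarith))
  have cp := cg.rpow_const (p := p - 2) (fun _ _ => Or.inr (by linarith))
  refine ⟨?_, ?_⟩
  · unfold Hf
    exact ((continuousOn_const.mul continuousOn_fst).mul cD).mul cq
  · have hc : ContinuousOn (fun r : ℝ × ℝ × ℝ => |Hx u k γ α q r.1 r.2.1 r.2.2| +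
        |Hy u k γ α q r.1 r.2.1 r.2.2| + Cf u p k γ α q r.1 r.2.1 r.2.2) S := by
      unfold Hx Hy Cf
      fun_prop
    obtain ⟨K, hK⟩ := ((isCompact_Icc.prod (isCompact_Icc.prod isCompact_Icc)).image_of_continuousOn
      hc).bddAbove
    refine ⟨max K 1, by positivity, fun x hx y hy t ht => le_max_of_le_left (hK ?_)⟩
    exact ⟨(x, y, t), ⟨hx, hy, ht⟩, rfl⟩

/-- hypothesis expression -/
def Ex (p k γ α q y G v : ℝ) : ℝ := -((p - 1) * q * (G ^ p / v)) - q * (q - 1) * (G / v) ^ 2 - Qw γ α y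
        + 2 * q * (G / v) * Pw γ α y + p * G ^ (p - 1) * Pw γ α y
        + (2 * k * q * Dw γ α y * v ^ (q - 1) + p * k * G ^ (p - 2) * Dw γ α y * v ^ q)

lemma J_int {k γ α q x y t h η ε K V1 V2 : ℝ} (hsol : ClassicalSolution p L T u) (hp : 2 < p)
    (hq : 1 < q) (hx0 : 0 < x) (hx : x < L) (hy : y ∈ Ioo 0 L) (ht : t ∈ Ioo 0 T)
    (hu : 0 < u x y t) (hk : 0 ≤ k) (hP : 0 ≤ Pw γ α y)
    (hE : Ex p k γ α q y (gradNorm u x y t) (u x y t) ≤ 0)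
    (ha : -(Hf u k γ α q x y t) - η ≤ pdx u x y t) (hh : 0 < h) (hη : 0 < η)
    (hK : |Hx u k γ α q x y t| + |Hy u k γ α q x y t| + Cf u p k γ α q x y t ≤ K)
    (hKη : K * η < ε)
    (h1 : |p * √(V1 ^ 2 + V2 ^ 2) ^ (p - 2) * V1 -
      p * gradNorm u x y t ^ (p - 2) * pdx u x y t| ≤ η)
    (h2 : |p * √(V1 ^ 2 + V2 ^ 2) ^ (p - 2) * V2 -
      p * gradNorm u x y t ^ (p - 2) * pdy u x y t| ≤ η)
    (d1 : V1 - pdx u x y t = -(h * Hx u k γ α q x y t))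
    (d2 : V2 - pdy u x y t = -(h * Hy u k γ α q x y t)) :
    h * (k * x * Dw γ α y * (q * u x y t ^ (q - 1) * pdt u x y t)) -
    h * (2 * (k * Dw γ α y * q * u x y t ^ (q - 1) * pdx u x y t) +
       k * x * Dw γ α y * (q * (q - 1) * u x y t ^ (q - 2) * pdx u x y t ^ 2 +
        q * u x y t ^ (q - 1) * pdxx u x y t)) -
    h * (k * x * (Qw γ α y * Dw γ α y * u x y t ^ q +
        2 * (Dw1 γ α y * (q * u x y t ^ (q - 1) * pdy u x y t)) +
        Dw γ α y * (q * (q - 1) * u x y t ^ (q - 2) * pdy u x y t ^ 2 +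
        q * u x y t ^ (q - 1) * pdyy u x y t))) +
    √(V1 ^ 2 + V2 ^ 2) ^ p - gradNorm u x y t ^ p < h * ε := by
  have hpde := hsol.pde (abs_lt.2 ⟨by linarith, hx⟩) hy ht
  have hG2 : gradNorm u x y t ^ 2 = pdx u x y t ^ 2 + pdy u x y t ^ 2 :=
    Real.sq_sqrt (by positivity)
  have hb : pdy u x y t ≤ gradNorm u x y t := (le_abs_self _).trans (abs_pdy_le x y t)
  have hJ := J_alg (a := pdx u x y t) (b := pdy u x y t) (v := u x y t) (D := Dw γ α y)
    (P := Pw γ α y) (Q := Qw γ α y) (x := x) (k := k) (η := η) (G := gradNorm u x y t)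
    hp hq hu (Dw_pos hy.1) hP hx0 hk (gradNorm_nonneg x y t) hG2 hb ha hE
  have hT := norm_tangent (a1 := pdx u x y t) (a2 := pdy u x y t) (b1 := V1) (b2 := V2) hp
  have hgn : √(pdx u x y t ^ 2 + pdy u x y t ^ 2) = gradNorm u x y t := rfl
  rw [hgn, d1, d2] at hT
  rw [Dw1_eq hy.1]
  have hHx : Hx u k γ α q x y t = k * Dw γ α y * u x y t ^ q +
    k * x * Dw γ α y * q * u x y t ^ (q - 1) * pdx u x y t := rfl
  have hHy : Hy u k γ α q x y t = k * x * (-(Pw γ α y * Dw γ α y) * u x y t ^ q +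
      Dw γ α y * q * u x y t ^ (q - 1) * pdy u x y t) := by
    rw [← Dw1_eq hy.1]; rfl
  have hCf : Cf u p k γ α q x y t = 2 * k * q * Dw γ α y * u x y t ^ (q - 1) +
    p * k * gradNorm u x y t ^ (p - 2) * Dw γ α y * u x y t ^ q := rfl
  rw [← hHx, ← hHy, ← hCf] at hJ
  have e0 : gradNorm u x y t ^ p = pdt u x y t - (pdxx u x y t + pdyy u x y t) := hpde.symm
  set F1 := p * √(V1 ^ 2 + V2 ^ 2) ^ (p - 2) * V1 with hF1
  set F2 := p * √(V1 ^ 2 + V2 ^ 2) ^ (p - 2) * V2 with hF2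
  set f1 := p * gradNorm u x y t ^ (p - 2) * pdx u x y t with hf1
  set f2 := p * gradNorm u x y t ^ (p - 2) * pdy u x y t with hf2
  have m1 : (f1 - F1) * Hx u k γ α q x y t ≤ η * |Hx u k γ α q x y t| := by
    refine (le_abs_self _).trans ?_
    rw [abs_mul, abs_sub_comm]
    gcongr
  have m2 : (f2 - F2) * Hy u k γ α q x y t ≤ η * |Hy u k γ α q x y t| := by
    refine (le_abs_self _).trans ?_
    rw [abs_mul, abs_sub_comm]
    gcongr
  have m3 : (|Hx u k γ α q x y t| + |Hy u k γ α q x y t| + Cf u p k γ α q x y t) * η ≤ K * η := by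
    gcongr
  have hT2 : √(V1 ^ 2 + V2 ^ 2) ^ p - gradNorm u x y t ^ p ≤
      h * (-(F1 * Hx u k γ α q x y t) - F2 * Hy u k γ α q x y t) := by
    refine hT.trans (le_of_eq ?_)
    rw [hF1, hF2]; ring
  have hJ2 : (k * x * Dw γ α y * q * u x y t ^ (q - 1) * gradNorm u x y t ^ p -
      2 * (k * Dw γ α y * q * u x y t ^ (q - 1) * pdx u x y t) -
      k * x * Dw γ α y * (q * (q - 1) * u x y t ^ (q - 2)) * (pdx u x y t ^ 2 + pdy u x y t ^ 2) -
      k * x * (Qw γ α y * Dw γ α y) * u x y t ^ q +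
      2 * (k * x * (Pw γ α y * Dw γ α y) * (q * u x y t ^ (q - 1) * pdy u x y t))) -
      (f1 * Hx u k γ α q x y t + f2 * Hy u k γ α q x y t) ≤ Cf u p k γ α q x y t * η := by
    refine le_trans (le_of_eq ?_) hJ
    rw [hf1, hf2]; ring
  rw [e0] at hJ2
  have hfin : (k * x * Dw γ α y * q * u x y t ^ (q - 1) *
        (pdt u x y t - (pdxx u x y t + pdyy u x y t)) -
      2 * (k * Dw γ α y * q * u x y t ^ (q - 1) * pdx u x y t) -
      k * x * Dw γ α y * (q * (q - 1) * u x y t ^ (q - 2)) * (pdx u x y t ^ 2 + pdy u x y t ^ 2) -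
      k * x * (Qw γ α y * Dw γ α y) * u x y t ^ q +
      2 * (k * x * (Pw γ α y * Dw γ α y) * (q * u x y t ^ (q - 1) * pdy u x y t)))
      + (-(F1 * Hx u k γ α q x y t) - F2 * Hy u k γ α q x y t) < ε := by linarith
  have hfin2 := mul_lt_mul_of_pos_left hfin hh
  refine lt_of_le_of_lt ?_ hfin2
  clear hfin2 hfin hJ2 hJ m1 m2 m3 h1 h2 hE
  linarith

end

section

variable {p L T : ℝ} {u : ℝ → ℝ → ℝ → ℝ}

lemma F_cont (hsol : ClassicalSolution p L T u) (hp : 2 < p) {t0 τ : ℝ} (ht0 : 0 < t0) (hτ : τ < T) :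
    ContinuousOn (fun r : ℝ × ℝ × ℝ => p * gradNorm u r.1 r.2.1 r.2.2 ^ (p - 2) *
      pdx u r.1 r.2.1 r.2.2) (box L t0 τ) ∧
    ContinuousOn (fun r : ℝ × ℝ × ℝ => p * gradNorm u r.1 r.2.1 r.2.2 ^ (p - 2) *
      pdy u r.1 r.2.1 r.2.2) (box L t0 τ) := by
  have cp := (box_cg hsol ht0 hτ).rpow_const (p := p - 2) (fun _ _ => Or.inr (by linarith))
  exact ⟨(continuousOn_const.mul cp).mul (box_cx hsol ht0 hτ),
    (continuousOn_const.mul cp).mul (box_cy hsol ht0 hτ)⟩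

set_option maxHeartbeats 800000 in
lemma J_core (hsol : ClassicalSolution p L T u) (hmon : MonCond L T u) (hp : 2 < p)
    {k γ α q x1 y1 t0 h0 : ℝ} (hL : 0 < L)
    (hq : 1 < q) (hk : 0 ≤ k) (hα : 0 ≤ α) (hγ : 1 ≤ q - γ) (hx1 : 0 < x1) (hx1L : x1 < L / 4)
    (hy1L : y1 < L / 4) (hy11 : y1 ≤ 1) (ht0 : 0 < t0) (hh0 : 0 < h0)
    (hP : ∀ y ∈ Ioc 0 y1, 0 ≤ Pw γ α y)
    (hE : ∀ x ∈ Ioo 0 x1, ∀ y ∈ Ioo 0 y1, ∀ t ∈ Ioo t0 T, 0 < u x y t →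
      Ex p k γ α q y (gradNorm u x y t) (u x y t) ≤ 0)
    (hB : ∀ h, 0 < h → h < h0 → ∀ x ∈ Icc 0 x1, ∀ y ∈ Ioc 0 y1, ∀ t ∈ Ico t0 T,
      (t = t0 ∨ x = x1 ∨ y = y1) → h * Hf u k γ α q x y t ≤ u x y t - u (x + h) y t) :
    ∀ x ∈ Ioo 0 x1, ∀ y ∈ Ioo 0 y1, ∀ t ∈ Ioo t0 T, pdx u x y t + Hf u k γ α q x y t ≤ 0 := by
  intro X hX Y hY τ hτ
  apply eps_lim (c := 1 + (τ - t0))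
  intro ε hε
  obtain ⟨M, hM0, hM⟩ := grad_bdd_compact hsol ht0 hτ.2
  set A := 2 * k * x1 * M ^ q with hA
  have hA0 : 0 ≤ A := by positivity
  obtain ⟨y0, hy0, hy0Y, hy0ε⟩ : ∃ y0 > 0, y0 ≤ Y ∧ A * y0 ≤ ε := by
    refine ⟨min Y (ε / (A + 1)), lt_min hY.1 (by positivity), min_le_left _ _, ?_⟩
    calc A * min Y (ε / (A + 1)) ≤ A * (ε / (A + 1)) := by
          gcongr; exact min_le_right _ _
      _ = ε * (A / (A + 1)) := by ring
      _ ≤ ε * 1 := by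
          gcongr
          rw [div_le_one (by linarith)]; linarith
      _ = ε := mul_one _
  obtain ⟨hHc, K, hK0, hK⟩ := K_cont hsol (k := k) (γ := γ) (α := α) (q := q) (x1 := x1) (y0 := y0)
    (y1 := y1) (t0 := t0) (τ := τ) hp hq (by linarith) hy0 (by linarith) ht0 hτ.2
  set η := ε / (2 * K) with hη
  have hη0 : 0 < η := by positivity
  have hKη : K * η < ε := by
    have : K * η = ε / 2 := by rw [hη]; field_simp
    linarith
  obtain ⟨c1, c2⟩ := F_cont hsol hp ht0 hτ.2
  obtain ⟨δ1, hδ1, u1⟩ := box_unif c1 hη0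
  obtain ⟨δ2, hδ2, u2⟩ := box_unif c2 hη0
  obtain ⟨δ3, hδ3, u3⟩ := box_unif (box_cx hsol ht0 hτ.2) hη0
  have hd := cs_dx hsol (x := X) (y := Y) (t := τ) (abs_le.2 ⟨by linarith [hX.1], by linarith [hX.2]⟩)
    ⟨hY.1.le, by linarith [hY.2]⟩ ⟨ht0.trans hτ.1, hτ.2⟩
  suffices hs : pdx u X Y τ ≤ -Hf u k γ α q X Y τ + ε * (1 + (τ - t0)) by linarith
  refine deriv_le_of hd (δ := min h0 (min (L / 4) (min δ1 (min δ2 δ3)))) ?_ ?_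
  · simp only [lt_min_iff]; exact ⟨hh0, by linarith, hδ1, hδ2, hδ3⟩
  intro h hh hhδ
  simp only [lt_min_iff] at hhδ
  obtain ⟨n0, nL, n1, n2, n3⟩ := hhδ
  have key := transP hsol (hx := h) (hy := 0) (x0 := 0) (x1 := x1) (y0 := y0) (y1 := y1)
      (s0 := t0) (s1 := τ) (ε := h * ε) (b := h * ε) (Φ := fun x y t => h * Hf u k γ α q x y t)
      (by linarith) (by linarith) (by linarith) (by linarith) (by linarith)
      (by linarith) (by linarith) (by linarith) ht0 hτ.2 (continuousOn_const.mul hHc)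
      ?_ (by positivity) ?_ X ⟨hX.1.le, hX.2.le⟩ Y ⟨hy0Y, hY.2.le⟩ τ ⟨hτ.1.le, le_rfl⟩
  · rw [add_zero] at key
    linarith
  · intro x hx y hy t ht hbd
    rw [add_zero]
    have htT : t ∈ Ioo 0 T := ⟨ht0.trans_le ht.1, ht.2.trans_lt hτ.2⟩
    have hhε : 0 < h * ε := by positivity
    have han := u_anti hsol hmon (a := x) (b := x + h) (y := y) (t := t) hx.1 (by linarith)
      (by linarith [hx.2]) ⟨by linarith [hy.1], by linarith [hy.2]⟩ htT
    have hBd := hB h hh n0 x hx y ⟨by linarith [hy.1], hy.2⟩ t ⟨ht.1, htT.2⟩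
    rcases hbd with e | e | e | e | e
    · have : Hf u k γ α q x y t = 0 := by unfold Hf; rw [e]; ring
      rw [this]; linarith
    · have := hBd (Or.inr (Or.inl e)); linarith
    · have hul := u_lin hsol (x := x) (y := y) (t := t) (M := M)
        (abs_lt.2 ⟨by linarith [hx.1], by linarith [hx.2]⟩)
        ⟨by linarith [hy.1], by linarith [hy.2]⟩ htT (fun r hr =>
          hM x r t (abs_le.2 ⟨by linarith [hx.1], by linarith [hx.2]⟩)
          ⟨hr.1, by linarith [hr.2, hy.2]⟩ ht)
      have hu0 := hsol.nonneg (x := x) (y := y) (t := t)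
        (abs_le.2 ⟨by linarith [hx.1], by linarith [hx.2]⟩)
        ⟨by linarith [hy.1], by linarith [hy.2]⟩ htT
      have hbb := Hbound (γ := γ) (a := α) (q := q) (y := y) (v := u x y t) (M := M)
        (by linarith [hy.1]) (by linarith [hy.2]) hα hu0 hM0.le hul (by linarith) hγ
      have hH : Hf u k γ α q x y t ≤ ε := by
        calc Hf u k γ α q x y t = k * x * (Dw γ α y * u x y t ^ q) := by unfold Hf; ring
          _ ≤ k * x1 * (2 * M ^ q * y) := by
            apply mul_le_mul _ hbb (mul_nonneg (Dw_pos (by linarith [hy.1])).le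
              (Real.rpow_nonneg hu0 _)) (by positivity)
            exact mul_le_mul_of_nonneg_left hx.2 hk
          _ = A * y0 := by rw [hA, e]; ring
          _ ≤ ε := hy0ε
      have := mul_le_mul_of_nonneg_left hH hh.le
      linarith
    · have := hBd (Or.inr (Or.inr e)); linarith
    · have := hBd (Or.inl e); linarith
  · intro x hx y hy t ht hpos
    simp only [add_zero] at hpos ⊢
    have htT : t ∈ Ioo 0 T := ⟨ht0.trans ht.1, ht.2.trans_lt hτ.2⟩
    have hhε : 0 < h * ε := by positivity
    have hxL : |x| ≤ L := abs_le.2 ⟨by linarith [hx.1], by linarith [hx.2]⟩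
    have hxhL : |x + h| ≤ L := abs_le.2 ⟨by linarith [hx.1], by linarith [hx.2]⟩
    have hyp : 0 < y := hy0.trans hy.1
    have hyL : y ∈ Icc 0 L := ⟨hyp.le, by linarith [hy.2]⟩
    have han := u_anti hsol hmon (a := x) (b := x + h) (y := y) (t := t) hx.1.le (by linarith)
      (by linarith [hx.2]) ⟨hyp.le, by linarith [hy.2]⟩ htT
    have hu0 : 0 < u x y t := by
      rcases (hsol.nonneg hxL hyL htT).eq_or_lt with e | e
      · exfalso
        have : Hf u k γ α q x y t = 0 := by
          unfold Hf; rw [← e, Real.zero_rpow (by linarith), mul_zero]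
        rw [this] at hpos; linarith
      · exact e
    have hxx : |x - (x + h)| = h := by
      rw [show x - (x + h) = -h by ring, abs_neg, abs_of_pos hh]
    have ht' : t ∈ Icc t0 τ := ⟨ht.1.le, ht.2⟩
    have ha : -(Hf u k γ α q x y t) - η ≤ pdx u x y t := by
      obtain ⟨ξ, hξ, hξe⟩ := exists_hasDerivAt_eq_slope (fun s => u s y t) (fun s => pdx u s y t)
        (show x < x + h by linarith)
        (fun s hs => (cs_dx hsol (abs_le.2 ⟨by linarith [hs.1, hx.1], by linarith [hs.2, hx.2]⟩)
          hyL htT).continuousAt.continuousWithinAt)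
        (fun s hs => cs_dx hsol (abs_le.2 ⟨by linarith [hs.1, hx.1], by linarith [hs.2, hx.2]⟩)
          hyL htT)
      have hξL : |ξ| ≤ L := abs_le.2 ⟨by linarith [hξ.1, hx.1], by linarith [hξ.2, hx.2]⟩
      have k1 := u3 ξ y t x y hξL hyL hxL hyL ht'
        (by rw [abs_lt]; constructor <;> linarith [hξ.1, hξ.2]) (by simpa using hδ3)
      simp only at k1 hξe
      have k2 := (abs_lt.1 k1).2
      have k3 : -(Hf u k γ α q x y t) ≤ pdx u ξ y t := by
        rw [hξe, le_div_iff₀ (by linarith)]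
        have : -Hf u k γ α q x y t * (x + h - x) = -(h * Hf u k γ α q x y t) := by ring
        linarith
      linarith
    have v1 := u1 x y t (x + h) y hxL hyL hxhL hyL ht' (by rw [hxx]; exact n1)
      (by simpa using hδ1)
    have v2 := u2 x y t (x + h) y hxL hyL hxhL hyL ht' (by rw [hxx]; exact n2)
      (by simpa using hδ2)
    simp only at v1 v2
    rw [abs_sub_comm] at v1 v2
    have cu := cs_cu hsol hxL hyL htT
    have evx : ∀ᶠ s in nhds x, 0 < u s y t := by
      have : ContinuousAt (fun s => u s y t) x := (cs_dx hsol hxL hyL htT).continuousAt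
      exact this.eventually (lt_mem_nhds hu0)
    have evy : ∀ᶠ s in nhds y, 0 < u x s t := by
      have : ContinuousAt (fun s => u x s t) y := (cs_dy hsol hxL hyL htT).continuousAt
      exact this.eventually (lt_mem_nhds hu0)
    refine ⟨fun s => h * Hx u k γ α q s y t, fun s => h * Hy u k γ α q x s t, _, _, _, ?_,
      (Hx_dx hsol hxL hyL htT hu0).const_mul h, ?_,
      (Hy_dy hsol hxL ⟨hyp, hyL.2⟩ htT hu0).const_mul h,
      (Hf_dt hsol hxL hyL htT hu0).const_mul h, ?_⟩
    · filter_upwards [evx, Ioo_mem_nhds hx.1 hx.2] with s hs hs2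
      exact (Hf_dx hsol (abs_le.2 ⟨by linarith [hs2.1], by linarith [hs2.2]⟩) hyL htT hs).const_mul h
    · filter_upwards [evy, Ioo_mem_nhds hy.1 hy.2] with s hs hs2
      exact (Hf_dy hsol hxL ⟨by linarith [hs2.1], by linarith [hs2.2]⟩ htT hs).const_mul h
    · intro d1 d2
      exact J_int hsol hp hq hx.1 (by linarith [hx.2]) ⟨hyp, by linarith [hy.2]⟩ htT hu0 hk
        (hP y ⟨hyp, hy.2.le⟩) (hE x hx y ⟨hyp, hy.2⟩ t ⟨ht.1, htT.2⟩ hu0) ha hh hη0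
        (hK x ⟨hx.1.le, hx.2.le⟩ y ⟨hy.1.le, hy.2.le⟩ t ht') hKη v1.le v2.le d1 d2

end

section

variable {p L T : ℝ} {u : ℝ → ℝ → ℝ → ℝ}

lemma u_upper (hL : 0 < L) (hsol : ClassicalSolution p L T u) {β d C x y t : ℝ}
    (hβ1 : β < 1) (hx : |x| ≤ L / 2) (hy : y ∈ Ioc 0 (L / 2)) (ht : t ∈ Ioo 0 T)
    (hg : ∀ s ∈ Ioc 0 (L / 2), pdy u x s t ≤ d * s ^ (-β) + C) :
    u x y t ≤ d / (1 - β) * y ^ (1 - β) + C * y := by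
  set f : ℝ → ℝ := fun s => u x s t - (d / (1 - β) * s ^ (1 - β) + C * s) with hf
  have hder : ∀ s ∈ Ioo 0 (L / 2), HasDerivAt f (pdy u x s t - (d * s ^ (-β) + C)) s := by
    intro s hs
    have h1 := cs_dy hsol (x := x) (y := s) (t := t) (by linarith) ⟨hs.1.le, by linarith [hs.2]⟩ ht
    have h2 := (U_der (d := d) hβ1 hs.1).add ((hasDerivAt_id s).const_mul C)
    exact (h1.sub h2).congr_deriv (by simp)
  have hanti : AntitoneOn f (Icc 0 (L / 2)) := by
    apply antitoneOn_of_deriv_nonpos (convex_Icc _ _)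
    · intro s hs
      have h1 := (cs_dy hsol (x := x) (y := s) (t := t) (by linarith)
        ⟨hs.1, by linarith [hs.2]⟩ ht).continuousAt
      have h2 : ContinuousAt (fun s : ℝ => s ^ (1 - β)) s :=
        Real.continuousAt_rpow_const s (1 - β) (Or.inr (by linarith))
      exact (h1.sub ((continuousAt_const.mul h2).add
        (continuousAt_const.mul continuousAt_id))).continuousWithinAt
    · rw [interior_Icc]
      intro s hs
      exact (hder s hs).differentiableAt.differentiableWithinAt
    · rw [interior_Icc]
      intro s hs
      rw [(hder s hs).deriv]
      linarith [hg s ⟨hs.1, hs.2.le⟩]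
  have := hanti (a := 0) (b := y) ⟨le_rfl, by linarith⟩ ⟨hy.1.le, hy.2⟩ hy.1.le
  simp only [hf] at this
  rw [hsol.bc (by linarith) ht, Real.zero_rpow (by linarith)] at this
  linarith

lemma J_main (hp : 2 < p) (hp3 : p ≤ 3) {q β : ℝ} (hβ : β * (p - 1) = 1)
    (hq : p - 1 < q) (hL : 0 < L) (hT : 0 < T)
    (hsol : ClassicalSolution p L T u) (hgbu : IsolatedGBU L T u)
    (hmon : MonCond L T u) :
    ∃ k x1 y1 t0 : ℝ, 0 < k ∧ k < 1 ∧ 0 < x1 ∧ x1 < L ∧ 0 < y1 ∧ y1 ≤ 1 ∧ y1 < L ∧ 0 < t0 ∧ t0 < T ∧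
      ∀ x ∈ Ioo 0 x1, ∀ y ∈ Ioo 0 y1, ∀ t ∈ Ioo t0 T,
        pdx u x y t + Hf u k (q * (1 - β)) (β / 2) q x y t ≤ 0 := by
  have hβ0 : 0 < β := by
    by_contra h
    have : β * (p - 1) ≤ 0 := mul_nonpos_of_nonpos_of_nonneg (not_lt.1 h) (by linarith)
    linarith
  have hβ1 : β < 1 := by nlinarith
  have hqβ : 1 < q * β := by nlinarith
  have hq1 : 1 < q := by linarith
  have hb : 0 < 1 - β := by linarith
  obtain ⟨M, hM0, hM⟩ := bdry_const hL hT hsol hgbu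
  have hpx := pdx_bdd hL hT hsol hM0 hM
  have hpl := pdy_lower hL hT hsol hM0 hM
  have hpu := pdy_upper hp hβ hL hT hsol hM0 hM
  have hd0 : 0 < β ^ β := Real.rpow_pos_of_pos hβ0 _
  have hG : ∀ x y t : ℝ, |x| ≤ L / 2 → y ∈ Ioc 0 (L / 2) → t ∈ Ico (T / 2) T →
      gradNorm u x y t ≤ β ^ β * y ^ (-β) + (2 * M + 1) := by
    intro x y t hx hy ht
    have h1 := hpx x y t hx ⟨hy.1.le, hy.2⟩ ht
    have h2 := hpl x y t hx hy ht
    have h3 := hpu x y t hx hy ht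
    have h4 : 0 < β ^ β * y ^ (-β) := mul_pos hd0 (Real.rpow_pos_of_pos hy.1 _)
    have h5 : |pdy u x y t| ≤ β ^ β * y ^ (-β) + (M + 1) := abs_le.2 ⟨by linarith, h3⟩
    linarith [gradNorm_le (u := u) x y t]
  have hU : ∀ x y t : ℝ, |x| ≤ L / 2 → y ∈ Ioc 0 (L / 2) → t ∈ Ico (T / 2) T →
      u x y t ≤ β ^ β / (1 - β) * y ^ (1 - β) + (2 * M + 1) * y := by
    intro x y t hx hy ht
    refine u_upper hL hsol hβ1 hx hy ⟨by linarith [ht.1], ht.2⟩ (fun s hs => ?_)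
    linarith [hpu x s t hx hs ht]
  obtain ⟨ya, hya, hya1, hlem⟩ := lemE (C0 := 2 * M + 1) hp hp3 hβ hq (by linarith)
  obtain ⟨yb, hyb, hPw⟩ := Pw_nonneg (γ := q * (1 - β)) (β := β) (by positivity) hβ0 hβ1
  obtain ⟨x1, y1, t0, c, h0, hx1, hx1L, hy1, hy1L, hy1m, ht0, ht0T, hc, hh0, hbd⟩ :=
    hopf_main hp hL hT hsol hgbu hmon (lt_min hya hyb)
  obtain ⟨hy1a, hy1b⟩ := le_min_iff.1 hy1m
  obtain ⟨M1, hM1, o1⟩ := outer_bdd hgbu hx1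
  obtain ⟨M2, hM2, o2⟩ := grad_bdd_compact hsol (t1 := t0) (t2 := t0) (by linarith) ht0T
  set M3 := (β ^ β / (1 - β) * y1 ^ (1 - β) + (2 * M + 1) * y1) / y1 with hM3
  have hM30 : 0 < M3 := by positivity
  set N := M1 + M2 + M3 with hN
  have hN0 : 0 < N := by positivity
  have hub : ∀ x ∈ Icc 0 x1, ∀ y ∈ Ioc 0 y1, ∀ t ∈ Ico t0 T, (t = t0 ∨ x = x1 ∨ y = y1) →
      u x y t ≤ N * y := by
    intro x hx y hy t ht hcase
    have hxL : |x| < L := abs_lt.2 ⟨by linarith [hx.1], by linarith [hx.2]⟩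
    have htT : t ∈ Ioo 0 T := ⟨by linarith [ht.1], ht.2⟩
    rcases hcase with e | e | e
    · have := u_lin hsol (x := x) (y := y) (t := t) (M := M2) hxL ⟨hy.1.le, by linarith [hy.2]⟩ htT
        (fun r hr => o2 x r t hxL.le ⟨hr.1, by linarith [hr.2, hy.2]⟩ ⟨ht.1, e.le⟩)
      refine this.trans (mul_le_mul_of_nonneg_right (by linarith) hy.1.le)
    · have := u_lin hsol (x := x) (y := y) (t := t) (M := M1) hxL ⟨hy.1.le, by linarith [hy.2]⟩ htT
        (fun r hr => o1 x r t hxL.le ⟨hr.1, by linarith [hr.2, hy.2]⟩ htT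
          (Or.inl (by rw [abs_of_nonneg hx.1, e])))
      refine this.trans (mul_le_mul_of_nonneg_right (by linarith) hy.1.le)
    · have := hU x y t (abs_le.2 ⟨by linarith [hx.1], by linarith [hx.2]⟩)
        ⟨hy.1, by linarith [hy.2]⟩ ⟨by linarith [ht.1], ht.2⟩
      have e2 : M3 * y = β ^ β / (1 - β) * y ^ (1 - β) + (2 * M + 1) * y := by
        rw [hM3, e]; field_simp
      rw [← e2] at this
      refine this.trans (mul_le_mul_of_nonneg_right (by linarith) hy.1.le)
  obtain ⟨k, hk0, hk1, hkc⟩ : ∃ k > 0, k ≤ 1 / 2 ∧ k * (2 * N ^ q) ≤ c := by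
    refine ⟨min (1 / 2) (c / (2 * N ^ q)), lt_min (by norm_num) (by positivity), min_le_left _ _, ?_⟩
    have hNq : 0 < 2 * N ^ q := by positivity
    calc _ ≤ c / (2 * N ^ q) * (2 * N ^ q) := by
          gcongr; exact min_le_right _ _
      _ = c := by field_simp
  refine ⟨k, x1, y1, t0, hk0, by linarith, hx1, by linarith, hy1, by linarith, by linarith,
    by linarith, ht0T, ?_⟩
  refine J_core hsol hmon hp (h0 := h0) hL hq1 hk0.le (by linarith) (by linarith) hx1 hx1L hy1L
    (by linarith) (by linarith) hh0 (fun y hy => hPw y hy.1 (hy.2.trans hy1b)) ?_ ?_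
  · intro x hx y hy t ht hu
    have hx' : |x| ≤ L / 2 := abs_le.2 ⟨by linarith [hx.1], by linarith [hx.2]⟩
    have hy' : y ∈ Ioc 0 (L / 2) := ⟨hy.1, by linarith [hy.2]⟩
    have ht' : t ∈ Ico (T / 2) T := ⟨by linarith [ht.1], ht.2⟩
    exact hlem y (gradNorm u x y t) (u x y t) k hy.1 (by linarith [hy.2]) (gradNorm_nonneg x y t) hu
      (hG x y t hx' hy' ht') (hU x y t hx' hy' ht') hk0.le (by linarith)
  · intro h hh hhh x hx y hy t ht hcase
    refine le_trans ?_ (hbd h hh hhh x hx y ⟨hy.1.le, hy.2⟩ t ht hcase)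
    apply mul_le_mul_of_nonneg_left _ hh.le
    have hu0 := hsol.nonneg (x := x) (y := y) (t := t)
      (abs_le.2 ⟨by linarith [hx.1], by linarith [hx.2]⟩)
      ⟨hy.1.le, by linarith [hy.2]⟩ ⟨by linarith [ht.1], ht.2⟩
    have hbb := Hbound (γ := q * (1 - β)) (a := β / 2) (q := q) (y := y) (v := u x y t) (M := N)
      hy.1 (by linarith [hy.2]) (by linarith) hu0 hN0.le (hub x hx y hy t ht hcase) (by linarith)
      (by linarith)
    have hkx : 0 ≤ k * x := mul_nonneg hk0.le hx.1
    have hxy : 0 ≤ x * y := mul_nonneg hx.1 hy.1.le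
    calc Hf u k (q * (1 - β)) (β / 2) q x y t
        = k * x * (Dw (q * (1 - β)) (β / 2) y * u x y t ^ q) := by unfold Hf; ring
      _ ≤ k * x * (2 * N ^ q * y) := mul_le_mul_of_nonneg_left hbb hkx
      _ = k * (2 * N ^ q) * (x * y) := by ring
      _ ≤ c * (x * y) := mul_le_mul_of_nonneg_right hkc hxy

end

/-- Proposition 5.1: for `2 < p ≤ 3` and `q > p-1`, there are `k ∈ (0,1)` and
`x₁, y₁, σ > 0` such that `u_x + k x y^{-q(1-β)} (1+y) u^q ≤ 0` in
`(0,x₁) × (0,y₁) × (T-σ, T)`, where `β = 1/(p-1)`. -/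
theorem J_nonpositive (p q L T : ℝ) (hp : 2 < p) (hp3 : p ≤ 3)
    (hq : p - 1 < q) (hL : 0 < L) (hT : 0 < T) (u : ℝ → ℝ → ℝ → ℝ)
    (hsol : ClassicalSolution p L T u) (hgbu : IsolatedGBU L T u)
    (hmon : MonCond L T u) :
    ∃ k x₁ y₁ σ : ℝ, 0 < k ∧ k < 1 ∧ 0 < x₁ ∧ 0 < y₁ ∧ 0 < σ ∧
      ∀ x y t : ℝ, x ∈ Ioo (0:ℝ) x₁ → y ∈ Ioo (0:ℝ) y₁ → t ∈ Ioo (T - σ) T →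
        pdx u x y t +
          k * x * y ^ (-(q * (1 - 1/(p-1)))) * (1 + y) * (u x y t) ^ q ≤ 0 := by
  have hp1 : p - 1 ≠ 0 := by linarith
  obtain ⟨k, x1, y1, t0, hk0, hk1, hx1, hx1L, hy1, hy11, hy1L, ht0, ht0T, hJ⟩ :=
    J_main (β := 1 / (p - 1)) hp hp3 (by field_simp) hq hL hT hsol hgbu hmon
  refine ⟨k / 2, x1, y1, T - t0, by linarith, by linarith, hx1, hy1, by linarith, ?_⟩
  intro x y t hx hy ht
  have ht' : t ∈ Ioo t0 T := ⟨by linarith [ht.1], ht.2⟩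
  refine le_trans (add_le_add le_rfl ?_) (hJ x hx y hy t ht')
  have hu0 := hsol.nonneg (x := x) (y := y) (t := t)
      (abs_le.2 ⟨by linarith [hx.1], by linarith [hx.2]⟩)
      ⟨hy.1.le, by linarith [hy.2]⟩ ⟨by linarith [ht'.1], ht.2⟩
  unfold Hf Dw
  have h1 : 0 ≤ u x y t ^ q := Real.rpow_nonneg hu0 _
  have h2 : 0 < y ^ (-(q * (1 - 1 / (p - 1)))) := Real.rpow_pos_of_pos hy.1 _
  have h3 : 0 < y ^ (1 / (p - 1) / 2) := Real.rpow_pos_of_pos hy.1 _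
  generalize y ^ (-(q * (1 - 1 / (p - 1)))) = D at *
  generalize y ^ (1 / (p - 1) / 2) = Z at *
  generalize u x y t ^ q = V at *
  have h4 : 0 ≤ k * x * D * V := mul_nonneg (mul_pos (mul_pos hk0 hx.1) h2).le h1
  have h5 : (1 + y) / 2 ≤ 1 + Z := by linarith [hy.2]
  calc k / 2 * x * D * (1 + y) * V = k * x * D * V * ((1 + y) / 2) := by ring
    _ ≤ k * x * D * V * (1 + Z) := mul_le_mul_of_nonneg_left h5 h4
    _ = k * x * (D * (1 + Z)) * V := by ring
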